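/- arXiv:2411.17574 — 2 statements merged into one kernel-verified Lean document; each statement's English description precedes it below -/
import Mathlib

section
/- Let V ⊂ ℝ¹⁰ be the set of 18 points e₁, e₂, e₃, e₄, −(e₁+e₂+e₃+e₄), e₅, e₆, e₇, e₈, −(e₅+e₆+e₇+e₈), e₉, −e₉, e₁₀, −e₁₀, e₁+e₅, e₁+e₅+e₉, e₂+e₆, e₂+e₆+e₁₀, and define P = {x ∈ ℝ¹⁰ : ⟨x, v⟩ ≥ −1 for every v ∈ V}. Then, with respect to Lebesgue measure, ∫_P x_i dx = 74830759/302400 for i ∈ {1, 2, 5, 6}, ∫_P x_i dx = −74830759/453600 for i ∈ {3, 4, 7, 8}, and ∫_P x_i dx = 70493741/604800 for i ∈ {9, 10}. -/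
noncomputable section

open MeasureTheory
open scoped RealInnerProductSpace

/-- The standard basis vectors of `ℝ¹⁰`. -/
def ee (i : Fin 10) : EuclideanSpace ℝ (Fin 10) := EuclideanSpace.single i 1

/-- The 18 points `e₁, e₂, e₃, e₄, −(e₁+e₂+e₃+e₄), e₅, e₆, e₇, e₈, −(e₅+e₆+e₇+e₈),
e₉, −e₉, e₁₀, −e₁₀, e₁+e₅, e₁+e₅+e₉, e₂+e₆, e₂+e₆+e₁₀` (0-indexed here). -/
def V18 : Set (EuclideanSpace ℝ (Fin 10)) :=
  {ee 0, ee 1, ee 2, ee 3, -(ee 0 + ee 1 + ee 2 + ee 3),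
   ee 4, ee 5, ee 6, ee 7, -(ee 4 + ee 5 + ee 6 + ee 7),
   ee 8, -ee 8, ee 9, -ee 9,
   ee 0 + ee 4, ee 0 + ee 4 + ee 8,
   ee 1 + ee 5, ee 1 + ee 5 + ee 9}

/-- The moment polytope `P = {x ∈ ℝ¹⁰ : ⟪x, v⟫ ≥ −1 for every v ∈ V18}`. -/
def P : Set (EuclideanSpace ℝ (Fin 10)) := {x | ∀ v ∈ V18, ⟪x, v⟫ ≥ -1}


/-! ### General integration lemmas -/

/-- A continuous function restricted to a bounded measurable set is integrable. -/
lemma integrable_ind {E : Type*} [NormedAddCommGroup E] [ProperSpace E] [MeasureSpace E]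
    [BorelSpace E] [IsFiniteMeasureOnCompacts (volume : Measure E)] {S : Set E} (R : ℝ)
    (hS : MeasurableSet S) (hR : ∀ z ∈ S, ‖z‖ ≤ R) {g : E → ℝ} (hg : Continuous g) :
    Integrable (S.indicator g) := by
  rw [integrable_indicator_iff hS]
  refine IntegrableOn.mono_set (t := Metric.closedBall 0 R) ?_ ?_
  · exact hg.continuousOn.integrableOn_compact (isCompact_closedBall _ _)
  · intro z hz
    simpa using hR z hz

/-- The standard triangle of size `c`. -/
def Tri (c : ℝ) : Set (ℝ × ℝ) := {p | 0 ≤ p.1 ∧ 0 ≤ p.2 ∧ p.1 + p.2 ≤ c}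

lemma isClosed_Tri (c : ℝ) : IsClosed (Tri c) := by
  have h1 : IsClosed {p : ℝ × ℝ | 0 ≤ p.1} := isClosed_le (by fun_prop) (by fun_prop)
  have h2 : IsClosed {p : ℝ × ℝ | 0 ≤ p.2} := isClosed_le (by fun_prop) (by fun_prop)
  have h3 : IsClosed {p : ℝ × ℝ | p.1 + p.2 ≤ c} := isClosed_le (by fun_prop) (by fun_prop)
  exact h1.and (h2.and h3)

lemma measurableSet_Tri (c : ℝ) : MeasurableSet (Tri c) := (isClosed_Tri c).measurableSet

lemma norm_le_of_mem_Tri {c : ℝ} {p : ℝ × ℝ} (hp : p ∈ Tri c) : ‖p‖ ≤ c := by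
  obtain ⟨h1, h2, h3⟩ := hp
  rw [Prod.norm_def, Real.norm_of_nonneg h1, Real.norm_of_nonneg h2]
  exact max_le (by linarith) (by linarith)

lemma integrable_Tri (c : ℝ) {g : ℝ × ℝ → ℝ} (hg : Continuous g) :
    Integrable ((Tri c).indicator g) :=
  integrable_ind c (measurableSet_Tri c) (fun _ h => norm_le_of_mem_Tri h) hg

/-- Integral of the indicator of an interval as an interval integral. -/
lemma integral_Icc_ite {a b : ℝ} (hab : a ≤ b) (g : ℝ → ℝ) :
    (∫ x, (Set.Icc a b).indicator g x) = ∫ x in a..b, g x := by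
  rw [integral_indicator measurableSet_Icc, integral_Icc_eq_integral_Ioc,
    intervalIntegral.integral_of_le hab]

/-- First slice of a triangle. -/
lemma slice_Tri (c a : ℝ) (ha : 0 ≤ a) (hac : a ≤ c) (g : ℝ × ℝ → ℝ) :
    (∫ b, (Tri c).indicator g (a, b)) = ∫ b in (0)..(c - a), g (a, b) := by
  rw [← integral_Icc_ite (by linarith)]
  congr 1; ext b
  by_cases h : (a, b) ∈ Tri c
  · rw [Set.indicator_of_mem h, Set.indicator_of_mem]
    obtain ⟨h1, h2, h3⟩ := h
    simp only at h1 h2 h3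
    exact ⟨h2, by linarith⟩
  · rw [Set.indicator_of_notMem h, Set.indicator_of_notMem]
    rintro ⟨h1, h2⟩
    exact h ⟨ha, h1, by simp only; linarith⟩

/-- Second slice of a triangle. -/
lemma slice_Tri' (c b : ℝ) (hb : 0 ≤ b) (hbc : b ≤ c) (g : ℝ × ℝ → ℝ) :
    (∫ a, (Tri c).indicator g (a, b)) = ∫ a in (0)..(c - b), g (a, b) := by
  rw [← integral_Icc_ite (by linarith)]
  congr 1; ext a
  by_cases h : (a, b) ∈ Tri c
  · rw [Set.indicator_of_mem h, Set.indicator_of_mem]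
    obtain ⟨h1, h2, h3⟩ := h
    simp only at h1 h2 h3
    exact ⟨h1, by linarith⟩
  · rw [Set.indicator_of_notMem h, Set.indicator_of_notMem]
    rintro ⟨h1, h2⟩
    exact h ⟨h1, hb, by simp only; linarith⟩

lemma integral_Tri (c : ℝ) (hc : 0 ≤ c) {g : ℝ × ℝ → ℝ} (hg : Continuous g) :
    (∫ p, (Tri c).indicator g p) = ∫ a in (0)..c, ∫ b in (0)..(c - a), g (a, b) := by
  rw [Measure.volume_eq_prod, integral_prod _ (integrable_Tri c hg), ← integral_Icc_ite hc]
  congr 1; ext a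
  by_cases h : a ∈ Set.Icc 0 c
  · rw [Set.indicator_of_mem h, slice_Tri c a h.1 h.2]
  · rw [Set.indicator_of_notMem h]
    rw [← integral_zero ℝ ℝ]
    congr 1; ext b
    rw [Set.indicator_of_notMem]
    rintro ⟨h1, h2, h3⟩
    simp only at h1 h2 h3
    exact h ⟨h1, by linarith⟩

/-- The Beta integral. -/
lemma beta_int (u : ℝ) (j : ℕ) : ∀ i : ℕ,
    (∫ a in (0)..u, a ^ i * (u - a) ^ j) =
      ((i.factorial * j.factorial : ℕ) : ℝ) / ((i + j + 1).factorial : ℕ) * u ^ (i + j + 1) := by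
  induction j with
  | zero =>
    intro i
    simp only [pow_zero, mul_one, integral_pow, Nat.factorial, add_zero]
    have : ((i.factorial : ℕ) : ℝ) ≠ 0 := by exact_mod_cast i.factorial_ne_zero
    push_cast
    field_simp
    simp
  | succ j ih =>
    intro i
    have hp : (∫ a in (0)..u, (u - a) ^ (j + 1) * a ^ i) =
        (u - u) ^ (j + 1) * (u ^ (i + 1) / (i + 1)) - (u - 0) ^ (j + 1) * (0 ^ (i + 1) / (i + 1))
          - ∫ a in (0)..u, (-((j + 1 : ℕ) * (u - a) ^ j)) * (a ^ (i + 1) / (i + 1)) := by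
      apply intervalIntegral.integral_mul_deriv_eq_deriv_mul
      · intro x _
        have := ((hasDerivAt_id x).const_sub u).pow (j + 1)
        convert this using 1
        · rfl
        · simp
      · intro x _
        have := (hasDerivAt_pow (i + 1) x).div_const ((i : ℝ) + 1)
        convert this using 1
        have : (i : ℝ) + 1 ≠ 0 := by positivity
        push_cast
        field_simp
      · apply Continuous.intervalIntegrable; fun_prop
      · apply Continuous.intervalIntegrable; fun_prop
    have hq : (∫ a in (0)..u, (-((j + 1 : ℕ) * (u - a) ^ j)) * (a ^ (i + 1) / (i + 1)))
        = (-((j : ℝ) + 1) / (i + 1)) * ∫ a in (0)..u, a ^ (i + 1) * (u - a) ^ j := by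
      rw [← intervalIntegral.integral_const_mul]
      congr 1; ext a
      push_cast
      ring
    simp_rw [mul_comm (_ ^ i)]
    rw [hp, hq, ih (i + 1)]
    have e : i + 1 + j + 1 = i + (j + 1) + 1 := by ring
    rw [e]
    have h1 : ((i + (j + 1) + 1).factorial : ℝ) ≠ 0 := by exact_mod_cast Nat.factorial_ne_zero _
    rw [Nat.factorial_succ i, Nat.factorial_succ j]
    push_cast
    field_simp
    simp

/-! ### Moments of kernels -/

/-- Kernel times monomial on the triangle of size two. -/
def kap (k : ℝ → ℝ) (i j : ℕ) (p : ℝ × ℝ) : ℝ :=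
  k (p.1 + p.2) * (Tri 2).indicator (fun p => p.1 ^ i * p.2 ^ j) p

/-- A kernel: bounded and measurable. -/
def Ker (k : ℝ → ℝ) : Prop := Measurable k ∧ ∀ u, |k u| ≤ 2

lemma Ker.integrable_mul {k : ℝ → ℝ} (hk : Ker k) {E : Type*} [MeasureSpace E] {h f : E → ℝ}
    (hh : Measurable h) (hf : Integrable f) : Integrable (fun z => k (h z) * f z) := by
  refine Integrable.bdd_mul (c := 2) hf ?_ ?_
  · exact (hk.1.comp hh).aestronglyMeasurable
  · exact Filter.Eventually.of_forall fun z => by simpa using hk.2 (h z)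

lemma integrable_kap {k : ℝ → ℝ} (hk : Ker k) (i j : ℕ) : Integrable (kap k i j) :=
  hk.integrable_mul (h := fun p : ℝ × ℝ => p.1 + p.2) (by fun_prop)
    (integrable_Tri 2 (by fun_prop))

lemma mom_eq {k : ℝ → ℝ} (hk : Ker k) (i j : ℕ) :
    (∫ p, kap k i j p) = ((i.factorial * j.factorial : ℕ) : ℝ) / ((i + j + 1).factorial : ℕ) *
      ∫ u in (0)..2, k u * u ^ (i + j + 1) := by
  rw [Measure.volume_eq_prod, integral_prod _ (integrable_kap hk i j)]
  have h1 : ∀ a : ℝ, (∫ b, kap k i j (a, b)) = ∫ u, kap k i j (a, u - a) := fun a =>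
    (integral_sub_right_eq_self (fun b => kap k i j (a, b)) a).symm
  simp_rw [h1]
  have h2 : ∀ a u : ℝ, kap k i j (a, u - a) = k u *
      ({p : ℝ × ℝ | 0 ≤ p.1 ∧ p.1 ≤ p.2 ∧ p.2 ≤ 2}.indicator
        (fun p => p.1 ^ i * (p.2 - p.1) ^ j) (a, u)) := by
    intro a u
    unfold kap
    simp only [add_sub_cancel]
    congr 1
    simp only [Set.indicator, Tri, Set.mem_ofPred_eq, add_sub_cancel, sub_nonneg]
  simp_rw [h2]
  rw [integral_integral_swap]
  · rw [← intervalIntegral.integral_const_mul, ← integral_Icc_ite (by norm_num)]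
    congr 1; ext u
    rw [integral_const_mul]
    by_cases hu : u ∈ Set.Icc (0 : ℝ) 2
    · rw [Set.indicator_of_mem hu, mul_left_comm, ← beta_int, ← integral_Icc_ite hu.1]
      congr 2; ext a
      simp only [Set.indicator, Set.mem_ofPred_eq, Set.mem_Icc, hu.2, and_true]
    · rw [Set.indicator_of_notMem hu]
      have : ∀ a : ℝ, ({p : ℝ × ℝ | 0 ≤ p.1 ∧ p.1 ≤ p.2 ∧ p.2 ≤ 2}.indicator
        (fun p => p.1 ^ i * (p.2 - p.1) ^ j) (a, u)) = 0 := by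
        intro a
        rw [Set.indicator_of_notMem]
        rintro ⟨h1, h2, h3⟩
        simp only at h1 h2 h3
        exact hu ⟨by linarith, h3⟩
      simp [this]
  · refine hk.integrable_mul (h := fun p : ℝ × ℝ => p.2) (by fun_prop)
      (f := ({p : ℝ × ℝ | 0 ≤ p.1 ∧ p.1 ≤ p.2 ∧ p.2 ≤ 2}.indicator
        (fun p => p.1 ^ i * (p.2 - p.1) ^ j))) ?_
    refine integrable_ind 2 ?_ ?_ (by fun_prop)
    · have h1 : MeasurableSet {p : ℝ × ℝ | 0 ≤ p.1} :=
        measurableSet_le (by fun_prop) (by fun_prop)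
      have h2 : MeasurableSet {p : ℝ × ℝ | p.1 ≤ p.2} :=
        measurableSet_le (by fun_prop) (by fun_prop)
      have h3 : MeasurableSet {p : ℝ × ℝ | p.2 ≤ 2} :=
        measurableSet_le (by fun_prop) (by fun_prop)
      exact h1.inter (h2.inter h3)
    · rintro ⟨a, u⟩ ⟨h1, h2, h3⟩
      simp only at h1 h2 h3
      rw [Prod.norm_def, Real.norm_of_nonneg h1, Real.norm_of_nonneg (h1.trans h2)]
      exact max_le (h2.trans h3) h3

/-- The defect kernel `2 - L`. -/
def kK (u : ℝ) : ℝ := if u < 1 then 2 else if u ≤ 2 then 2 - u else 0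

/-- The first moment kernel. -/
def kM (u : ℝ) : ℝ := if u < 1 then 0 else if u ≤ 2 then (2 * u - u ^ 2) / 2 else 0

lemma kK_ker : Ker kK := by
  constructor
  · unfold kK
    refine Measurable.ite measurableSet_Iio (by fun_prop)
      (Measurable.ite measurableSet_Iic (by fun_prop) (by fun_prop))
  · intro u
    simp only [kK]
    split_ifs <;> rw [abs_le] <;> constructor <;> linarith

lemma kM_ker : Ker kM := by
  constructor
  · unfold kM
    refine Measurable.ite measurableSet_Iio (by fun_prop)
      (Measurable.ite measurableSet_Iic (by fun_prop) (by fun_prop))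
  · intro u
    simp only [kM]
    split_ifs <;> rw [abs_le] <;> constructor <;> nlinarith


/-! ### Four dimensional integrals -/

/-- Moment data of a kernel supported in `u ≤ 2`. -/
structure HasMom (k : ℝ → ℝ) (f : ℕ → ℚ) : Prop where
  ker : Ker k
  vanish : ∀ u, 2 < u → k u = 0
  mom : ∀ n, (∫ u in (0)..2, k u * u ^ n) = (f n : ℝ)

/-- Rational moments on the triangle. -/
def momQ (f : ℕ → ℚ) (i j : ℕ) : ℚ :=
  ((i.factorial * j.factorial : ℕ) : ℚ) / ((i + j + 1).factorial : ℕ) * f (i + j + 1)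

lemma HasMom.integral_kap {k : ℝ → ℝ} {f : ℕ → ℚ} (h : HasMom k f) (i j : ℕ) :
    (∫ p, kap k i j p) = (momQ f i j : ℝ) := by
  rw [mom_eq h.ker, h.mom, momQ]
  push_cast
  ring

lemma kap_zero {k : ℝ → ℝ} {p : ℝ × ℝ} (hp : p ∉ Tri 2) (i j : ℕ) : kap k i j p = 0 := by
  rw [kap, Set.indicator_of_notMem hp, mul_zero]

lemma kap_mem {k : ℝ → ℝ} {p : ℝ × ℝ} (hp : p ∈ Tri 2) (i j : ℕ) :
    kap k i j p = k (p.1 + p.2) * (p.1 ^ i * p.2 ^ j) := by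
  rw [kap, Set.indicator_of_mem hp]

/-- The product of two triangle functions, with interleaved variables. -/
def SS (g1 g2 : ℝ × ℝ → ℝ) (z : (ℝ × ℝ) × (ℝ × ℝ)) : ℝ :=
  (Tri 5).indicator g1 (z.1.1, z.2.1) * (Tri 5).indicator g2 (z.1.2, z.2.2)

lemma integrable_SS {g1 g2 : ℝ × ℝ → ℝ} (h1 : Continuous g1) (h2 : Continuous g2) :
    Integrable (SS g1 g2) := by
  have e : SS g1 g2 = ({z : (ℝ × ℝ) × (ℝ × ℝ) | (z.1.1, z.2.1) ∈ Tri 5} ∩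
      {z | (z.1.2, z.2.2) ∈ Tri 5}).indicator
        (fun z => g1 (z.1.1, z.2.1) * g2 (z.1.2, z.2.2)) := by
    ext z
    simp only [SS, Set.indicator, Set.mem_inter_iff, Set.mem_ofPred_eq]
    split_ifs <;> simp_all
  rw [e]
  refine integrable_ind 5 ?_ ?_ (by fun_prop)
  · refine MeasurableSet.inter ?_ ?_
    · exact (measurableSet_Tri 5).preimage
        (f := fun z : (ℝ × ℝ) × (ℝ × ℝ) => (z.1.1, z.2.1)) (by fun_prop)
    · exact (measurableSet_Tri 5).preimage
        (f := fun z : (ℝ × ℝ) × (ℝ × ℝ) => (z.1.2, z.2.2)) (by fun_prop)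
  · rintro ⟨⟨a, b⟩, ⟨c, d⟩⟩ ⟨h, h'⟩
    have h := norm_le_of_mem_Tri h
    have h' := norm_le_of_mem_Tri h'
    simp only [Prod.norm_def, sup_le_iff] at h h' ⊢
    exact ⟨⟨h.1, h'.1⟩, h.2, h'.2⟩

lemma SS_zero_left {g1 g2 : ℝ × ℝ → ℝ} {z : (ℝ × ℝ) × (ℝ × ℝ)} {k : ℝ → ℝ}
    (hk : ∀ u, 2 < u → k u = 0) (hz : z.1 ∉ Tri 2) : k (z.1.1 + z.1.2) = 0 ∨ SS g1 g2 z = 0 := by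
  by_cases h : 2 < z.1.1 + z.1.2
  · exact Or.inl (hk _ h)
  · right
    unfold SS
    by_cases h1 : 0 ≤ z.1.1
    · have h2 : ¬ 0 ≤ z.1.2 := fun h2 => hz ⟨h1, h2, not_lt.mp h⟩
      rw [Set.indicator_of_notMem (a := (z.1.2, z.2.2)) (fun h => h2 h.1), mul_zero]
    · rw [Set.indicator_of_notMem (a := (z.1.1, z.2.1)) (fun h => h1 h.1), zero_mul]

lemma SS_zero_right {g1 g2 : ℝ × ℝ → ℝ} {z : (ℝ × ℝ) × (ℝ × ℝ)} {k : ℝ → ℝ}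
    (hk : ∀ u, 2 < u → k u = 0) (hz : z.2 ∉ Tri 2) : k (z.2.1 + z.2.2) = 0 ∨ SS g1 g2 z = 0 := by
  by_cases h : 2 < z.2.1 + z.2.2
  · exact Or.inl (hk _ h)
  · right
    unfold SS
    by_cases h1 : 0 ≤ z.2.1
    · have h2 : ¬ 0 ≤ z.2.2 := fun h2 => hz ⟨h1, h2, not_lt.mp h⟩
      rw [Set.indicator_of_notMem (a := (z.1.2, z.2.2)) (fun h => h2 h.2.1), mul_zero]
    · rw [Set.indicator_of_notMem (a := (z.1.1, z.2.1)) (fun h => h1 h.2.1), zero_mul]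

/-- Doubly truncated integral. -/
lemma JKK {k0 k1 : ℝ → ℝ} {f0 f1 : ℕ → ℚ} (h0 : HasMom k0 f0) (h1 : HasMom k1 f1)
    (I1 I2 : Finset (ℕ × ℕ)) (c d : ℕ × ℕ → ℚ) (g1 g2 : ℝ × ℝ → ℝ)
    (hg1 : ∀ p, g1 p = ∑ s ∈ I1, (c s : ℝ) * (p.1 ^ s.1 * p.2 ^ s.2))
    (hg2 : ∀ p, g2 p = ∑ s ∈ I2, (d s : ℝ) * (p.1 ^ s.1 * p.2 ^ s.2)) :
    (∫ z : (ℝ × ℝ) × (ℝ × ℝ), k0 (z.1.1 + z.1.2) * (k1 (z.2.1 + z.2.2) * SS g1 g2 z)) =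
      ((∑ s ∈ I1, ∑ t ∈ I2, c s * d t * (momQ f0 s.1 t.1 * momQ f1 s.2 t.2) : ℚ) : ℝ) := by
  have key : ∀ z : (ℝ × ℝ) × (ℝ × ℝ),
      k0 (z.1.1 + z.1.2) * (k1 (z.2.1 + z.2.2) * SS g1 g2 z) =
      ∑ s ∈ I1, ∑ t ∈ I2, (c s : ℝ) * d t * (kap k0 s.1 t.1 z.1 * kap k1 s.2 t.2 z.2) := by
    intro z
    by_cases hz1 : z.1 ∈ Tri 2
    · by_cases hz2 : z.2 ∈ Tri 2
      · have m1 : (z.1.1, z.2.1) ∈ Tri 5 := by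
          obtain ⟨h1, h2, h3⟩ := hz1
          obtain ⟨h4, h5, h6⟩ := hz2
          exact ⟨h1, h4, by simp only; linarith⟩
        have m2 : (z.1.2, z.2.2) ∈ Tri 5 := by
          obtain ⟨h1, h2, h3⟩ := hz1
          obtain ⟨h4, h5, h6⟩ := hz2
          exact ⟨h2, h5, by simp only; linarith⟩
        rw [SS, Set.indicator_of_mem m1, Set.indicator_of_mem m2, hg1, hg2,
          Finset.sum_mul_sum, Finset.mul_sum, Finset.mul_sum]
        refine Finset.sum_congr rfl fun s _ => ?_
        rw [Finset.mul_sum, Finset.mul_sum]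
        refine Finset.sum_congr rfl fun t _ => ?_
        rw [kap_mem hz1, kap_mem hz2]
        ring
      · simp_rw [kap_zero hz2]
        rcases SS_zero_right (g1 := g1) (g2 := g2) h1.vanish hz2 with h | h <;> simp [h]
    · simp_rw [kap_zero hz1]
      rcases SS_zero_left (g1 := g1) (g2 := g2) h0.vanish hz1 with h | h <;> simp [h]
  simp_rw [key]
  have hint : ∀ s t : ℕ × ℕ, Integrable (fun z : (ℝ × ℝ) × (ℝ × ℝ) =>
      (c s : ℝ) * d t * (kap k0 s.1 t.1 z.1 * kap k1 s.2 t.2 z.2)) := fun s t =>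
    ((integrable_kap h0.ker s.1 t.1).mul_prod (integrable_kap h1.ker s.2 t.2)).const_mul _
  rw [integral_finsetSum _ fun s _ => integrable_finsetSum _ fun t _ => hint s t]
  push_cast
  refine Finset.sum_congr rfl fun s _ => ?_
  rw [integral_finsetSum _ fun t _ => hint s t]
  refine Finset.sum_congr rfl fun t _ => ?_
  rw [integral_const_mul, Measure.volume_eq_prod, integral_prod_mul (kap k0 s.1 t.1),
    h0.integral_kap, h1.integral_kap]

lemma integral_kap_sum {k : ℝ → ℝ} {f : ℕ → ℚ} (hk : HasMom k f) (m n : ℕ) (C D : ℕ → ℚ)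
    (σ1 σ2 : ℝ → ℝ)
    (h1 : ∀ a, 0 ≤ a → a ≤ 5 → σ1 a = ∑ s ∈ Finset.range m, (C s : ℝ) * a ^ s)
    (h2 : ∀ a, 0 ≤ a → a ≤ 5 → σ2 a = ∑ s ∈ Finset.range n, (D s : ℝ) * a ^ s)
    (h1' : ∀ a, ¬ 0 ≤ a → σ1 a = 0) (h2' : ∀ a, ¬ 0 ≤ a → σ2 a = 0) :
    (∫ p : ℝ × ℝ, k (p.1 + p.2) * (σ1 p.1 * σ2 p.2)) =
      ((∑ s ∈ Finset.range m, ∑ t ∈ Finset.range n, C s * D t * momQ f s t : ℚ) : ℝ) := by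
  have key : ∀ p : ℝ × ℝ, k (p.1 + p.2) * (σ1 p.1 * σ2 p.2) =
      ∑ s ∈ Finset.range m, ∑ t ∈ Finset.range n, (C s : ℝ) * D t * kap k s t p := by
    intro p
    by_cases hp : p ∈ Tri 2
    · have hp' := hp
      obtain ⟨e1, e2, e3⟩ := hp'
      rw [h1 _ e1 (by linarith), h2 _ e2 (by linarith), Finset.sum_mul_sum, Finset.mul_sum]
      refine Finset.sum_congr rfl fun s _ => ?_
      rw [Finset.mul_sum]
      refine Finset.sum_congr rfl fun t _ => ?_
      rw [kap_mem hp]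
      ring
    · simp_rw [kap_zero hp]
      simp only [mul_zero, Finset.sum_const_zero]
      by_cases h : 2 < p.1 + p.2
      · rw [hk.vanish _ h, zero_mul]
      · by_cases e1 : 0 ≤ p.1
        · have e2 : ¬ 0 ≤ p.2 := fun e2 => hp ⟨e1, e2, not_lt.mp h⟩
          rw [h2' _ e2]; ring
        · rw [h1' _ e1]; ring
  simp_rw [key]
  have hint : ∀ s t : ℕ, Integrable (fun p : ℝ × ℝ => (C s : ℝ) * D t * kap k s t p) :=
    fun s t => (integrable_kap hk.ker s t).const_mul _
  rw [integral_finsetSum _ fun s _ => integrable_finsetSum _ fun t _ => hint s t]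
  push_cast
  refine Finset.sum_congr rfl fun s _ => ?_
  rw [integral_finsetSum _ fun t _ => hint s t]
  refine Finset.sum_congr rfl fun t _ => ?_
  rw [integral_const_mul, hk.integral_kap]

/-- Slice integrals. -/
def sl (g : ℝ × ℝ → ℝ) (a : ℝ) : ℝ := ∫ b, (Tri 5).indicator g (a, b)

/-- Slice integrals in the other direction. -/
def sl' (g : ℝ × ℝ → ℝ) (b : ℝ) : ℝ := ∫ a, (Tri 5).indicator g (a, b)

lemma sl_neg (g : ℝ × ℝ → ℝ) (a : ℝ) (ha : ¬ 0 ≤ a) : sl g a = 0 := by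
  have : ∀ b, (Tri 5).indicator g (a, b) = 0 := fun b =>
    Set.indicator_of_notMem (fun h => ha h.1) _
  simp [sl, this]

lemma sl_gt (g : ℝ × ℝ → ℝ) (a : ℝ) (ha : 5 < a) : sl g a = 0 := by
  have : ∀ b, (Tri 5).indicator g (a, b) = 0 := fun b =>
    Set.indicator_of_notMem (by rintro ⟨_, h, h'⟩; simp only at h h'; linarith) _
  simp [sl, this]

lemma sl'_neg (g : ℝ × ℝ → ℝ) (a : ℝ) (ha : ¬ 0 ≤ a) : sl' g a = 0 := by
  have : ∀ b, (Tri 5).indicator g (b, a) = 0 := fun b =>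
    Set.indicator_of_notMem (fun h => ha h.2.1) _
  simp [sl', this]

lemma J1 {k : ℝ → ℝ} (hk : Ker k) {g1 g2 : ℝ × ℝ → ℝ} (h1 : Continuous g1)
    (h2 : Continuous g2) :
    (∫ z : (ℝ × ℝ) × (ℝ × ℝ), k (z.1.1 + z.1.2) * SS g1 g2 z) =
      ∫ p : ℝ × ℝ, k (p.1 + p.2) * (sl g1 p.1 * sl g2 p.2) := by
  rw [Measure.volume_eq_prod (α := ℝ × ℝ) (β := ℝ × ℝ), integral_prod _ (hk.integrable_mul
    (h := fun z : (ℝ × ℝ) × (ℝ × ℝ) => z.1.1 + z.1.2) (by fun_prop) (integrable_SS h1 h2))]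
  congr 1; ext p
  dsimp only
  rw [integral_const_mul]
  congr 1
  simp only [SS]
  rw [Measure.volume_eq_prod, integral_prod_mul (fun a => (Tri 5).indicator g1 (p.1, a))
    (fun a => (Tri 5).indicator g2 (p.2, a))]
  rfl

lemma J1' {k : ℝ → ℝ} (hk : Ker k) {g1 g2 : ℝ × ℝ → ℝ} (h1 : Continuous g1)
    (h2 : Continuous g2) :
    (∫ z : (ℝ × ℝ) × (ℝ × ℝ), k (z.2.1 + z.2.2) * SS g1 g2 z) =
      ∫ p : ℝ × ℝ, k (p.1 + p.2) * (sl' g1 p.1 * sl' g2 p.2) := by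
  rw [Measure.volume_eq_prod (α := ℝ × ℝ) (β := ℝ × ℝ), integral_prod_symm _ (hk.integrable_mul
    (h := fun z : (ℝ × ℝ) × (ℝ × ℝ) => z.2.1 + z.2.2) (by fun_prop) (integrable_SS h1 h2))]
  congr 1; ext p
  dsimp only
  rw [integral_const_mul]
  congr 1
  simp only [SS]
  rw [Measure.volume_eq_prod, integral_prod_mul (fun a => (Tri 5).indicator g1 (a, p.1))
    (fun a => (Tri 5).indicator g2 (a, p.2))]
  rfl

lemma J11 {g1 g2 : ℝ × ℝ → ℝ} (h1 : Continuous g1) (h2 : Continuous g2) :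
    (∫ z : (ℝ × ℝ) × (ℝ × ℝ), SS g1 g2 z) = (∫ a, sl g1 a) * ∫ b, sl g2 b := by
  have := J1 (k := fun _ => 1) ⟨by fun_prop, by norm_num⟩ h1 h2
  simp only [one_mul] at this
  rw [this, Measure.volume_eq_prod, integral_prod_mul]


/-! ### Evaluation of the two basic integrals -/

/-- Moments of `kK`. -/
def fK (n : ℕ) : ℚ := 2 / (n + 1) + 2 * ((2 ^ (n + 1) - 1) / (n + 1)) - (2 ^ (n + 2) - 1) / (n + 2)

/-- Moments of `kM`. -/
def fM (n : ℕ) : ℚ := (2 ^ (n + 2) - 1) / (n + 2) - (2 ^ (n + 3) - 1) / (n + 3) / 2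

lemma Ker.intervalIntegrable {k : ℝ → ℝ} (hk : Ker k) (n : ℕ) (a b : ℝ) :
    IntervalIntegrable (fun u => k u * u ^ n) volume a b := by
  rw [intervalIntegrable_iff]
  have h : IntegrableOn (fun u : ℝ => u ^ n) (Set.uIoc a b) := by
    rw [← intervalIntegrable_iff]
    exact Continuous.intervalIntegrable (by fun_prop) _ _
  refine Integrable.bdd_mul (c := 2) h hk.1.aestronglyMeasurable ?_
  exact Filter.Eventually.of_forall fun z => by simpa using hk.2 z

lemma hasMom_kK : HasMom kK fK where
  ker := kK_ker
  vanish u hu := by simp [kK, not_lt.mpr (by linarith : (1 : ℝ) ≤ u), hu]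
  mom n := by
    rw [← intervalIntegral.integral_add_adjacent_intervals (b := 1)
      (kK_ker.intervalIntegrable n _ _) (kK_ker.intervalIntegrable n _ _)]
    have e1 : (∫ u in (0 : ℝ)..1, kK u * u ^ n) = ∫ u in (0 : ℝ)..1, 2 * u ^ n := by
      refine intervalIntegral.integral_congr_Ioo_of_le (by norm_num) fun u hu => ?_
      simp [kK, hu.2]
    have e2 : (∫ u in (1 : ℝ)..2, kK u * u ^ n) = ∫ u in (1 : ℝ)..2, (2 * u ^ n - u ^ (n + 1)) := by
      refine intervalIntegral.integral_congr_Ioo_of_le (by norm_num) fun u hu => ?_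
      simp only [kK, not_lt.mpr hu.1.le, hu.2.le, if_true, if_false]
      ring
    rw [e1, e2, intervalIntegral.integral_sub (Continuous.intervalIntegrable (by fun_prop) _ _)
      (Continuous.intervalIntegrable (by fun_prop) _ _), intervalIntegral.integral_const_mul,
      intervalIntegral.integral_const_mul, integral_pow, integral_pow, integral_pow, fK]
    push_cast
    simp only [one_pow, ne_eq, Nat.succ_ne_zero, not_false_eq_true, zero_pow]
    ring_nf

lemma hasMom_kM : HasMom kM fM where
  ker := kM_ker
  vanish u hu := by simp [kM, hu]
  mom n := by
    rw [← intervalIntegral.integral_add_adjacent_intervals (b := 1)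
      (kM_ker.intervalIntegrable n _ _) (kM_ker.intervalIntegrable n _ _)]
    have e1 : (∫ u in (0 : ℝ)..1, kM u * u ^ n) = ∫ u in (0 : ℝ)..1, 0 := by
      refine intervalIntegral.integral_congr_Ioo_of_le (by norm_num) fun u hu => ?_
      simp [kM, hu.2]
    have e2 : (∫ u in (1 : ℝ)..2, kM u * u ^ n) =
        ∫ u in (1 : ℝ)..2, (u ^ (n + 1) - (1 / 2) * u ^ (n + 2)) := by
      refine intervalIntegral.integral_congr_Ioo_of_le (by norm_num) fun u hu => ?_
      simp only [kM, not_lt.mpr hu.1.le, hu.2.le, if_true, if_false]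
      ring
    rw [e1, e2, intervalIntegral.integral_sub (Continuous.intervalIntegrable (by fun_prop) _ _)
      (Continuous.intervalIntegrable (by fun_prop) _ _), intervalIntegral.integral_const_mul,
      integral_pow, integral_pow, fM]
    push_cast
    simp only [one_pow, intervalIntegral.integral_zero]
    ring_nf

/-- The plain weight. -/
def gg (p : ℝ × ℝ) : ℝ := (5 - p.1 - p.2) ^ 2 / 2

/-- The plain weight times the first coordinate. -/
def g0 (p : ℝ × ℝ) : ℝ := (p.1 - 1) * gg p

lemma cont_gg : Continuous gg := by unfold gg; fun_prop

lemma cont_g0 : Continuous g0 := by unfold g0 gg; fun_prop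

lemma sl_gg (a : ℝ) (h0 : 0 ≤ a) (h5 : a ≤ 5) : sl gg a = (5 - a) ^ 3 / 6 := by
  have h := beta_int (5 - a) 2 0
  rw [sl, slice_Tri 5 a h0 h5]
  have e : ∀ b, gg (a, b) = (1 / 2) * (b ^ 0 * (5 - a - b) ^ 2) := fun b => by
    simp only [gg]; ring
  simp_rw [e]
  rw [intervalIntegral.integral_const_mul, h]
  norm_num [Nat.factorial]
  ring

lemma sl_g0 (a : ℝ) (h0 : 0 ≤ a) (h5 : a ≤ 5) : sl g0 a = (a - 1) * ((5 - a) ^ 3 / 6) := by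
  rw [← sl_gg a h0 h5, sl, sl, slice_Tri 5 a h0 h5, slice_Tri 5 a h0 h5,
    ← intervalIntegral.integral_const_mul]
  rfl

lemma sl'_gg (a : ℝ) (h0 : 0 ≤ a) (h5 : a ≤ 5) : sl' gg a = (5 - a) ^ 3 / 6 := by
  have h := beta_int (5 - a) 2 0
  rw [sl', slice_Tri' 5 a h0 h5]
  have e : ∀ b, gg (b, a) = (1 / 2) * (b ^ 0 * (5 - a - b) ^ 2) := fun b => by
    simp only [gg]; ring
  simp_rw [e]
  rw [intervalIntegral.integral_const_mul, h]
  norm_num [Nat.factorial]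
  ring

lemma sl'_g0 (a : ℝ) (h0 : 0 ≤ a) (h5 : a ≤ 5) :
    sl' g0 a = (5 - a) ^ 4 / 24 - (5 - a) ^ 3 / 6 := by
  have h := beta_int (5 - a) 2 0
  have h' := beta_int (5 - a) 2 1
  rw [sl', slice_Tri' 5 a h0 h5]
  have e : ∀ b, g0 (b, a) = (1 / 2) * (b ^ 1 * (5 - a - b) ^ 2)
      - (1 / 2) * (b ^ 0 * (5 - a - b) ^ 2) := fun b => by
    simp only [g0, gg]; ring
  simp_rw [e]
  rw [intervalIntegral.integral_sub (Continuous.intervalIntegrable (by fun_prop) _ _)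
    (Continuous.intervalIntegrable (by fun_prop) _ _), intervalIntegral.integral_const_mul,
    intervalIntegral.integral_const_mul, h, h']
  norm_num [Nat.factorial]
  ring

lemma integral_sl_g0 : (∫ a, sl g0 a) = 0 := by
  have e : ∀ a, sl g0 a = (Set.Icc 0 5).indicator
      (fun a => (1 / 6) * (a ^ 1 * (5 - a) ^ 3) - (1 / 6) * (a ^ 0 * (5 - a) ^ 3)) a := by
    intro a
    by_cases h : a ∈ Set.Icc (0 : ℝ) 5
    · rw [Set.indicator_of_mem h, sl_g0 a h.1 h.2]
      ring
    · rw [Set.indicator_of_notMem h]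
      by_cases h0 : 0 ≤ a
      · exact sl_gt _ _ (not_le.mp fun h5 => h ⟨h0, h5⟩)
      · exact sl_neg _ _ h0
  simp_rw [e]
  rw [integral_Icc_ite (by norm_num),
    intervalIntegral.integral_sub (Continuous.intervalIntegrable (by fun_prop) _ _)
    (Continuous.intervalIntegrable (by fun_prop) _ _), intervalIntegral.integral_const_mul,
    intervalIntegral.integral_const_mul, beta_int, beta_int]
  norm_num [Nat.factorial]

/-- Coefficients of `gg`. -/
def cgg : ℕ × ℕ → ℚ
  | (0, 0) => 25 / 2
  | (1, 0) => -5
  | (0, 1) => -5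
  | (2, 0) => 1 / 2
  | (0, 2) => 1 / 2
  | (1, 1) => 1
  | _ => 0

/-- Coefficients of `g0`. -/
def cg0 : ℕ × ℕ → ℚ
  | (0, j) => - cgg (0, j)
  | (i + 1, j) => cgg (i, j) - cgg (i + 1, j)

/-- Coefficients of `(5 - a) ^ 3 / 6`. -/
def cs : ℕ → ℚ
  | 0 => 125 / 6
  | 1 => -75 / 6
  | 2 => 15 / 6
  | 3 => -1 / 6
  | _ => 0

/-- Coefficients of `(a - 1) * (5 - a) ^ 3 / 6`. -/
def cs0 : ℕ → ℚ
  | 0 => - cs 0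
  | i + 1 => cs i - cs (i + 1)

lemma gg_eq (p : ℝ × ℝ) : gg p =
    ∑ s ∈ Finset.range 3 ×ˢ Finset.range 3, (cgg s : ℝ) * (p.1 ^ s.1 * p.2 ^ s.2) := by
  simp [Finset.sum_product, Finset.sum_range_succ, cgg, gg]
  ring

lemma g0_eq (p : ℝ × ℝ) : g0 p =
    ∑ s ∈ Finset.range 4 ×ˢ Finset.range 3, (cg0 s : ℝ) * (p.1 ^ s.1 * p.2 ^ s.2) := by
  simp [Finset.sum_product, Finset.sum_range_succ, cgg, cg0, g0, gg]
  ring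

lemma cs_eq (a : ℝ) : (5 - a) ^ 3 / 6 = ∑ s ∈ Finset.range 4, (cs s : ℝ) * a ^ s := by
  simp [Finset.sum_range_succ, cs]
  ring

lemma cs0_eq (a : ℝ) :
    (a - 1) * ((5 - a) ^ 3 / 6) = ∑ s ∈ Finset.range 5, (cs0 s : ℝ) * a ^ s := by
  simp [Finset.sum_range_succ, cs, cs0]
  ring

lemma cs0'_eq (a : ℝ) :
    (5 - a) ^ 4 / 24 - (5 - a) ^ 3 / 6 =
      ∑ s ∈ Finset.range 5, ((-cs0 s / 4 : ℚ) : ℝ) * a ^ s := by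
  simp [Finset.sum_range_succ, cs, cs0]
  ring

/-- The basic integral for the coordinate `x₁`. -/
lemma basic0 : (∫ z : (ℝ × ℝ) × (ℝ × ℝ), (2 - kK (z.1.1 + z.1.2)) *
    ((2 - kK (z.2.1 + z.2.2)) * SS g0 gg z)) = 74830759 / 302400 := by
  have i0 := integrable_SS cont_g0 cont_gg
  have i1 := kK_ker.integrable_mul
    (h := fun z : (ℝ × ℝ) × (ℝ × ℝ) => z.1.1 + z.1.2) (by fun_prop) i0
  have i2 := kK_ker.integrable_mul
    (h := fun z : (ℝ × ℝ) × (ℝ × ℝ) => z.2.1 + z.2.2) (by fun_prop) i0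
  have i3 := kK_ker.integrable_mul
    (h := fun z : (ℝ × ℝ) × (ℝ × ℝ) => z.1.1 + z.1.2) (by fun_prop) i2
  have e : ∀ z : (ℝ × ℝ) × (ℝ × ℝ), (2 - kK (z.1.1 + z.1.2)) *
    ((2 - kK (z.2.1 + z.2.2)) * SS g0 gg z) = ((4 * SS g0 gg z
      - 2 * (kK (z.1.1 + z.1.2) * SS g0 gg z)) - 2 * (kK (z.2.1 + z.2.2) * SS g0 gg z))
      + kK (z.1.1 + z.1.2) * (kK (z.2.1 + z.2.2) * SS g0 gg z) := fun z => by ring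
  have j1 : Integrable (fun z : (ℝ × ℝ) × (ℝ × ℝ) =>
      4 * SS g0 gg z - 2 * (kK (z.1.1 + z.1.2) * SS g0 gg z)) :=
    (i0.const_mul 4).sub (i1.const_mul 2)
  have j2 : Integrable (fun z : (ℝ × ℝ) × (ℝ × ℝ) =>
      4 * SS g0 gg z - 2 * (kK (z.1.1 + z.1.2) * SS g0 gg z)
        - 2 * (kK (z.2.1 + z.2.2) * SS g0 gg z)) :=
    j1.sub (i2.const_mul 2)
  simp_rw [e]
  rw [integral_add j2 i3,
    integral_sub j1 (i2.const_mul 2),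
    integral_sub (i0.const_mul 4) (i1.const_mul 2), integral_const_mul, integral_const_mul,
    integral_const_mul, J11 cont_g0 cont_gg, integral_sl_g0, J1 kK_ker cont_g0 cont_gg,
    J1' kK_ker cont_g0 cont_gg, JKK hasMom_kK hasMom_kK _ _ _ _ _ _ g0_eq gg_eq,
    integral_kap_sum hasMom_kK 5 4 cs0 cs (sl g0) (sl gg)
      (fun a h h' => (sl_g0 a h h').trans (cs0_eq a))
      (fun a h h' => (sl_gg a h h').trans (cs_eq a)) (sl_neg _) (sl_neg _),
    integral_kap_sum hasMom_kK 5 4 _ cs (sl' g0) (sl' gg)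
      (fun a h h' => (sl'_g0 a h h').trans (cs0'_eq a))
      (fun a h h' => (sl'_gg a h h').trans (cs_eq a)) (sl'_neg _) (sl'_neg _)]
  have : (4 * 0 - 2 * (∑ s ∈ Finset.range 5, ∑ t ∈ Finset.range 4, cs0 s * cs t * momQ fK s t)
      - 2 * (∑ s ∈ Finset.range 5, ∑ t ∈ Finset.range 4, (-cs0 s / 4) * cs t * momQ fK s t)
      + (∑ s ∈ Finset.range 4 ×ˢ Finset.range 3, ∑ t ∈ Finset.range 3 ×ˢ Finset.range 3,
        cg0 s * cgg t * (momQ fK s.1 t.1 * momQ fK s.2 t.2)) : ℚ) = 74830759 / 302400 := by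
    decide +kernel
  rw [zero_mul, show (74830759 / 302400 : ℝ) = ((74830759 / 302400 : ℚ) : ℝ) by norm_num, ← this,
    Rat.cast_add, Rat.cast_sub, Rat.cast_sub, Rat.cast_mul, Rat.cast_mul, Rat.cast_mul]
  norm_num

/-- The basic integral for the coordinate `x₉`. -/
lemma basic8 : (∫ z : (ℝ × ℝ) × (ℝ × ℝ), kM (z.1.1 + z.1.2) *
    ((2 - kK (z.2.1 + z.2.2)) * SS gg gg z)) = 70493741 / 604800 := by
  have i0 := integrable_SS cont_gg cont_gg
  have i1 := kM_ker.integrable_mul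
    (h := fun z : (ℝ × ℝ) × (ℝ × ℝ) => z.1.1 + z.1.2) (by fun_prop) i0
  have i2 := kK_ker.integrable_mul
    (h := fun z : (ℝ × ℝ) × (ℝ × ℝ) => z.2.1 + z.2.2) (by fun_prop) i0
  have i3 := kM_ker.integrable_mul
    (h := fun z : (ℝ × ℝ) × (ℝ × ℝ) => z.1.1 + z.1.2) (by fun_prop) i2
  have e : ∀ z : (ℝ × ℝ) × (ℝ × ℝ), kM (z.1.1 + z.1.2) *
    ((2 - kK (z.2.1 + z.2.2)) * SS gg gg z) = 2 * (kM (z.1.1 + z.1.2) * SS gg gg z)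
      - kM (z.1.1 + z.1.2) * (kK (z.2.1 + z.2.2) * SS gg gg z) := fun z => by ring
  simp_rw [e]
  rw [integral_sub (i1.const_mul 2) i3, integral_const_mul, J1 kM_ker cont_gg cont_gg,
    JKK hasMom_kM hasMom_kK _ _ _ _ _ _ gg_eq gg_eq,
    integral_kap_sum hasMom_kM 4 4 cs cs (sl gg) (sl gg)
      (fun a h h' => (sl_gg a h h').trans (cs_eq a))
      (fun a h h' => (sl_gg a h h').trans (cs_eq a)) (sl_neg _) (sl_neg _)]
  have : (2 * (∑ s ∈ Finset.range 4, ∑ t ∈ Finset.range 4, cs s * cs t * momQ fM s t)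
      - (∑ s ∈ Finset.range 3 ×ˢ Finset.range 3, ∑ t ∈ Finset.range 3 ×ˢ Finset.range 3,
        cgg s * cgg t * (momQ fM s.1 t.1 * momQ fK s.2 t.2)) : ℚ) = 70493741 / 604800 := by
    decide +kernel
  rw [show (70493741 / 604800 : ℝ) = ((70493741 / 604800 : ℚ) : ℝ) by norm_num, ← this,
    Rat.cast_sub, Rat.cast_mul, Rat.cast_ofNat]


/-! ### Reduction of the ten dimensional integrals -/

lemma mem_P (x : EuclideanSpace ℝ (Fin 10)) : x ∈ P ↔
    -1 ≤ x 0 ∧ -1 ≤ x 1 ∧ -1 ≤ x 2 ∧ -1 ≤ x 3 ∧ x 0 + x 1 + x 2 + x 3 ≤ 1 ∧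
    -1 ≤ x 4 ∧ -1 ≤ x 5 ∧ -1 ≤ x 6 ∧ -1 ≤ x 7 ∧ x 4 + x 5 + x 6 + x 7 ≤ 1 ∧
    -1 ≤ x 8 ∧ x 8 ≤ 1 ∧ -1 ≤ x 9 ∧ x 9 ≤ 1 ∧
    -1 ≤ x 0 + x 4 ∧ -1 ≤ x 0 + x 4 + x 8 ∧ -1 ≤ x 1 + x 5 ∧ -1 ≤ x 1 + x 5 + x 9 := by
  have h : ∀ i, ⟪x, ee i⟫ = x i := fun i => by simp [ee, EuclideanSpace.inner_single_right]
  simp only [P, V18, Set.mem_ofPred_eq, Set.mem_insert_iff, Set.mem_singleton_iff,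
    forall_eq_or_imp, forall_eq, inner_neg_right, inner_add_right, h, ge_iff_le,
    neg_le_neg_iff]

lemma isClosed_P : IsClosed P := by
  have : P = ⋂ v ∈ V18, {x : EuclideanSpace ℝ (Fin 10) | -1 ≤ ⟪x, v⟫} := by
    ext x; simp [P]
  rw [this]
  exact isClosed_biInter fun v _ => isClosed_le (by fun_prop) (by fun_prop)

/-- Coordinate involutions preserving `P`. -/
lemma perm_P (t : Fin 10 → Fin 10) (ht : ∀ i, t (t i) = i)
    (hP : ∀ x y : EuclideanSpace ℝ (Fin 10), (∀ i, y i = x (t i)) → x ∈ P → y ∈ P) (i : Fin 10) :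
    (∫ x in P, x (t i)) = ∫ x in P, x i := by
  let σ : Equiv.Perm (Fin 10) := ⟨t, t, ht, ht⟩
  have hm := (LinearIsometryEquiv.piLpCongrLeft 2 ℝ ℝ σ).measurePreserving
  have := hm.setIntegral_preimage_emb
    (LinearIsometryEquiv.piLpCongrLeft 2 ℝ ℝ σ).toHomeomorph.measurableEmbedding
    (fun x => x (t i)) P
  rw [← this]
  have hP : (LinearIsometryEquiv.piLpCongrLeft 2 ℝ ℝ σ) ⁻¹' P = P := by
    ext x
    constructor
    · exact hP _ _ fun i => congrArg x (ht i).symm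
    · exact hP _ _ fun i => rfl
  rw [hP]
  congr 1; ext x
  exact congrArg x (ht i)

lemma symA (i : Fin 10) : (∫ x in P, x ((![1, 0, 2, 3, 5, 4, 6, 7, 9, 8] : Fin 10 → Fin 10) i))
    = ∫ x in P, x i := by
  refine perm_P _ (by decide) (fun x y h => ?_) i
  simp only [mem_P, h, Matrix.cons_val]
  rintro ⟨h1, h2, h3, h4, h5, h6, h7, h8, h9, h10, h11, h12, h13, h14, h15, h16, h17, h18⟩
  refine ⟨?_, ?_, ?_, ?_, ?_, ?_, ?_, ?_, ?_, ?_, ?_, ?_, ?_, ?_, ?_, ?_, ?_, ?_⟩ <;> linarith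

lemma symB (i : Fin 10) : (∫ x in P, x ((![4, 5, 6, 7, 0, 1, 2, 3, 8, 9] : Fin 10 → Fin 10) i))
    = ∫ x in P, x i := by
  refine perm_P _ (by decide) (fun x y h => ?_) i
  simp only [mem_P, h, Matrix.cons_val]
  rintro ⟨h1, h2, h3, h4, h5, h6, h7, h8, h9, h10, h11, h12, h13, h14, h15, h16, h17, h18⟩
  refine ⟨?_, ?_, ?_, ?_, ?_, ?_, ?_, ?_, ?_, ?_, ?_, ?_, ?_, ?_, ?_, ?_, ?_, ?_⟩ <;> linarith

lemma symC (i : Fin 10) : (∫ x in P, x ((![0, 1, 3, 2, 4, 5, 6, 7, 8, 9] : Fin 10 → Fin 10) i))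
    = ∫ x in P, x i := by
  refine perm_P _ (by decide) (fun x y h => ?_) i
  simp only [mem_P, h, Matrix.cons_val]
  rintro ⟨h1, h2, h3, h4, h5, h6, h7, h8, h9, h10, h11, h12, h13, h14, h15, h16, h17, h18⟩
  refine ⟨?_, ?_, ?_, ?_, ?_, ?_, ?_, ?_, ?_, ?_, ?_, ?_, ?_, ?_, ?_, ?_, ?_, ?_⟩ <;> linarith

/-- Regrouped coordinates. -/
abbrev Q4 : Type := (ℝ × ℝ) × (ℝ × ℝ)

/-- Shifted and regrouped coordinates on `ℝ¹⁰`. -/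
def psi (z : Q4 × (Q4 × (ℝ × ℝ))) : Fin 10 → ℝ :=
  ![z.1.1.1 - 1, z.1.2.1 - 1, z.2.1.1.1 - 1, z.2.1.1.2 - 1,
    z.1.1.2 - 1, z.1.2.2 - 1, z.2.1.2.1 - 1, z.2.1.2.2 - 1, z.2.2.1, z.2.2.2]

lemma continuous_psi : Continuous psi := by
  refine continuous_pi fun i => ?_
  fin_cases i <;> simp [psi] <;> fun_prop

lemma psi_mp : MeasurePreserving psi := by
  refine ⟨continuous_psi.measurable, ?_⟩
  symm
  refine Measure.pi_eq fun s hs => ?_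
  rw [Measure.map_apply continuous_psi.measurable (MeasurableSet.univ_pi hs)]
  have h : psi ⁻¹' (Set.univ.pi s) =
      ((((fun x : ℝ => x - 1) ⁻¹' s 0) ×ˢ ((fun x : ℝ => x - 1) ⁻¹' s 4)) ×ˢ
        (((fun x : ℝ => x - 1) ⁻¹' s 1) ×ˢ ((fun x : ℝ => x - 1) ⁻¹' s 5))) ×ˢ
      (((((fun x : ℝ => x - 1) ⁻¹' s 2) ×ˢ ((fun x : ℝ => x - 1) ⁻¹' s 3)) ×ˢ
        (((fun x : ℝ => x - 1) ⁻¹' s 6) ×ˢ ((fun x : ℝ => x - 1) ⁻¹' s 7))) ×ˢ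
        (s 8 ×ˢ s 9)) := by
    ext z
    simp [psi, Fin.forall_fin_succ]
    tauto
  rw [h]
  simp only [Measure.volume_eq_prod, Measure.prod_prod]
  have hv : ∀ i, volume ((fun x : ℝ => x - 1) ⁻¹' s i) = volume (s i) := fun i =>
    (measurePreserving_sub_right volume 1).measure_preimage (hs i).nullMeasurableSet
  simp only [hv, Fin.prod_univ_succ]
  simp
  ring

/-- Change of variables. -/
lemma integral_P (f : EuclideanSpace ℝ (Fin 10) → ℝ) (hf : Continuous f) :
    (∫ x in P, f x) = ∫ z, P.indicator f (WithLp.toLp 2 (psi z)) := by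
  have hmp := (PiLp.volume_preserving_toLp (Fin 10)).comp psi_mp
  rw [← integral_indicator isClosed_P.measurableSet, ← hmp.map_eq, integral_map]
  · rfl
  · exact hmp.measurable.aemeasurable
  · exact (hf.measurable.indicator isClosed_P.measurableSet).aestronglyMeasurable

/-- Admissible values of `s` given `u`. -/
def Lset (u : ℝ) : Set ℝ := {s | -1 ≤ s ∧ s ≤ 1 ∧ 1 ≤ u ∧ 1 ≤ u + s}

/-- Positivity set. -/
def Pos4 : Set Q4 := {z | 0 ≤ z.1.1 ∧ 0 ≤ z.1.2 ∧ 0 ≤ z.2.1 ∧ 0 ≤ z.2.2}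

lemma factor_P (f : EuclideanSpace ℝ (Fin 10) → ℝ) (w : Q4 → ℝ) (h1 : ℝ × ℝ → ℝ) (h8 : ℝ → ℝ)
    (hf : ∀ z, f (WithLp.toLp 2 (psi z)) = w z.1 * h1 z.2.1.1 * h8 z.2.2.1)
    (z : Q4 × (Q4 × (ℝ × ℝ))) :
    P.indicator f (WithLp.toLp 2 (psi z)) = Pos4.indicator w z.1 *
      (((Tri (5 - z.1.1.1 - z.1.2.1)).indicator h1 z.2.1.1 *
        (Tri (5 - z.1.1.2 - z.1.2.2)).indicator 1 z.2.1.2) *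
      ((Lset (z.1.1.1 + z.1.1.2)).indicator h8 z.2.2.1 *
        (Lset (z.1.2.1 + z.1.2.2)).indicator 1 z.2.2.2)) := by
  have hiff : WithLp.toLp 2 (psi z) ∈ P ↔ (z.1 ∈ Pos4 ∧ z.2.1.1 ∈ Tri (5 - z.1.1.1 - z.1.2.1) ∧
      z.2.1.2 ∈ Tri (5 - z.1.1.2 - z.1.2.2) ∧ z.2.2.1 ∈ Lset (z.1.1.1 + z.1.1.2) ∧
      z.2.2.2 ∈ Lset (z.1.2.1 + z.1.2.2)) := by
    simp only [mem_P, psi, Pos4, Tri, Lset, Set.mem_ofPred_eq, Matrix.cons_val]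
    constructor
    · rintro ⟨h1, h2, h3, h4, h5, h6, h7, h8, h9, h10, h11, h12, h13, h14, h15, h16, h17, h18⟩
      refine ⟨⟨?_, ?_, ?_, ?_⟩, ⟨?_, ?_, ?_⟩, ⟨?_, ?_, ?_⟩, ⟨?_, ?_, ?_, ?_⟩, ?_, ?_, ?_, ?_⟩ <;>
        linarith
    · rintro ⟨⟨h1, h2, h3, h4⟩, ⟨h5, h6, h7⟩, ⟨h8, h9, h10⟩, ⟨h11, h12, h13, h14⟩,
        h15, h16, h17, h18⟩
      refine ⟨?_, ?_, ?_, ?_, ?_, ?_, ?_, ?_, ?_, ?_, ?_, ?_, ?_, ?_, ?_, ?_, ?_, ?_⟩ <;> linarith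
  simp only [Set.indicator, hiff, hf, Pi.one_apply]
  split_ifs <;> simp_all
  ring

lemma bounded_P (z : Q4 × (Q4 × (ℝ × ℝ))) (hz : WithLp.toLp 2 (psi z) ∈ P) : ‖z‖ ≤ 5 := by
  obtain ⟨⟨⟨a0, b0⟩, ⟨a1, b1⟩⟩, ⟨⟨⟨a2, a3⟩, ⟨b2, b3⟩⟩, ⟨s, t⟩⟩⟩ := z
  simp only [mem_P, psi, Matrix.cons_val] at hz
  obtain ⟨h1, h2, h3, h4, h5, h6, h7, h8, h9, h10, h11, h12, h13, h14, h15, h16, h17, h18⟩ := hz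
  simp only [Prod.norm_def, sup_le_iff, Real.norm_eq_abs, abs_le]
  refine ⟨⟨⟨⟨?_, ?_⟩, ⟨?_, ?_⟩⟩, ⟨⟨?_, ?_⟩, ⟨?_, ?_⟩⟩⟩,
    ⟨⟨⟨⟨?_, ?_⟩, ⟨?_, ?_⟩⟩, ⟨⟨?_, ?_⟩, ⟨?_, ?_⟩⟩⟩, ⟨⟨?_, ?_⟩, ⟨?_, ?_⟩⟩⟩⟩ <;> linarith

lemma fubini_P (f : EuclideanSpace ℝ (Fin 10) → ℝ) (hfc : Continuous f)
    (w : Q4 → ℝ) (h1 : ℝ × ℝ → ℝ) (h8 : ℝ → ℝ)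
    (hf : ∀ z, f (WithLp.toLp 2 (psi z)) = w z.1 * h1 z.2.1.1 * h8 z.2.2.1) :
    (∫ x in P, f x) = ∫ z : Q4, Pos4.indicator w z *
      (((∫ p, (Tri (5 - z.1.1 - z.2.1)).indicator h1 p) *
        (∫ p, (Tri (5 - z.1.2 - z.2.2)).indicator 1 p)) *
      ((∫ s, (Lset (z.1.1 + z.1.2)).indicator h8 s) *
        (∫ t, (Lset (z.2.1 + z.2.2)).indicator 1 t))) := by
  have hct : Continuous fun z : Q4 × (Q4 × (ℝ × ℝ)) => WithLp.toLp 2 (psi z) :=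
    (PiLp.continuous_toLp 2 _).comp continuous_psi
  have hint : Integrable fun z : Q4 × (Q4 × (ℝ × ℝ)) => P.indicator f (WithLp.toLp 2 (psi z)) :=
    integrable_ind (S := (fun z : Q4 × (Q4 × (ℝ × ℝ)) => WithLp.toLp 2 (psi z)) ⁻¹' P) 5
      (isClosed_P.preimage hct).measurableSet bounded_P (hfc.comp hct)
  rw [integral_P f hfc, Measure.volume_eq_prod (α := Q4) (β := Q4 × (ℝ × ℝ)),
    integral_prod _ hint]
  congr 1; ext z
  simp_rw [factor_P f w h1 h8 hf]
  rw [integral_const_mul]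
  congr 1
  rw [Measure.volume_eq_prod (α := Q4) (β := ℝ × ℝ),
    integral_prod_mul (fun y : Q4 => (Tri (5 - z.1.1 - z.2.1)).indicator h1 y.1 *
        (Tri (5 - z.1.2 - z.2.2)).indicator 1 y.2)
      (fun y : ℝ × ℝ => (Lset (z.1.1 + z.1.2)).indicator h8 y.1 *
        (Lset (z.2.1 + z.2.2)).indicator 1 y.2)]
  congr 1
  · rw [Measure.volume_eq_prod (α := ℝ × ℝ) (β := ℝ × ℝ), integral_prod_mul]
  · rw [Measure.volume_eq_prod (α := ℝ) (β := ℝ), integral_prod_mul]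

lemma int_Tri_one (c : ℝ) :
    (∫ p, (Tri c).indicator (1 : ℝ × ℝ → ℝ) p) = if 0 ≤ c then c ^ 2 / 2 else 0 := by
  split_ifs with hc
  · rw [integral_Tri c hc continuous_one]
    have e : ∀ a : ℝ, (∫ b in (0)..(c - a), (1 : ℝ × ℝ → ℝ) (a, b)) = a ^ 0 * (c - a) ^ 1 := by
      intro a; simp
    simp_rw [e]
    rw [beta_int]
    norm_num [Nat.factorial]
    ring
  · have : Tri c = ∅ := by
      ext p
      simp only [Tri, Set.mem_ofPred_eq, Set.mem_empty_iff_false, iff_false]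
      rintro ⟨h1, h2, h3⟩
      exact hc (by linarith)
    simp [this]

lemma int_Tri_fst (c : ℝ) : (∫ p, (Tri c).indicator (fun p : ℝ × ℝ => p.1 - 1) p) =
    (if 0 ≤ c then c ^ 2 / 2 else 0) * (c / 3 - 1) := by
  split_ifs with hc
  · rw [integral_Tri c hc (by fun_prop)]
    have e : ∀ a : ℝ, (∫ b in (0)..(c - a), (a - 1)) = a ^ 1 * (c - a) ^ 1 - a ^ 0 * (c - a) ^ 1 := by
      intro a; simp; ring
    simp_rw [e]
    rw [intervalIntegral.integral_sub (Continuous.intervalIntegrable (by fun_prop) _ _)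
      (Continuous.intervalIntegrable (by fun_prop) _ _), beta_int, beta_int]
    norm_num [Nat.factorial]
    ring
  · have : Tri c = ∅ := by
      ext p
      simp only [Tri, Set.mem_ofPred_eq, Set.mem_empty_iff_false, iff_false]
      rintro ⟨h1, h2, h3⟩
      exact hc (by linarith)
    simp [this]

lemma Lset_lt {u : ℝ} (hu : u < 1) : Lset u = ∅ := by
  ext s
  simp only [Lset, Set.mem_ofPred_eq, Set.mem_empty_iff_false, iff_false]
  rintro ⟨h1, h2, h3, h4⟩
  linarith

lemma Lset_mid {u : ℝ} (hu : 1 ≤ u) (hu2 : u ≤ 2) : Lset u = Set.Icc (1 - u) 1 := by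
  ext s
  simp only [Lset, Set.mem_ofPred_eq, Set.mem_Icc]
  constructor
  · rintro ⟨h1, h2, h3, h4⟩
    constructor <;> linarith
  · rintro ⟨h1, h2⟩
    refine ⟨?_, ?_, ?_, ?_⟩ <;> linarith

lemma Lset_gt {u : ℝ} (hu : 2 < u) : Lset u = Set.Icc (-1) 1 := by
  ext s
  simp only [Lset, Set.mem_ofPred_eq, Set.mem_Icc]
  constructor
  · rintro ⟨h1, h2, h3, h4⟩
    exact ⟨h1, h2⟩
  · rintro ⟨h1, h2⟩
    refine ⟨?_, ?_, ?_, ?_⟩ <;> linarith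

lemma int_Lset_one (u : ℝ) : (∫ s, (Lset u).indicator (1 : ℝ → ℝ) s) = 2 - kK u := by
  unfold kK
  split_ifs with h1 h2
  · simp [Lset_lt h1]
  · rw [Lset_mid (not_lt.mp h1) h2, integral_Icc_ite (by linarith)]
    simp
  · rw [Lset_gt (not_le.mp h2), integral_Icc_ite (by norm_num)]
    simp
    norm_num

lemma int_Lset_id (u : ℝ) : (∫ s, (Lset u).indicator (fun s : ℝ => s) s) = kM u := by
  unfold kM
  split_ifs with h1 h2
  · simp [Lset_lt h1]
  · rw [Lset_mid (not_lt.mp h1) h2, integral_Icc_ite (by linarith)]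
    simp
    ring
  · rw [Lset_gt (not_le.mp h2), integral_Icc_ite (by norm_num)]
    simp

lemma ind_SS (w : Q4 → ℝ) (z : Q4) : Pos4.indicator w z *
    ((if 0 ≤ 5 - z.1.1 - z.2.1 then (5 - z.1.1 - z.2.1) ^ 2 / 2 else 0) *
      (if 0 ≤ 5 - z.1.2 - z.2.2 then (5 - z.1.2 - z.2.2) ^ 2 / 2 else 0)) =
    w z * SS gg gg z := by
  have e1 : 0 ≤ 5 - z.1.1 - z.2.1 ↔ z.1.1 + z.2.1 ≤ 5 := by constructor <;> intro <;> linarith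
  have e2 : 0 ≤ 5 - z.1.2 - z.2.2 ↔ z.1.2 + z.2.2 ≤ 5 := by constructor <;> intro <;> linarith
  simp only [SS, Set.indicator, Pos4, Tri, Set.mem_ofPred_eq, e1, e2, gg]
  by_cases h1 : 0 ≤ z.1.1 <;> by_cases h2 : 0 ≤ z.1.2 <;> by_cases h3 : 0 ≤ z.2.1 <;>
    by_cases h4 : 0 ≤ z.2.2 <;> simp [h1, h2, h3, h4]

lemma ind_SS_mul (w : Q4 → ℝ) (z : Q4) (L : ℝ) : Pos4.indicator w z *
    (((if 0 ≤ 5 - z.1.1 - z.2.1 then (5 - z.1.1 - z.2.1) ^ 2 / 2 else 0) *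
      (if 0 ≤ 5 - z.1.2 - z.2.2 then (5 - z.1.2 - z.2.2) ^ 2 / 2 else 0)) * L) =
    w z * SS gg gg z * L := by
  rw [← mul_assoc, ind_SS]

lemma SS_g0 (z : Q4) : (z.1.1 - 1) * SS gg gg z = SS g0 gg z := by
  simp only [SS, Set.indicator, g0]
  split_ifs <;> ring

lemma int_x0 : (∫ x in P, x 0) = 74830759 / 302400 := by
  rw [fubini_P (fun x => x 0) (by fun_prop) (fun z => z.1.1 - 1) 1 1
    (fun z => by simp [psi]), ← basic0]
  congr 1; ext z
  rw [int_Tri_one, int_Tri_one, ← SS_g0]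
  have e : ∀ u, (∫ s, (Lset u).indicator (1 : ℝ → ℝ) s) = 2 - kK u := int_Lset_one
  rw [e, e, ← mul_assoc, ind_SS]
  ring

lemma int_x8 : (∫ x in P, x 8) = 70493741 / 604800 := by
  rw [fubini_P (fun x => x 8) (by fun_prop) (fun _ => 1) 1 (fun s => s)
    (fun z => by simp [psi]), ← basic8]
  congr 1; ext z
  rw [int_Tri_one, int_Tri_one, int_Lset_id, int_Lset_one, ← mul_assoc, ind_SS]
  ring

lemma ker_two_sub : Ker (fun u => 2 - kK u) := by
  refine ⟨kK_ker.1.const_sub 2, fun u => ?_⟩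
  simp only [kK]
  split_ifs <;> rw [abs_le] <;> constructor <;> linarith

lemma int_x1 : (∫ x in P, x 1) = 74830759 / 302400 := by
  rw [← int_x0]
  exact symA 0

lemma int_x2 : (∫ x in P, x 2) = -74830759 / 453600 := by
  have h0 := int_x0
  have h1 := int_x1
  rw [fubini_P (fun x => x 0) (by fun_prop) (fun z => z.1.1 - 1) 1 1
    (fun z => by simp [psi])] at h0
  rw [fubini_P (fun x => x 1) (by fun_prop) (fun z => z.2.1 - 1) 1 1
    (fun z => by simp [psi])] at h1
  rw [fubini_P (fun x => x 2) (by fun_prop) (fun _ => 1) (fun p => p.1 - 1) 1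
    (fun z => by simp [psi])]
  simp_rw [int_Tri_one, int_Lset_one, ind_SS_mul] at h0 h1
  simp_rw [int_Tri_one, int_Tri_fst, int_Lset_one]
  have e : ∀ z : Q4, Pos4.indicator (fun _ => (1 : ℝ)) z *
    (((if 0 ≤ 5 - z.1.1 - z.2.1 then (5 - z.1.1 - z.2.1) ^ 2 / 2 else 0) *
        ((5 - z.1.1 - z.2.1) / 3 - 1) *
      (if 0 ≤ 5 - z.1.2 - z.2.2 then (5 - z.1.2 - z.2.2) ^ 2 / 2 else 0)) *
      ((2 - kK (z.1.1 + z.1.2)) * (2 - kK (z.2.1 + z.2.2)))) =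
      (-1 / 3) * ((z.1.1 - 1) * SS gg gg z * ((2 - kK (z.1.1 + z.1.2)) * (2 - kK (z.2.1 + z.2.2)))
        + (z.2.1 - 1) * SS gg gg z * ((2 - kK (z.1.1 + z.1.2)) * (2 - kK (z.2.1 + z.2.2)))) := by
    intro z
    have h := ind_SS (fun _ => 1) z
    rw [one_mul] at h
    rw [← h]
    ring
  simp_rw [e]
  have hint : ∀ g : ℝ × ℝ → ℝ, Continuous g → Integrable (fun z : Q4 =>
      SS g gg z * ((2 - kK (z.1.1 + z.1.2)) * (2 - kK (z.2.1 + z.2.2)))) := by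
    intro g hg
    have i2 := ker_two_sub.integrable_mul
      (h := fun z : (ℝ × ℝ) × (ℝ × ℝ) => z.2.1 + z.2.2) (by fun_prop) (integrable_SS hg cont_gg)
    have i3 := ker_two_sub.integrable_mul
      (h := fun z : (ℝ × ℝ) × (ℝ × ℝ) => z.1.1 + z.1.2) (by fun_prop) i2
    refine i3.congr (Filter.Eventually.of_forall fun z => ?_)
    simp only
    ring
  have ea : ∀ z : Q4, (z.1.1 - 1) * SS gg gg z = SS g0 gg z := SS_g0
  have eb : ∀ z : Q4, (z.2.1 - 1) * SS gg gg z = SS (fun p => (p.2 - 1) * gg p) gg z := by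
    intro z
    simp only [SS, Set.indicator]
    split_ifs <;> ring
  simp_rw [ea] at h0 ⊢
  simp_rw [eb] at h1 ⊢
  rw [integral_const_mul, integral_add (hint _ cont_g0)
    (hint _ (by have := cont_gg; fun_prop)), h0, h1]
  norm_num

/-- With respect to Lebesgue measure (1-indexed coordinates of the paper
correspond to 0-indexed coordinates here): `∫_P x_i dx = 74830759/302400` for
`i ∈ {1,2,5,6}`, `∫_P x_i dx = −74830759/453600` for `i ∈ {3,4,7,8}`, and
`∫_P x_i dx = 70493741/604800` for `i ∈ {9,10}`. -/
theorem stmt10 :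
    (∀ i : Fin 10, (i = 0 ∨ i = 1 ∨ i = 4 ∨ i = 5) →
      (∫ x in P, x i) = 74830759 / 302400) ∧
    (∀ i : Fin 10, (i = 2 ∨ i = 3 ∨ i = 6 ∨ i = 7) →
      (∫ x in P, x i) = -74830759 / 453600) ∧
    (∀ i : Fin 10, (i = 8 ∨ i = 9) →
      (∫ x in P, x i) = 70493741 / 604800) := by
  have h3 : (∫ x in P, x 3) = -74830759 / 453600 := (symC 2).trans int_x2
  refine ⟨?_, ?_, ?_⟩
  · rintro i (rfl | rfl | rfl | rfl)
    · exact int_x0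
    · exact int_x1
    · exact (symB 0).trans int_x0
    · exact (symB 1).trans int_x1
  · rintro i (rfl | rfl | rfl | rfl)
    · exact int_x2
    · exact h3
    · exact (symB 2).trans int_x2
    · exact (symB 3).trans h3
  · rintro i (rfl | rfl)
    · exact int_x8
    · exact (symA 8).trans int_x8
end
end

section
/- Let V ⊂ ℝ¹⁰ be the set of 18 points e₁, e₂, e₃, e₄, −(e₁+e₂+e₃+e₄), e₅, e₆, e₇, e₈, −(e₅+e₆+e₇+e₈), e₉, −e₉, e₁₀, −e₁₀, e₁+e₅, e₁+e₅+e₉, e₂+e₆, e₂+e₆+e₁₀, and define P = {x ∈ ℝ¹⁰ : ⟨x, v⟩ ≥ −1 for every v ∈ V}. Then, with respect to Lebesgue measure, ∫_P x_i² dx = 178450577/207360 for i ∈ {1, 2, 5, 6}, ∫_P x_i² dx = 11836195861/17107200 for i ∈ {3, 4, 7, 8}, and ∫_P x_i² dx = 47610261247/119750400 for i ∈ {9, 10}. -/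
noncomputable section

open MeasureTheory
open scoped RealInnerProductSpace

/-- Evaluation (Horner form) of the polynomial with coefficient list `L`. -/
def evalL : List ℝ → ℝ → ℝ
  | [], _ => 0
  | c :: L, x => c + x * evalL L x

/-- Antiderivative: the sum of `c_i x^(k+i+1) / (k+i+1)`. -/
def antiL : ℕ → List ℝ → ℝ → ℝ
  | _, [], _ => 0
  | k, c :: L, x => c * x ^ (k + 1) / ((k : ℝ) + 1) + antiL (k + 1) L x

lemma antiL_hasDerivAt (L : List ℝ) : ∀ (k : ℕ) (x : ℝ),
    HasDerivAt (antiL k L) (x ^ k * evalL L x) x := by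
  induction L with
  | nil => intro k x; simpa [antiL, evalL] using hasDerivAt_const x (0 : ℝ)
  | cons c L ih =>
    intro k x
    have h1 : HasDerivAt (fun x : ℝ => c * x ^ (k + 1) / ((k : ℝ) + 1)) (c * x ^ k) x := by
      have h := ((hasDerivAt_pow (k + 1) x).const_mul c).div_const ((k : ℝ) + 1)
      refine h.congr_deriv ?_
      have : (k : ℝ) + 1 ≠ 0 := by positivity
      rw [Nat.add_sub_cancel]
      push_cast
      field_simp
    have h2 := h1.add (ih (k + 1) x)
    refine h2.congr_deriv ?_
    simp only [evalL]
    ring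

lemma evalL_continuous (L : List ℝ) : Continuous (evalL L) := by
  induction L with
  | nil => exact continuous_const
  | cons c L ih => exact continuous_const.add (continuous_id.mul ih)

/-- Interval integral of a polynomial. -/
lemma pint {f : ℝ → ℝ} {lo hi : ℝ} (L : List ℝ) {r : ℝ} (h : ∀ x, f x = evalL L x)
    (hr : antiL 0 L hi - antiL 0 L lo = r) : ∫ x in lo..hi, f x = r := by
  have hf : f = evalL L := funext h
  subst hf
  rw [← hr]
  apply intervalIntegral.integral_eq_sub_of_hasDerivAt
  · intro x _
    simpa using antiL_hasDerivAt L 0 x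
  · exact (evalL_continuous L).intervalIntegrable _ _

/-- Telescopes of nested intervals. -/
inductive Tele : ℕ → Type
  | nil : Tele 0
  | cons {n : ℕ} (I : Set ℝ) (lo hi : ℝ) (rest : ℝ → Tele n) : Tele (n + 1)

/-- The region described by a telescope. -/
def Tele.set : {n : ℕ} → Tele n → Set (Fin n → ℝ)
  | _, .nil => Set.univ
  | _, .cons I _ _ rest => {x | x 0 ∈ I ∧ Fin.tail x ∈ (rest (x 0)).set}

/-- The iterated integral over a telescope. -/
def Tele.int : {n : ℕ} → Tele n → ((Fin n → ℝ) → ℝ) → ℝ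
  | _, .nil, f => f ![]
  | _, .cons _ lo hi rest, f =>
      ∫ x in lo..hi, (rest x).int (fun y => f (Matrix.vecCons x y))

/-- Well-formedness: the intervals are as announced. -/
def Tele.WF : {n : ℕ} → Tele n → Prop
  | _, .nil => True
  | _, .cons I lo hi rest =>
      lo ≤ hi ∧ (I = Set.Icc lo hi ∨ I = Set.Ico lo hi) ∧ ∀ x ∈ I, (rest x).WF

lemma bdd_integrableOn {n : ℕ} {S : Set (Fin n → ℝ)} {f : (Fin n → ℝ) → ℝ}
    (R : ℝ) (hR : ∀ x ∈ S, ∀ i, |x i| ≤ R) (hf : Continuous f) : IntegrableOn f S := by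
  have hc : IsCompact (Set.Icc (fun _ : Fin n => -R) (fun _ => R)) := isCompact_Icc
  refine (hf.continuousOn.integrableOn_compact hc).mono_set ?_
  intro x hx
  exact ⟨fun i => (abs_le.1 (hR x hx i)).1, fun i => (abs_le.1 (hR x hx i)).2⟩

lemma Tele.integral_eq {n : ℕ} (T : Tele n) : ∀ (f : (Fin n → ℝ) → ℝ), T.WF →
    MeasurableSet T.set → (∃ R : ℝ, ∀ x ∈ T.set, ∀ i, |x i| ≤ R) → Continuous f →
    ∫ x in T.set, f x = T.int f := by
  induction T with
  | nil =>
    intro f _ _ _ _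
    simp only [Tele.set, Tele.int, Measure.restrict_univ]
    have : f = fun _ => f ![] := by
      funext x
      rw [Subsingleton.elim x ![]]
    rw [this]
    simp [volume_pi, Measure.real]
  | @cons n I lo hi rest ih =>
    intro f hwf hm hR hf
    obtain ⟨R, hR⟩ := hR
    obtain ⟨hle, hI, hrest⟩ := hwf
    set S := (Tele.cons I lo hi rest).set with hS
    have hmp := (volume_preserving_piFinSuccAbove (fun _ : Fin (n + 1) => ℝ) 0).symm
    have h_integrable : Integrable (S.indicator f) := by
      rw [integrable_indicator_iff hm]
      exact bdd_integrableOn R hR hf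
    have hcons : ∀ (x : ℝ) (y : Fin n → ℝ),
        (MeasurableEquiv.piFinSuccAbove (fun _ : Fin (n + 1) => ℝ) 0).symm (x, y)
          = Matrix.vecCons x y := by
      intro x y
      simp [MeasurableEquiv.piFinSuccAbove, Matrix.vecCons]
      rfl
    have hcc : ∀ x : ℝ, Continuous (fun y : Fin n → ℝ => (Matrix.vecCons x y : Fin (n+1) → ℝ)) := by
      intro x
      refine continuous_pi fun i => ?_
      refine Fin.cases ?_ (fun j => ?_) i
      · simpa using continuous_const
      · simpa using continuous_apply j
    have hmem : ∀ (x : ℝ) (y : Fin n → ℝ),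
        Matrix.vecCons x y ∈ S ↔ x ∈ I ∧ y ∈ (rest x).set := by
      intro x y
      rfl
    rw [← integral_indicator hm, ← hmp.integral_comp', Measure.volume_eq_prod, integral_prod]
    swap
    · exact (hmp.integrable_comp_emb (MeasurableEquiv.measurableEmbedding _)).2 h_integrable
    simp only [hcons]
    have hImeas : MeasurableSet I := by
      rcases hI with h | h <;> rw [h]
      · exact measurableSet_Icc
      · exact measurableSet_Ico
    have key : ∀ x, (∫ y, S.indicator f (Matrix.vecCons x y))
        = I.indicator (fun x => (rest x).int (fun y => f (Matrix.vecCons x y))) x := by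
      intro x
      by_cases hx : x ∈ I
      · rw [Set.indicator_of_mem hx]
        have hset : (rest x).set = (fun y : Fin n → ℝ => (Matrix.vecCons x y : Fin (n+1) → ℝ)) ⁻¹' S := by
          ext y
          simp [hmem, hx]
        have hm' : MeasurableSet (rest x).set := by
          rw [hset]
          exact (hcc x).measurable hm
        rw [← ih x _ (hrest x hx) hm' ⟨R, ?_⟩ (show Continuous (fun y => f (Matrix.vecCons x y)) from hf.comp (hcc x)), ← integral_indicator hm']
        · congr 1
          funext y
          by_cases hy : y ∈ (rest x).set
          · rw [Set.indicator_of_mem hy, Set.indicator_of_mem ((hmem x y).2 ⟨hx, hy⟩)]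
          · rw [Set.indicator_of_notMem hy,
              Set.indicator_of_notMem (fun h => hy ((hmem x y).1 h).2)]
        · intro y hy i
          simpa using hR (Matrix.vecCons x y) ((hmem x y).2 ⟨hx, hy⟩) i.succ
      · rw [Set.indicator_of_notMem hx]
        have : ∀ y, S.indicator f (Matrix.vecCons x y) = 0 := fun y =>
          Set.indicator_of_notMem (fun h => hx ((hmem x y).1 h).1) _
        simp [this]
    simp only [key]
    rw [integral_indicator hImeas, Tele.int, intervalIntegral.integral_of_le hle]
    rcases hI with h | h <;> rw [h]
    · rw [integral_Icc_eq_integral_Ioc]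
    · rw [integral_Ico_eq_integral_Ioo, integral_Ioc_eq_integral_Ioo]


set_option linter.unusedSimpArgs false
set_option linter.unusedVariables false
set_option linter.style.longLine false
set_option maxHeartbeats 2000000 in
set_option maxRecDepth 10000 in
lemma inn_k (r R k : ℝ) :
    (∫ y in (0 : ℝ)..(r), ∫ z in (0 : ℝ)..(r - y), ∫ p in (0 : ℝ)..(R), ∫ q in (0 : ℝ)..(R - p), (k : ℝ)) =
      (1/4)*r^2*R^2*k := by
  have h0 : ∀ p : ℝ, (∫ q in (0 : ℝ)..(R - p), (k : ℝ)) =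
      (1)*R*k + (-1)*p*k := by
    intro p
    exact pint [(1)*k]
      (by intro x; simp only [evalL]; ring1) (by simp only [antiL, Nat.cast_add, Nat.cast_zero, Nat.cast_one]; ring1)
  simp only [h0]
  have h1 : (∫ p in (0 : ℝ)..(R), ((1)*R*k + (-1)*p*k : ℝ)) =
      (1/2)*R^2*k := by
    exact pint [(1)*R*k, (-1)*k]
      (by intro x; simp only [evalL]; ring1) (by simp only [antiL, Nat.cast_add, Nat.cast_zero, Nat.cast_one]; ring1)
  simp only [h1]
  have h2 : ∀ y : ℝ, (∫ z in (0 : ℝ)..(r - y), ((1/2)*R^2*k : ℝ)) =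
      (1/2)*r*R^2*k + (-1/2)*y*R^2*k := by
    intro y
    exact pint [(1/2)*R^2*k]
      (by intro x; simp only [evalL]; ring1) (by simp only [antiL, Nat.cast_add, Nat.cast_zero, Nat.cast_one]; ring1)
  simp only [h2]
  exact pint [(1/2)*r*R^2*k, (-1/2)*R^2*k]
    (by intro x; simp only [evalL]; ring1) (by simp only [antiL, Nat.cast_add, Nat.cast_zero, Nat.cast_one]; ring1)

set_option maxHeartbeats 2000000 in
set_option maxRecDepth 10000 in
lemma inn_y (r R : ℝ) :
    (∫ y in (0 : ℝ)..(r), ∫ z in (0 : ℝ)..(r - y), ∫ p in (0 : ℝ)..(R), ∫ q in (0 : ℝ)..(R - p), ((y - 1) ^ 2 : ℝ)) =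
      (1/4)*r^2*R^2 + (-1/6)*r^3*R^2 + (1/24)*r^4*R^2 := by
  have h0 : ∀ y p : ℝ, (∫ q in (0 : ℝ)..(R - p), ((y - 1) ^ 2 : ℝ)) =
      (1)*R*(y - 1) ^ 2 + (-1)*p*(y - 1) ^ 2 := by
    intro y p
    exact pint [(1)*(y - 1) ^ 2]
      (by intro x; simp only [evalL]; ring1) (by simp only [antiL, Nat.cast_add, Nat.cast_zero, Nat.cast_one]; ring1)
  simp only [h0]
  have h1 : ∀ y : ℝ, (∫ p in (0 : ℝ)..(R), ((1)*R*(y - 1) ^ 2 + (-1)*p*(y - 1) ^ 2 : ℝ)) =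
      (1/2)*R^2*(y - 1) ^ 2 := by
    intro y
    exact pint [(1)*R*(y - 1) ^ 2, (-1)*(y - 1) ^ 2]
      (by intro x; simp only [evalL]; ring1) (by simp only [antiL, Nat.cast_add, Nat.cast_zero, Nat.cast_one]; ring1)
  simp only [h1]
  have h2 : ∀ y : ℝ, (∫ z in (0 : ℝ)..(r - y), ((1/2)*R^2*(y - 1) ^ 2 : ℝ)) =
      (1/2)*r*R^2*(y - 1) ^ 2 + (-1/2)*y*R^2*(y - 1) ^ 2 := by
    intro y
    exact pint [(1/2)*R^2*(y - 1) ^ 2]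
      (by intro x; simp only [evalL]; ring1) (by simp only [antiL, Nat.cast_add, Nat.cast_zero, Nat.cast_one]; ring1)
  simp only [h2]
  exact pint [(1/2)*r*R^2, (-1/2)*R^2 + (-1)*r*R^2, (1)*R^2 + (1/2)*r*R^2, (-1/2)*R^2]
    (by intro x; simp only [evalL]; ring1) (by simp only [antiL, Nat.cast_add, Nat.cast_zero, Nat.cast_one]; ring1)

set_option maxHeartbeats 2000000 in
set_option maxRecDepth 10000 in
lemma qc_k (A B k : ℝ) :
    (∫ c in (0 : ℝ)..(A), ∫ d in (0 : ℝ)..(B), ∫ y in (0 : ℝ)..(A - c), ∫ z in (0 : ℝ)..(A - c - y), ∫ p in (0 : ℝ)..(B - d), ∫ q in (0 : ℝ)..(B - d - p), (k : ℝ)) =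
      (1/36)*A^3*B^3*k := by
  simp only [inn_k]
  have h0 : ∀ c : ℝ, (∫ d in (0 : ℝ)..(B), ((1/4)*(A - c)^2*(B - d)^2*k : ℝ)) =
      (1/12)*(A - c)^2*B^3*k := by
    intro c
    exact pint [(1/4)*(A - c)^2*B^2*k, (-1/2)*(A - c)^2*B*k, (1/4)*(A - c)^2*k]
      (by intro x; simp only [evalL]; ring1) (by simp only [antiL, Nat.cast_add, Nat.cast_zero, Nat.cast_one]; ring1)
  simp only [h0]
  exact pint [(1/12)*A^2*B^3*k, (-1/6)*A*B^3*k, (1/12)*B^3*k]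
    (by intro x; simp only [evalL]; ring1) (by simp only [antiL, Nat.cast_add, Nat.cast_zero, Nat.cast_one]; ring1)

set_option maxHeartbeats 2000000 in
set_option maxRecDepth 10000 in
lemma qc_c (A B : ℝ) :
    (∫ c in (0 : ℝ)..(A), ∫ d in (0 : ℝ)..(B), ∫ y in (0 : ℝ)..(A - c), ∫ z in (0 : ℝ)..(A - c - y), ∫ p in (0 : ℝ)..(B - d), ∫ q in (0 : ℝ)..(B - d - p), ((c - 1) ^ 2 : ℝ)) =
      (1/36)*A^3*B^3 + (-1/72)*A^4*B^3 + (1/360)*A^5*B^3 := by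
  simp only [inn_k]
  have h0 : ∀ c : ℝ, (∫ d in (0 : ℝ)..(B), ((1/4)*(A - c)^2*(B - d)^2*(c - 1) ^ 2 : ℝ)) =
      (1/12)*(A - c)^2*B^3*(c - 1) ^ 2 := by
    intro c
    exact pint [(1/4)*(A - c)^2*B^2*(c - 1) ^ 2, (-1/2)*(A - c)^2*B*(c - 1) ^ 2, (1/4)*(A - c)^2*(c - 1) ^ 2]
      (by intro x; simp only [evalL]; ring1) (by simp only [antiL, Nat.cast_add, Nat.cast_zero, Nat.cast_one]; ring1)
  simp only [h0]
  exact pint [(1/12)*A^2*B^3, (-1/6)*A*B^3 + (-1/6)*A^2*B^3, (1/12)*B^3 + (1/3)*A*B^3 + (1/12)*A^2*B^3, (-1/6)*B^3 + (-1/6)*A*B^3, (1/12)*B^3]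
    (by intro x; simp only [evalL]; ring1) (by simp only [antiL, Nat.cast_add, Nat.cast_zero, Nat.cast_one]; ring1)

set_option maxHeartbeats 2000000 in
set_option maxRecDepth 10000 in
lemma qc_y (A B : ℝ) :
    (∫ c in (0 : ℝ)..(A), ∫ d in (0 : ℝ)..(B), ∫ y in (0 : ℝ)..(A - c), ∫ z in (0 : ℝ)..(A - c - y), ∫ p in (0 : ℝ)..(B - d), ∫ q in (0 : ℝ)..(B - d - p), ((y - 1) ^ 2 : ℝ)) =
      (1/36)*A^3*B^3 + (-1/72)*A^4*B^3 + (1/360)*A^5*B^3 := by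
  simp only [inn_y]
  have h0 : ∀ c : ℝ, (∫ d in (0 : ℝ)..(B), ((1/4)*(A - c)^2*(B - d)^2 + (-1/6)*(A - c)^3*(B - d)^2 + (1/24)*(A - c)^4*(B - d)^2 : ℝ)) =
      (1/12)*(A - c)^2*B^3 + (-1/18)*(A - c)^3*B^3 + (1/72)*(A - c)^4*B^3 := by
    intro c
    exact pint [(1/4)*(A - c)^2*B^2 + (-1/6)*(A - c)^3*B^2 + (1/24)*(A - c)^4*B^2, (-1/2)*(A - c)^2*B + (1/3)*(A - c)^3*B + (-1/12)*(A - c)^4*B, (1/4)*(A - c)^2 + (-1/6)*(A - c)^3 + (1/24)*(A - c)^4]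
      (by intro x; simp only [evalL]; ring1) (by simp only [antiL, Nat.cast_add, Nat.cast_zero, Nat.cast_one]; ring1)
  simp only [h0]
  exact pint [(1/12)*A^2*B^3 + (-1/18)*A^3*B^3 + (1/72)*A^4*B^3, (-1/6)*A*B^3 + (1/6)*A^2*B^3 + (-1/18)*A^3*B^3, (1/12)*B^3 + (-1/6)*A*B^3 + (1/12)*A^2*B^3, (1/18)*B^3 + (-1/18)*A*B^3, (1/72)*B^3]
    (by intro x; simp only [evalL]; ring1) (by simp only [antiL, Nat.cast_add, Nat.cast_zero, Nat.cast_one]; ring1)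

set_option maxHeartbeats 2000000 in
set_option maxRecDepth 10000 in
lemma tc_k (A B n k : ℝ) :
    (∫ c in (0 : ℝ)..(n), ∫ d in (0 : ℝ)..(n - c), ∫ y in (0 : ℝ)..(A - c), ∫ z in (0 : ℝ)..(A - c - y), ∫ p in (0 : ℝ)..(B - d), ∫ q in (0 : ℝ)..(B - d - p), (k : ℝ)) =
      (1/8)*n^2*A^2*B^2*k + (-1/12)*n^3*A*B^2*k + (-1/12)*n^3*A^2*B*k + (1/48)*n^4*B^2*k + (1/24)*n^4*A*B*k + (1/48)*n^4*A^2*k + (-1/120)*n^5*B*k + (-1/120)*n^5*A*k + (1/720)*n^6*k := by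
  simp only [inn_k]
  have h0 : ∀ c : ℝ, (∫ d in (0 : ℝ)..(n - c), ((1/4)*(A - c)^2*(B - d)^2*k : ℝ)) =
      (-1/4)*c*(A - c)^2*B^2*k + (-1/4)*c^2*(A - c)^2*B*k + (-1/12)*c^3*(A - c)^2*k + (1/4)*n*(A - c)^2*B^2*k + (1/2)*n*c*(A - c)^2*B*k + (1/4)*n*c^2*(A - c)^2*k + (-1/4)*n^2*(A - c)^2*B*k + (-1/4)*n^2*c*(A - c)^2*k + (1/12)*n^3*(A - c)^2*k := by
    intro c
    exact pint [(1/4)*(A - c)^2*B^2*k, (-1/2)*(A - c)^2*B*k, (1/4)*(A - c)^2*k]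
      (by intro x; simp only [evalL]; ring1) (by simp only [antiL, Nat.cast_add, Nat.cast_zero, Nat.cast_one]; ring1)
  simp only [h0]
  exact pint [(1/4)*n*A^2*B^2*k + (-1/4)*n^2*A^2*B*k + (1/12)*n^3*A^2*k, (-1/4)*A^2*B^2*k + (-1/2)*n*A*B^2*k + (1/2)*n*A^2*B*k + (1/2)*n^2*A*B*k + (-1/4)*n^2*A^2*k + (-1/6)*n^3*A*k, (1/2)*A*B^2*k + (-1/4)*A^2*B*k + (1/4)*n*B^2*k + (-1)*n*A*B*k + (1/4)*n*A^2*k + (-1/4)*n^2*B*k + (1/2)*n^2*A*k + (1/12)*n^3*k, (-1/4)*B^2*k + (1/2)*A*B*k + (-1/12)*A^2*k + (1/2)*n*B*k + (-1/2)*n*A*k + (-1/4)*n^2*k, (-1/4)*B*k + (1/6)*A*k + (1/4)*n*k, (-1/12)*k]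
    (by intro x; simp only [evalL]; ring1) (by simp only [antiL, Nat.cast_add, Nat.cast_zero, Nat.cast_one]; ring1)

set_option maxHeartbeats 2000000 in
set_option maxRecDepth 10000 in
lemma tc_y (A B n : ℝ) :
    (∫ c in (0 : ℝ)..(n), ∫ d in (0 : ℝ)..(n - c), ∫ y in (0 : ℝ)..(A - c), ∫ z in (0 : ℝ)..(A - c - y), ∫ p in (0 : ℝ)..(B - d), ∫ q in (0 : ℝ)..(B - d - p), ((y - 1) ^ 2 : ℝ)) =
      (1/8)*n^2*A^2*B^2 + (-1/12)*n^2*A^3*B^2 + (1/48)*n^2*A^4*B^2 + (-1/12)*n^3*A*B^2 + (-1/12)*n^3*A^2*B + (1/12)*n^3*A^2*B^2 + (1/18)*n^3*A^3*B + (-1/36)*n^3*A^3*B^2 + (-1/72)*n^3*A^4*B + (1/48)*n^4*B^2 + (1/24)*n^4*A*B + (-1/24)*n^4*A*B^2 + (1/48)*n^4*A^2 + (-1/24)*n^4*A^2*B + (1/48)*n^4*A^2*B^2 + (-1/72)*n^4*A^3 + (1/72)*n^4*A^3*B + (1/288)*n^4*A^4 + (-1/120)*n^5*B + (1/120)*n^5*B^2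 + (-1/120)*n^5*A + (1/60)*n^5*A*B + (-1/120)*n^5*A*B^2 + (1/120)*n^5*A^2 + (-1/120)*n^5*A^2*B + (-1/360)*n^5*A^3 + (1/720)*n^6 + (-1/360)*n^6*B + (1/720)*n^6*B^2 + (-1/360)*n^6*A + (1/360)*n^6*A*B + (1/720)*n^6*A^2 + (1/2520)*n^7 + (-1/2520)*n^7*B + (-1/2520)*n^7*A + (1/20160)*n^8 := by
  simp only [inn_y]
  have h0 : ∀ c : ℝ, (∫ d in (0 : ℝ)..(n - c), ((1/4)*(A - c)^2*(B - d)^2 + (-1/6)*(A - c)^3*(B - d)^2 + (1/24)*(A - c)^4*(B - d)^2 : ℝ)) =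
      (-1/4)*c*(A - c)^2*B^2 + (1/6)*c*(A - c)^3*B^2 + (-1/24)*c*(A - c)^4*B^2 + (-1/4)*c^2*(A - c)^2*B + (1/6)*c^2*(A - c)^3*B + (-1/24)*c^2*(A - c)^4*B + (-1/12)*c^3*(A - c)^2 + (1/18)*c^3*(A - c)^3 + (-1/72)*c^3*(A - c)^4 + (1/4)*n*(A - c)^2*B^2 + (-1/6)*n*(A - c)^3*B^2 + (1/24)*n*(A - c)^4*B^2 + (1/2)*n*c*(A - c)^2*B + (-1/3)*n*c*(A - c)^3*B + (1/12)*n*c*(A - c)^4*B + (1/4)*n*c^2*(A - c)^2 + (-1/6)*n*c^2*(A - c)^3 + (1/24)*n*c^2*(A - c)^4 + (-1/4)*n^2*(A - c)^2*B + (1/6)*n^2*(A - c)^3*B + (-1/24)*n^2*(A - c)^4*B + (-1/4)*n^2*c*(A - c)^2 + (1/6)*n^2*c*(A - c)^3 + (-1/24)*n^2*c*(A - c)^4 + (1/12)*n^3*(A - c)^2 + (-1/18)*n^3*(A - c)^3 + (1/72)*n^3*(A - c)^4 := by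
    intro c
    exact pint [(1/4)*(A - c)^2*B^2 + (-1/6)*(A - c)^3*B^2 + (1/24)*(A - c)^4*B^2, (-1/2)*(A - c)^2*B + (1/3)*(A - c)^3*B + (-1/12)*(A - c)^4*B, (1/4)*(A - c)^2 + (-1/6)*(A - c)^3 + (1/24)*(A - c)^4]
      (by intro x; simp only [evalL]; ring1) (by simp only [antiL, Nat.cast_add, Nat.cast_zero, Nat.cast_one]; ring1)
  simp only [h0]
  exact pint [(1/4)*n*A^2*B^2 + (-1/6)*n*A^3*B^2 + (1/24)*n*A^4*B^2 + (-1/4)*n^2*A^2*B + (1/6)*n^2*A^3*B + (-1/24)*n^2*A^4*B + (1/12)*n^3*A^2 + (-1/18)*n^3*A^3 + (1/72)*n^3*A^4, (-1/4)*A^2*B^2 + (1/6)*A^3*B^2 + (-1/24)*A^4*B^2 + (-1/2)*n*A*B^2 + (1/2)*n*A^2*B + (1/2)*n*A^2*B^2 + (-1/3)*n*A^3*B + (-1/6)*n*A^3*B^2 + (1/12)*n*A^4*B + (1/2)*n^2*A*B + (-1/4)*n^2*A^2 + (-1/2)*n^2*A^2*B + (1/6)*n^2*A^3 + (1/6)*n^2*A^3*B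 + (-1/24)*n^2*A^4 + (-1/6)*n^3*A + (1/6)*n^3*A^2 + (-1/18)*n^3*A^3, (1/2)*A*B^2 + (-1/4)*A^2*B + (-1/2)*A^2*B^2 + (1/6)*A^3*B + (1/6)*A^3*B^2 + (-1/24)*A^4*B + (1/4)*n*B^2 + (-1)*n*A*B + (-1/2)*n*A*B^2 + (1/4)*n*A^2 + (1)*n*A^2*B + (1/4)*n*A^2*B^2 + (-1/6)*n*A^3 + (-1/3)*n*A^3*B + (1/24)*n*A^4 + (-1/4)*n^2*B + (1/2)*n^2*A + (1/2)*n^2*A*B + (-1/2)*n^2*A^2 + (-1/4)*n^2*A^2*B + (1/6)*n^2*A^3 + (1/12)*n^3 + (-1/6)*n^3*A + (1/12)*n^3*A^2, (-1/4)*B^2 + (1/2)*A*B + (1/2)*A*B^2 + (-1/12)*A^2 + (-1/2)*A^2*B + (-1/4)*A^2*B^2 + (1/18)*A^3 + (1/6)*A^3*B + (-1/72)*A^4 + (1/2)*n*B + (1/6)*n*B^2 + (-1/2)*n*A + (-1)*n*A*B + (-1/6)*n*A*B^2 + (1/2)*n*A^2 + (1/2)*n*A^2*B + (-1/6)*n*A^3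 + (-1/4)*n^2 + (-1/6)*n^2*B + (1/2)*n^2*A + (1/6)*n^2*A*B + (-1/4)*n^2*A^2 + (1/18)*n^3 + (-1/18)*n^3*A, (-1/4)*B + (-1/6)*B^2 + (1/6)*A + (1/2)*A*B + (1/6)*A*B^2 + (-1/6)*A^2 + (-1/4)*A^2*B + (1/18)*A^3 + (1/4)*n + (1/3)*n*B + (1/24)*n*B^2 + (-1/2)*n*A + (-1/3)*n*A*B + (1/4)*n*A^2 + (-1/6)*n^2 + (-1/24)*n^2*B + (1/6)*n^2*A + (1/72)*n^3, (-1/12) + (-1/6)*B + (-1/24)*B^2 + (1/6)*A + (1/6)*A*B + (-1/12)*A^2 + (1/6)*n + (1/12)*n*B + (-1/6)*n*A + (-1/24)*n^2, (-1/18) + (-1/24)*B + (1/18)*A + (1/24)*n, (-1/72)]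
    (by intro x; simp only [evalL]; ring1) (by simp only [antiL, Nat.cast_add, Nat.cast_zero, Nat.cast_one]; ring1)

set_option maxHeartbeats 2000000 in
set_option maxRecDepth 10000 in
lemma Q_k (k : ℝ) :
    (∫ a in (0 : ℝ)..(5), ∫ b in (0 : ℝ)..(5), ∫ c in (0 : ℝ)..(5 - a), ∫ d in (0 : ℝ)..(5 - b), ∫ y in (0 : ℝ)..(5 - a - c), ∫ z in (0 : ℝ)..(5 - a - c - y), ∫ p in (0 : ℝ)..(5 - b - d), ∫ q in (0 : ℝ)..(5 - b - d - p), (k : ℝ)) =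
      (390625/576)*k := by
  simp only [qc_k]
  have h0 : ∀ a : ℝ, (∫ b in (0 : ℝ)..(5), ((1/36)*(5 - a)^3*(5 - b)^3*k : ℝ)) =
      (625/144)*(5 - a)^3*k := by
    intro a
    exact pint [(125/36)*(5 - a)^3*k, (-25/12)*(5 - a)^3*k, (5/12)*(5 - a)^3*k, (-1/36)*(5 - a)^3*k]
      (by intro x; simp only [evalL]; ring1) (by simp only [antiL, Nat.cast_add, Nat.cast_zero, Nat.cast_one]; ring1)
  simp only [h0]
  exact pint [(78125/144)*k, (-15625/48)*k, (3125/48)*k, (-625/144)*k]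
    (by intro x; simp only [evalL]; ring1) (by simp only [antiL, Nat.cast_add, Nat.cast_zero, Nat.cast_one]; ring1)

set_option maxHeartbeats 2000000 in
set_option maxRecDepth 10000 in
lemma Q_a :
    (∫ a in (0 : ℝ)..(5), ∫ b in (0 : ℝ)..(5), ∫ c in (0 : ℝ)..(5 - a), ∫ d in (0 : ℝ)..(5 - b), ∫ y in (0 : ℝ)..(5 - a - c), ∫ z in (0 : ℝ)..(5 - a - c - y), ∫ p in (0 : ℝ)..(5 - b - d), ∫ q in (0 : ℝ)..(5 - b - d - p), ((a - 1) ^ 2 : ℝ)) =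
      (390625/864) := by
  simp only [qc_k]
  have h0 : ∀ a : ℝ, (∫ b in (0 : ℝ)..(5), ((1/36)*(5 - a)^3*(5 - b)^3*(a - 1) ^ 2 : ℝ)) =
      (625/144)*(5 - a)^3*(a - 1) ^ 2 := by
    intro a
    exact pint [(125/36)*(5 - a)^3*(a - 1) ^ 2, (-25/12)*(5 - a)^3*(a - 1) ^ 2, (5/12)*(5 - a)^3*(a - 1) ^ 2, (-1/36)*(5 - a)^3*(a - 1) ^ 2]
      (by intro x; simp only [evalL]; ring1) (by simp only [antiL, Nat.cast_add, Nat.cast_zero, Nat.cast_one]; ring1)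
  simp only [h0]
  exact pint [(78125/144), (-203125/144), (90625/72), (-33125/72), (10625/144), (-625/144)]
    (by intro x; simp only [evalL]; ring1) (by simp only [antiL, Nat.cast_add, Nat.cast_zero, Nat.cast_one]; ring1)

set_option maxHeartbeats 2000000 in
set_option maxRecDepth 10000 in
lemma Q_y :
    (∫ a in (0 : ℝ)..(5), ∫ b in (0 : ℝ)..(5), ∫ c in (0 : ℝ)..(5 - a), ∫ d in (0 : ℝ)..(5 - b), ∫ y in (0 : ℝ)..(5 - a - c), ∫ z in (0 : ℝ)..(5 - a - c - y), ∫ p in (0 : ℝ)..(5 - b - d), ∫ q in (0 : ℝ)..(5 - b - d - p), ((y - 1) ^ 2 : ℝ)) =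
      (390625/864) := by
  simp only [qc_y]
  have h0 : ∀ a : ℝ, (∫ b in (0 : ℝ)..(5), ((1/36)*(5 - a)^3*(5 - b)^3 + (-1/72)*(5 - a)^4*(5 - b)^3 + (1/360)*(5 - a)^5*(5 - b)^3 : ℝ)) =
      (625/144)*(5 - a)^3 + (-625/288)*(5 - a)^4 + (125/288)*(5 - a)^5 := by
    intro a
    exact pint [(125/36)*(5 - a)^3 + (-125/72)*(5 - a)^4 + (25/72)*(5 - a)^5, (-25/12)*(5 - a)^3 + (25/24)*(5 - a)^4 + (-5/24)*(5 - a)^5, (5/12)*(5 - a)^3 + (-5/24)*(5 - a)^4 + (1/24)*(5 - a)^5, (-1/36)*(5 - a)^3 + (1/72)*(5 - a)^4 + (-1/360)*(5 - a)^5]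
      (by intro x; simp only [evalL]; ring1) (by simp only [antiL, Nat.cast_add, Nat.cast_zero, Nat.cast_one]; ring1)
  simp only [h0]
  exact pint [(78125/144), (-171875/288), (40625/144), (-625/9), (625/72), (-125/288)]
    (by intro x; simp only [evalL]; ring1) (by simp only [antiL, Nat.cast_add, Nat.cast_zero, Nat.cast_one]; ring1)

set_option maxHeartbeats 2000000 in
set_option maxRecDepth 10000 in
lemma O_k (m k : ℝ) :
    (∫ a in (0 : ℝ)..(m), ∫ b in (0 : ℝ)..(m - a), ∫ c in (0 : ℝ)..(5 - a), ∫ d in (0 : ℝ)..(5 - b), ∫ y in (0 : ℝ)..(5 - a - c), ∫ z in (0 : ℝ)..(5 - a - c - y), ∫ p in (0 : ℝ)..(5 - b - d), ∫ q in (0 : ℝ)..(5 - b - d - p), (k : ℝ)) =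
      (15625/72)*m^2*k + (-3125/36)*m^3*k + (4375/288)*m^4*k + (-25/18)*m^5*k + (5/72)*m^6*k + (-1/504)*m^7*k + (1/40320)*m^8*k := by
  simp only [qc_k]
  have h0 : ∀ a : ℝ, (∫ b in (0 : ℝ)..(m - a), ((1/36)*(5 - a)^3*(5 - b)^3*k : ℝ)) =
      (125/36)*(5 - a)^3*(m - a)*k + (-25/24)*(5 - a)^3*(m - a)^2*k + (5/36)*(5 - a)^3*(m - a)^3*k + (-1/144)*(5 - a)^3*(m - a)^4*k := by
    intro a
    exact pint [(125/36)*(5 - a)^3*k, (-25/12)*(5 - a)^3*k, (5/12)*(5 - a)^3*k, (-1/36)*(5 - a)^3*k]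
      (by intro x; simp only [evalL]; ring1) (by simp only [antiL, Nat.cast_add, Nat.cast_zero, Nat.cast_one]; ring1)
  simp only [h0]
  exact pint [(15625/36)*m*k + (-3125/24)*m^2*k + (625/36)*m^3*k + (-125/144)*m^4*k, (-15625/36)*k + (625/24)*m^2*k + (-125/18)*m^3*k + (25/48)*m^4*k, (3125/24)*k + (-625/12)*m*k + (125/12)*m^2*k + (-5/48)*m^4*k, (625/72)*k + (-25/12)*m^2*k + (5/18)*m^3*k + (1/144)*m^4*k, (-125/48)*k + (25/12)*m*k + (-5/24)*m^2*k + (-1/36)*m^3*k, (-25/48)*k + (1/24)*m^2*k, (5/144)*k + (-1/36)*m*k, (1/144)*k]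
    (by intro x; simp only [evalL]; ring1) (by simp only [antiL, Nat.cast_add, Nat.cast_zero, Nat.cast_one]; ring1)

set_option maxHeartbeats 2000000 in
set_option maxRecDepth 10000 in
lemma O_a (m : ℝ) :
    (∫ a in (0 : ℝ)..(m), ∫ b in (0 : ℝ)..(m - a), ∫ c in (0 : ℝ)..(5 - a), ∫ d in (0 : ℝ)..(5 - b), ∫ y in (0 : ℝ)..(5 - a - c), ∫ z in (0 : ℝ)..(5 - a - c - y), ∫ p in (0 : ℝ)..(5 - b - d), ∫ q in (0 : ℝ)..(5 - b - d - p), ((a - 1) ^ 2 : ℝ)) =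
      (15625/72)*m^2 + (-6250/27)*m^3 + (100625/864)*m^4 + (-2225/72)*m^5 + (3935/864)*m^6 + (-71/189)*m^7 + (29/1680)*m^8 + (-1/2160)*m^9 + (1/181440)*m^10 := by
  simp only [qc_k]
  have h0 : ∀ a : ℝ, (∫ b in (0 : ℝ)..(m - a), ((1/36)*(5 - a)^3*(5 - b)^3*(a - 1) ^ 2 : ℝ)) =
      (125/36)*(5 - a)^3*(m - a)*(a - 1) ^ 2 + (-25/24)*(5 - a)^3*(m - a)^2*(a - 1) ^ 2 + (5/36)*(5 - a)^3*(m - a)^3*(a - 1) ^ 2 + (-1/144)*(5 - a)^3*(m - a)^4*(a - 1) ^ 2 := by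
    intro a
    exact pint [(125/36)*(5 - a)^3*(a - 1) ^ 2, (-25/12)*(5 - a)^3*(a - 1) ^ 2, (5/12)*(5 - a)^3*(a - 1) ^ 2, (-1/36)*(5 - a)^3*(a - 1) ^ 2]
      (by intro x; simp only [evalL]; ring1) (by simp only [antiL, Nat.cast_add, Nat.cast_zero, Nat.cast_one]; ring1)
  simp only [h0]
  exact pint [(15625/36)*m + (-3125/24)*m^2 + (625/36)*m^3 + (-125/144)*m^4, (-15625/36) + (-15625/18)*m + (6875/24)*m^2 + (-125/3)*m^3 + (325/144)*m^4, (71875/72) + (6875/18)*m + (-1375/8)*m^2 + (125/4)*m^3 + (-145/72)*m^4, (-49375/72) + (625/6)*m + (25/8)*m^2 + (-20/3)*m^3 + (53/72)*m^4, (15875/144) + (-50)*m + (115/8)*m^2 + (-7/12)*m^3 + (-17/144)*m^4, (1925/144) + (-25/6)*m + (-13/8)*m^2 + (1/3)*m^3 + (1/144)*m^4, (-55/36) + (37/18)*m + (-7/24)*m^2 + (-1/36)*m^3, (-7/12) + (1/18)*m + (1/24)*m^2, (1/48) + (-1/36)*m, (1/144)]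
    (by intro x; simp only [evalL]; ring1) (by simp only [antiL, Nat.cast_add, Nat.cast_zero, Nat.cast_one]; ring1)

set_option maxHeartbeats 2000000 in
set_option maxRecDepth 10000 in
lemma O_c (m : ℝ) :
    (∫ a in (0 : ℝ)..(m), ∫ b in (0 : ℝ)..(m - a), ∫ c in (0 : ℝ)..(5 - a), ∫ d in (0 : ℝ)..(5 - b), ∫ y in (0 : ℝ)..(5 - a - c), ∫ z in (0 : ℝ)..(5 - a - c - y), ∫ p in (0 : ℝ)..(5 - b - d), ∫ q in (0 : ℝ)..(5 - b - d - p), ((c - 1) ^ 2 : ℝ)) =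
      (15625/72)*m^2 + (-53125/432)*m^3 + (60625/1728)*m^4 + (-1775/288)*m^5 + (1195/1728)*m^6 + (-73/1512)*m^7 + (9/4480)*m^8 + (-1/20160)*m^9 + (1/1814400)*m^10 := by
  simp only [qc_c]
  have h0 : ∀ a : ℝ, (∫ b in (0 : ℝ)..(m - a), ((1/36)*(5 - a)^3*(5 - b)^3 + (-1/72)*(5 - a)^4*(5 - b)^3 + (1/360)*(5 - a)^5*(5 - b)^3 : ℝ)) =
      (125/36)*(5 - a)^3*(m - a) + (-25/24)*(5 - a)^3*(m - a)^2 + (5/36)*(5 - a)^3*(m - a)^3 + (-1/144)*(5 - a)^3*(m - a)^4 + (-125/72)*(5 - a)^4*(m - a) + (25/48)*(5 - a)^4*(m - a)^2 + (-5/72)*(5 - a)^4*(m - a)^3 + (1/288)*(5 - a)^4*(m - a)^4 + (25/72)*(5 - a)^5*(m - a) + (-5/48)*(5 - a)^5*(m - a)^2 + (1/72)*(5 - a)^5*(m - a)^3 + (-1/1440)*(5 - a)^5*(m - a)^4 := by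
    intro a
    exact pint [(125/36)*(5 - a)^3 + (-125/72)*(5 - a)^4 + (25/72)*(5 - a)^5, (-25/12)*(5 - a)^3 + (25/24)*(5 - a)^4 + (-5/24)*(5 - a)^5, (5/12)*(5 - a)^3 + (-5/24)*(5 - a)^4 + (1/24)*(5 - a)^5, (-1/36)*(5 - a)^3 + (1/72)*(5 - a)^4 + (-1/360)*(5 - a)^5]
      (by intro x; simp only [evalL]; ring1) (by simp only [antiL, Nat.cast_add, Nat.cast_zero, Nat.cast_one]; ring1)
  simp only [h0]
  exact pint [(15625/36)*m + (-3125/24)*m^2 + (625/36)*m^3 + (-125/144)*m^4, (-15625/36) + (-15625/72)*m + (4375/48)*m^2 + (-125/8)*m^3 + (275/288)*m^4, (3125/9) + (-625/72)*m + (-125/8)*m^2 + (125/24)*m^3 + (-65/144)*m^4, (-14375/144) + (625/24)*m + (-75/16)*m^2 + (-5/12)*m^3 + (1/9)*m^4, (875/144) + (-25/8)*m + (15/8)*m^2 + (-1/6)*m^3 + (-1/72)*m^4, (475/288) + (-25/24)*m + (-1/16)*m^2 + (1/24)*m^3 + (1/1440)*m^4, (5/144) + (13/72)*m + (-1/24)*m^2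 + (-1/360)*m^3, (-1/16) + (1/72)*m + (1/240)*m^2, (-1/360)*m, (1/1440)]
    (by intro x; simp only [evalL]; ring1) (by simp only [antiL, Nat.cast_add, Nat.cast_zero, Nat.cast_one]; ring1)

set_option maxHeartbeats 2000000 in
set_option maxRecDepth 10000 in
lemma O_y (m : ℝ) :
    (∫ a in (0 : ℝ)..(m), ∫ b in (0 : ℝ)..(m - a), ∫ c in (0 : ℝ)..(5 - a), ∫ d in (0 : ℝ)..(5 - b), ∫ y in (0 : ℝ)..(5 - a - c), ∫ z in (0 : ℝ)..(5 - a - c - y), ∫ p in (0 : ℝ)..(5 - b - d), ∫ q in (0 : ℝ)..(5 - b - d - p), ((y - 1) ^ 2 : ℝ)) =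
      (15625/72)*m^2 + (-53125/432)*m^3 + (60625/1728)*m^4 + (-1775/288)*m^5 + (1195/1728)*m^6 + (-73/1512)*m^7 + (9/4480)*m^8 + (-1/20160)*m^9 + (1/1814400)*m^10 := by
  simp only [qc_y]
  have h0 : ∀ a : ℝ, (∫ b in (0 : ℝ)..(m - a), ((1/36)*(5 - a)^3*(5 - b)^3 + (-1/72)*(5 - a)^4*(5 - b)^3 + (1/360)*(5 - a)^5*(5 - b)^3 : ℝ)) =
      (125/36)*(5 - a)^3*(m - a) + (-25/24)*(5 - a)^3*(m - a)^2 + (5/36)*(5 - a)^3*(m - a)^3 + (-1/144)*(5 - a)^3*(m - a)^4 + (-125/72)*(5 - a)^4*(m - a) + (25/48)*(5 - a)^4*(m - a)^2 + (-5/72)*(5 - a)^4*(m - a)^3 + (1/288)*(5 - a)^4*(m - a)^4 + (25/72)*(5 - a)^5*(m - a) + (-5/48)*(5 - a)^5*(m - a)^2 + (1/72)*(5 - a)^5*(m - a)^3 + (-1/1440)*(5 - a)^5*(m - a)^4 := by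
    intro a
    exact pint [(125/36)*(5 - a)^3 + (-125/72)*(5 - a)^4 + (25/72)*(5 - a)^5, (-25/12)*(5 - a)^3 + (25/24)*(5 - a)^4 + (-5/24)*(5 - a)^5, (5/12)*(5 - a)^3 + (-5/24)*(5 - a)^4 + (1/24)*(5 - a)^5, (-1/36)*(5 - a)^3 + (1/72)*(5 - a)^4 + (-1/360)*(5 - a)^5]
      (by intro x; simp only [evalL]; ring1) (by simp only [antiL, Nat.cast_add, Nat.cast_zero, Nat.cast_one]; ring1)
  simp only [h0]
  exact pint [(15625/36)*m + (-3125/24)*m^2 + (625/36)*m^3 + (-125/144)*m^4, (-15625/36) + (-15625/72)*m + (4375/48)*m^2 + (-125/8)*m^3 + (275/288)*m^4, (3125/9) + (-625/72)*m + (-125/8)*m^2 + (125/24)*m^3 + (-65/144)*m^4, (-14375/144) + (625/24)*m + (-75/16)*m^2 + (-5/12)*m^3 + (1/9)*m^4, (875/144) + (-25/8)*m + (15/8)*m^2 + (-1/6)*m^3 + (-1/72)*m^4, (475/288) + (-25/24)*m + (-1/16)*m^2 + (1/24)*m^3 + (1/1440)*m^4, (5/144) + (13/72)*m + (-1/24)*m^2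 + (-1/360)*m^3, (-1/16) + (1/72)*m + (1/240)*m^2, (-1/360)*m, (1/1440)]
    (by intro x; simp only [evalL]; ring1) (by simp only [antiL, Nat.cast_add, Nat.cast_zero, Nat.cast_one]; ring1)

set_option maxHeartbeats 2000000 in
set_option maxRecDepth 10000 in
lemma H_k (m n k : ℝ) :
    (∫ a in (0 : ℝ)..(m), ∫ b in (0 : ℝ)..(m - a), ∫ c in (0 : ℝ)..(n), ∫ d in (0 : ℝ)..(n - c), ∫ y in (0 : ℝ)..(5 - a - c), ∫ z in (0 : ℝ)..(5 - a - c - y), ∫ p in (0 : ℝ)..(5 - b - d), ∫ q in (0 : ℝ)..(5 - b - d - p), (k : ℝ)) =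
      (625/16)*m^2*n^2*k + (-125/12)*m^2*n^3*k + (25/24)*m^2*n^4*k + (-1/24)*m^2*n^5*k + (1/1440)*m^2*n^6*k + (-125/12)*m^3*n^2*k + (25/12)*m^3*n^3*k + (-5/36)*m^3*n^4*k + (1/360)*m^3*n^5*k + (25/24)*m^4*n^2*k + (-5/36)*m^4*n^3*k + (1/192)*m^4*n^4*k + (-1/24)*m^5*n^2*k + (1/360)*m^5*n^3*k + (1/1440)*m^6*n^2*k := by
  simp only [tc_k]
  have h0 : ∀ a : ℝ, (∫ b in (0 : ℝ)..(m - a), ((1/8)*n^2*(5 - a)^2*(5 - b)^2*k + (-1/12)*n^3*(5 - a)*(5 - b)^2*k + (-1/12)*n^3*(5 - a)^2*(5 - b)*k + (1/48)*n^4*(5 - b)^2*k + (1/24)*n^4*(5 - a)*(5 - b)*k + (1/48)*n^4*(5 - a)^2*k + (-1/120)*n^5*(5 - b)*k + (-1/120)*n^5*(5 - a)*k + (1/720)*n^6*k : ℝ)) =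
      (25/8)*n^2*(5 - a)^2*(m - a)*k + (-5/8)*n^2*(5 - a)^2*(m - a)^2*k + (1/24)*n^2*(5 - a)^2*(m - a)^3*k + (-25/12)*n^3*(5 - a)*(m - a)*k + (5/12)*n^3*(5 - a)*(m - a)^2*k + (-1/36)*n^3*(5 - a)*(m - a)^3*k + (-5/12)*n^3*(5 - a)^2*(m - a)*k + (1/24)*n^3*(5 - a)^2*(m - a)^2*k + (25/48)*n^4*(m - a)*k + (-5/48)*n^4*(m - a)^2*k + (1/144)*n^4*(m - a)^3*k + (5/24)*n^4*(5 - a)*(m - a)*k + (-1/48)*n^4*(5 - a)*(m - a)^2*k + (1/48)*n^4*(5 - a)^2*(m - a)*k + (-1/24)*n^5*(m - a)*k + (1/240)*n^5*(m - a)^2*k + (-1/120)*n^5*(5 - a)*(m - a)*k + (1/720)*n^6*(m - a)*k := by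
    intro a
    exact pint [(25/8)*n^2*(5 - a)^2*k + (-25/12)*n^3*(5 - a)*k + (-5/12)*n^3*(5 - a)^2*k + (25/48)*n^4*k + (5/24)*n^4*(5 - a)*k + (1/48)*n^4*(5 - a)^2*k + (-1/24)*n^5*k + (-1/120)*n^5*(5 - a)*k + (1/720)*n^6*k, (-5/4)*n^2*(5 - a)^2*k + (5/6)*n^3*(5 - a)*k + (1/12)*n^3*(5 - a)^2*k + (-5/24)*n^4*k + (-1/24)*n^4*(5 - a)*k + (1/120)*n^5*k, (1/8)*n^2*(5 - a)^2*k + (-1/12)*n^3*(5 - a)*k + (1/48)*n^4*k]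
      (by intro x; simp only [evalL]; ring1) (by simp only [antiL, Nat.cast_add, Nat.cast_zero, Nat.cast_one]; ring1)
  simp only [h0]
  exact pint [(625/8)*m*n^2*k + (-125/6)*m*n^3*k + (25/12)*m*n^4*k + (-1/12)*m*n^5*k + (1/720)*m*n^6*k + (-125/8)*m^2*n^2*k + (25/8)*m^2*n^3*k + (-5/24)*m^2*n^4*k + (1/240)*m^2*n^5*k + (25/24)*m^3*n^2*k + (-5/36)*m^3*n^3*k + (1/144)*m^3*n^4*k, (-625/8)*n^2*k + (125/6)*n^3*k + (-25/12)*n^4*k + (1/12)*n^5*k + (-1/720)*n^6*k + (25/8)*m^2*n^2*k + (-5/12)*m^2*n^3*k + (-5/12)*m^3*n^2*k + (1/36)*m^3*n^3*k, (125/8)*n^2*k + (-25/8)*n^3*k + (5/24)*n^4*k + (-1/240)*n^5*k + (-25/4)*m*n^2*k + (5/6)*m*n^3*k + (5/8)*m^2*n^2*k + (-1/24)*m^2*n^3*k + (1/24)*m^3*n^2*k, (25/12)*n^2*k + (-5/18)*n^3*k + (-1/144)*n^4*k + (-1/8)*m^2*n^2*k, (-5/24)*n^2*k + (1/72)*n^3*k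 + (1/8)*m*n^2*k, (-1/24)*n^2*k]
    (by intro x; simp only [evalL]; ring1) (by simp only [antiL, Nat.cast_add, Nat.cast_zero, Nat.cast_one]; ring1)

set_option maxHeartbeats 2000000 in
set_option maxRecDepth 10000 in
lemma H_a (m n : ℝ) :
    (∫ a in (0 : ℝ)..(m), ∫ b in (0 : ℝ)..(m - a), ∫ c in (0 : ℝ)..(n), ∫ d in (0 : ℝ)..(n - c), ∫ y in (0 : ℝ)..(5 - a - c), ∫ z in (0 : ℝ)..(5 - a - c - y), ∫ p in (0 : ℝ)..(5 - b - d), ∫ q in (0 : ℝ)..(5 - b - d - p), ((a - 1) ^ 2 : ℝ)) =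
      (625/16)*m^2*n^2 + (-125/12)*m^2*n^3 + (25/24)*m^2*n^4 + (-1/24)*m^2*n^5 + (1/1440)*m^2*n^6 + (-875/24)*m^3*n^2 + (325/36)*m^3*n^3 + (-5/6)*m^3*n^4 + (11/360)*m^3*n^5 + (-1/2160)*m^3*n^6 + (1475/96)*m^4*n^2 + (-55/16)*m^4*n^3 + (163/576)*m^4*n^4 + (-13/1440)*m^4*n^5 + (1/8640)*m^4*n^6 + (-71/24)*m^5*n^2 + (191/360)*m^5*n^3 + (-23/720)*m^5*n^4 + (1/1800)*m^5*n^5 + (47/180)*m^6*n^2 + (-7/216)*m^6*n^3 + (1/864)*m^6*n^4 + (-1/105)*m^7*n^2 + (1/1680)*m^7*n^3 + (1/6720)*m^8*n^2 := by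
  simp only [tc_k]
  have h0 : ∀ a : ℝ, (∫ b in (0 : ℝ)..(m - a), ((1/8)*n^2*(5 - a)^2*(5 - b)^2*(a - 1) ^ 2 + (-1/12)*n^3*(5 - a)*(5 - b)^2*(a - 1) ^ 2 + (-1/12)*n^3*(5 - a)^2*(5 - b)*(a - 1) ^ 2 + (1/48)*n^4*(5 - b)^2*(a - 1) ^ 2 + (1/24)*n^4*(5 - a)*(5 - b)*(a - 1) ^ 2 + (1/48)*n^4*(5 - a)^2*(a - 1) ^ 2 + (-1/120)*n^5*(5 - b)*(a - 1) ^ 2 + (-1/120)*n^5*(5 - a)*(a - 1) ^ 2 + (1/720)*n^6*(a - 1) ^ 2 : ℝ)) =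
      (25/8)*n^2*(5 - a)^2*(m - a)*(a - 1) ^ 2 + (-5/8)*n^2*(5 - a)^2*(m - a)^2*(a - 1) ^ 2 + (1/24)*n^2*(5 - a)^2*(m - a)^3*(a - 1) ^ 2 + (-25/12)*n^3*(5 - a)*(m - a)*(a - 1) ^ 2 + (5/12)*n^3*(5 - a)*(m - a)^2*(a - 1) ^ 2 + (-1/36)*n^3*(5 - a)*(m - a)^3*(a - 1) ^ 2 + (-5/12)*n^3*(5 - a)^2*(m - a)*(a - 1) ^ 2 + (1/24)*n^3*(5 - a)^2*(m - a)^2*(a - 1) ^ 2 + (25/48)*n^4*(m - a)*(a - 1) ^ 2 + (-5/48)*n^4*(m - a)^2*(a - 1) ^ 2 + (1/144)*n^4*(m - a)^3*(a - 1) ^ 2 + (5/24)*n^4*(5 - a)*(m - a)*(a - 1) ^ 2 + (-1/48)*n^4*(5 - a)*(m - a)^2*(a - 1) ^ 2 + (1/48)*n^4*(5 - a)^2*(m - a)*(a - 1) ^ 2 + (-1/24)*n^5*(m - a)*(a - 1) ^ 2 + (1/240)*n^5*(m - a)^2*(a - 1) ^ 2 + (-1/120)*n^5*(5 - a)*(m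 - a)*(a - 1) ^ 2 + (1/720)*n^6*(m - a)*(a - 1) ^ 2 := by
    intro a
    exact pint [(25/8)*n^2*(5 - a)^2*(a - 1) ^ 2 + (-25/12)*n^3*(5 - a)*(a - 1) ^ 2 + (-5/12)*n^3*(5 - a)^2*(a - 1) ^ 2 + (25/48)*n^4*(a - 1) ^ 2 + (5/24)*n^4*(5 - a)*(a - 1) ^ 2 + (1/48)*n^4*(5 - a)^2*(a - 1) ^ 2 + (-1/24)*n^5*(a - 1) ^ 2 + (-1/120)*n^5*(5 - a)*(a - 1) ^ 2 + (1/720)*n^6*(a - 1) ^ 2, (-5/4)*n^2*(5 - a)^2*(a - 1) ^ 2 + (5/6)*n^3*(5 - a)*(a - 1) ^ 2 + (1/12)*n^3*(5 - a)^2*(a - 1) ^ 2 + (-5/24)*n^4*(a - 1) ^ 2 + (-1/24)*n^4*(5 - a)*(a - 1) ^ 2 + (1/120)*n^5*(a - 1) ^ 2, (1/8)*n^2*(5 - a)^2*(a - 1) ^ 2 + (-1/12)*n^3*(5 - a)*(a - 1) ^ 2 + (1/48)*n^4*(a - 1) ^ 2]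
      (by intro x; simp only [evalL]; ring1) (by simp only [antiL, Nat.cast_add, Nat.cast_zero, Nat.cast_one]; ring1)
  simp only [h0]
  exact pint [(625/8)*m*n^2 + (-125/6)*m*n^3 + (25/12)*m*n^4 + (-1/12)*m*n^5 + (1/720)*m*n^6 + (-125/8)*m^2*n^2 + (25/8)*m^2*n^3 + (-5/24)*m^2*n^4 + (1/240)*m^2*n^5 + (25/24)*m^3*n^2 + (-5/36)*m^3*n^3 + (1/144)*m^3*n^4, (-625/8)*n^2 + (125/6)*n^3 + (-25/12)*n^4 + (1/12)*n^5 + (-1/720)*n^6 + (-625/4)*m*n^2 + (125/3)*m*n^3 + (-25/6)*m*n^4 + (1/6)*m*n^5 + (-1/360)*m*n^6 + (275/8)*m^2*n^2 + (-20/3)*m^2*n^3 + (5/12)*m^2*n^4 + (-1/120)*m^2*n^5 + (-5/2)*m^3*n^2 + (11/36)*m^3*n^3 + (-1/72)*m^3*n^4, (1375/8)*n^2 + (-1075/24)*n^3 + (35/8)*n^4 + (-41/240)*n^5 + (1/360)*n^6 + (575/8)*m*n^2 + (-20)*m*n^3 + (25/12)*m*n^4 + (-1/12)*m*n^5 + (1/720)*m*n^6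 + (-85/4)*m^2*n^2 + (47/12)*m^2*n^3 + (-5/24)*m^2*n^4 + (1/240)*m^2*n^5 + (23/12)*m^3*n^2 + (-7/36)*m^3*n^3 + (1/144)*m^3*n^4, (-2575/24)*n^2 + (965/36)*n^3 + (-361/144)*n^4 + (11/120)*n^5 + (-1/720)*n^6 + (25/2)*m*n^2 + (-5/3)*m*n^3 + (7/4)*m^2*n^2 + (-1/3)*m^2*n^3 + (-1/2)*m^3*n^2 + (1/36)*m^3*n^3, (45/4)*n^2 + (-23/9)*n^3 + (2/9)*n^4 + (-1/240)*n^5 + (-49/8)*m*n^2 + (5/6)*m*n^3 + (7/8)*m^2*n^2 + (-1/24)*m^2*n^3 + (1/24)*m^3*n^2, (59/24)*n^2 + (-11/36)*n^3 + (-1/144)*n^4 + (-1/4)*m*n^2 + (-1/8)*m^2*n^2, (-1/8)*n^2 + (1/72)*n^3 + (1/8)*m*n^2, (-1/24)*n^2]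
    (by intro x; simp only [evalL]; ring1) (by simp only [antiL, Nat.cast_add, Nat.cast_zero, Nat.cast_one]; ring1)

set_option maxHeartbeats 2000000 in
set_option maxRecDepth 10000 in
lemma H_y (m n : ℝ) :
    (∫ a in (0 : ℝ)..(m), ∫ b in (0 : ℝ)..(m - a), ∫ c in (0 : ℝ)..(n), ∫ d in (0 : ℝ)..(n - c), ∫ y in (0 : ℝ)..(5 - a - c), ∫ z in (0 : ℝ)..(5 - a - c - y), ∫ p in (0 : ℝ)..(5 - b - d), ∫ q in (0 : ℝ)..(5 - b - d - p), ((y - 1) ^ 2 : ℝ)) =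
      (6875/96)*m^2*n^2 + (-4625/144)*m^2*n^3 + (1325/192)*m^2*n^4 + (-121/144)*m^2*n^5 + (9/160)*m^2*n^6 + (-1/560)*m^2*n^7 + (1/40320)*m^2*n^8 + (-4625/144)*m^3*n^2 + (5275/432)*m^3*n^3 + (-455/216)*m^3*n^4 + (137/720)*m^3*n^5 + (-1/120)*m^3*n^6 + (1/7560)*m^3*n^7 + (1325/192)*m^4*n^2 + (-455/216)*m^4*n^3 + (17/64)*m^4*n^4 + (-11/720)*m^4*n^5 + (1/2880)*m^4*n^6 + (-121/144)*m^5*n^2 + (137/720)*m^5*n^3 + (-11/720)*m^5*n^4 + (1/2400)*m^5*n^5 + (9/160)*m^6*n^2 + (-1/120)*m^6*n^3 + (1/2880)*m^6*n^4 + (-1/560)*m^7*n^2 + (1/7560)*m^7*n^3 + (1/40320)*m^8*n^2 := by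
  simp only [tc_y]
  have h0 : ∀ a : ℝ, (∫ b in (0 : ℝ)..(m - a), ((1/8)*n^2*(5 - a)^2*(5 - b)^2 + (-1/12)*n^2*(5 - a)^3*(5 - b)^2 + (1/48)*n^2*(5 - a)^4*(5 - b)^2 + (-1/12)*n^3*(5 - a)*(5 - b)^2 + (-1/12)*n^3*(5 - a)^2*(5 - b) + (1/12)*n^3*(5 - a)^2*(5 - b)^2 + (1/18)*n^3*(5 - a)^3*(5 - b) + (-1/36)*n^3*(5 - a)^3*(5 - b)^2 + (-1/72)*n^3*(5 - a)^4*(5 - b) + (1/48)*n^4*(5 - b)^2 + (1/24)*n^4*(5 - a)*(5 - b) + (-1/24)*n^4*(5 - a)*(5 - b)^2 + (1/48)*n^4*(5 - a)^2 + (-1/24)*n^4*(5 - a)^2*(5 - b) + (1/48)*n^4*(5 - a)^2*(5 - b)^2 + (-1/72)*n^4*(5 - a)^3 + (1/72)*n^4*(5 - a)^3*(5 - b) + (1/288)*n^4*(5 - a)^4 + (-1/120)*n^5*(5 - b) + (1/120)*n^5*(5 - b)^2 + (-1/120)*n^5*(5 - a) + (1/60)*n^5*(5 - a)*(5 - b)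 + (-1/120)*n^5*(5 - a)*(5 - b)^2 + (1/120)*n^5*(5 - a)^2 + (-1/120)*n^5*(5 - a)^2*(5 - b) + (-1/360)*n^5*(5 - a)^3 + (1/720)*n^6 + (-1/360)*n^6*(5 - b) + (1/720)*n^6*(5 - b)^2 + (-1/360)*n^6*(5 - a) + (1/360)*n^6*(5 - a)*(5 - b) + (1/720)*n^6*(5 - a)^2 + (1/2520)*n^7 + (-1/2520)*n^7*(5 - b) + (-1/2520)*n^7*(5 - a) + (1/20160)*n^8 : ℝ)) =
      (25/8)*n^2*(5 - a)^2*(m - a) + (-5/8)*n^2*(5 - a)^2*(m - a)^2 + (1/24)*n^2*(5 - a)^2*(m - a)^3 + (-25/12)*n^2*(5 - a)^3*(m - a) + (5/12)*n^2*(5 - a)^3*(m - a)^2 + (-1/36)*n^2*(5 - a)^3*(m - a)^3 + (25/48)*n^2*(5 - a)^4*(m - a) + (-5/48)*n^2*(5 - a)^4*(m - a)^2 + (1/144)*n^2*(5 - a)^4*(m - a)^3 + (-25/12)*n^3*(5 - a)*(m - a) + (5/12)*n^3*(5 - a)*(m - a)^2 + (-1/36)*n^3*(5 - a)*(m - a)^3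 + (5/3)*n^3*(5 - a)^2*(m - a) + (-3/8)*n^3*(5 - a)^2*(m - a)^2 + (1/36)*n^3*(5 - a)^2*(m - a)^3 + (-5/12)*n^3*(5 - a)^3*(m - a) + (1/9)*n^3*(5 - a)^3*(m - a)^2 + (-1/108)*n^3*(5 - a)^3*(m - a)^3 + (-5/72)*n^3*(5 - a)^4*(m - a) + (1/144)*n^3*(5 - a)^4*(m - a)^2 + (25/48)*n^4*(m - a) + (-5/48)*n^4*(m - a)^2 + (1/144)*n^4*(m - a)^3 + (-5/6)*n^4*(5 - a)*(m - a) + (3/16)*n^4*(5 - a)*(m - a)^2 + (-1/72)*n^4*(5 - a)*(m - a)^3 + (1/3)*n^4*(5 - a)^2*(m - a) + (-1/12)*n^4*(5 - a)^2*(m - a)^2 + (1/144)*n^4*(5 - a)^2*(m - a)^3 + (1/18)*n^4*(5 - a)^3*(m - a) + (-1/144)*n^4*(5 - a)^3*(m - a)^2 + (1/288)*n^4*(5 - a)^4*(m - a) + (1/6)*n^5*(m - a) + (-3/80)*n^5*(m - a)^2 + (1/360)*n^5*(m - a)^3 + (-2/15)*n^5*(5 - a)*(m - a) + (1/30)*n^5*(5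 - a)*(m - a)^2 + (-1/360)*n^5*(5 - a)*(m - a)^3 + (-1/30)*n^5*(5 - a)^2*(m - a) + (1/240)*n^5*(5 - a)^2*(m - a)^2 + (-1/360)*n^5*(5 - a)^3*(m - a) + (1/45)*n^6*(m - a) + (-1/180)*n^6*(m - a)^2 + (1/2160)*n^6*(m - a)^3 + (1/90)*n^6*(5 - a)*(m - a) + (-1/720)*n^6*(5 - a)*(m - a)^2 + (1/720)*n^6*(5 - a)^2*(m - a) + (-1/630)*n^7*(m - a) + (1/5040)*n^7*(m - a)^2 + (-1/2520)*n^7*(5 - a)*(m - a) + (1/20160)*n^8*(m - a) := by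
    intro a
    exact pint [(25/8)*n^2*(5 - a)^2 + (-25/12)*n^2*(5 - a)^3 + (25/48)*n^2*(5 - a)^4 + (-25/12)*n^3*(5 - a) + (5/3)*n^3*(5 - a)^2 + (-5/12)*n^3*(5 - a)^3 + (-5/72)*n^3*(5 - a)^4 + (25/48)*n^4 + (-5/6)*n^4*(5 - a) + (1/3)*n^4*(5 - a)^2 + (1/18)*n^4*(5 - a)^3 + (1/288)*n^4*(5 - a)^4 + (1/6)*n^5 + (-2/15)*n^5*(5 - a) + (-1/30)*n^5*(5 - a)^2 + (-1/360)*n^5*(5 - a)^3 + (1/45)*n^6 + (1/90)*n^6*(5 - a) + (1/720)*n^6*(5 - a)^2 + (-1/630)*n^7 + (-1/2520)*n^7*(5 - a) + (1/20160)*n^8, (-5/4)*n^2*(5 - a)^2 + (5/6)*n^2*(5 - a)^3 + (-5/24)*n^2*(5 - a)^4 + (5/6)*n^3*(5 - a) + (-3/4)*n^3*(5 - a)^2 + (2/9)*n^3*(5 - a)^3 + (1/72)*n^3*(5 - a)^4 + (-5/24)*n^4 + (3/8)*n^4*(5 - a) + (-1/6)*n^4*(5 - a)^2 + (-1/72)*n^4*(5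 - a)^3 + (-3/40)*n^5 + (1/15)*n^5*(5 - a) + (1/120)*n^5*(5 - a)^2 + (-1/90)*n^6 + (-1/360)*n^6*(5 - a) + (1/2520)*n^7, (1/8)*n^2*(5 - a)^2 + (-1/12)*n^2*(5 - a)^3 + (1/48)*n^2*(5 - a)^4 + (-1/12)*n^3*(5 - a) + (1/12)*n^3*(5 - a)^2 + (-1/36)*n^3*(5 - a)^3 + (1/48)*n^4 + (-1/24)*n^4*(5 - a) + (1/48)*n^4*(5 - a)^2 + (1/120)*n^5 + (-1/120)*n^5*(5 - a) + (1/720)*n^6]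
      (by intro x; simp only [evalL]; ring1) (by simp only [antiL, Nat.cast_add, Nat.cast_zero, Nat.cast_one]; ring1)
  simp only [h0]
  exact pint [(6875/48)*m*n^2 + (-4625/72)*m*n^3 + (1325/96)*m*n^4 + (-121/72)*m*n^5 + (9/80)*m*n^6 + (-1/280)*m*n^7 + (1/20160)*m*n^8 + (-1375/48)*m^2*n^2 + (175/16)*m^2*n^3 + (-305/144)*m^2*n^4 + (7/30)*m^2*n^5 + (-1/80)*m^2*n^6 + (1/5040)*m^2*n^7 + (275/144)*m^3*n^2 + (-65/108)*m^3*n^3 + (1/9)*m^3*n^4 + (-1/90)*m^3*n^5 + (1/2160)*m^3*n^6, (-6875/48)*n^2 + (4625/72)*n^3 + (-1325/96)*n^4 + (121/72)*n^5 + (-9/80)*n^6 + (1/280)*n^7 + (-1/20160)*n^8 + (-625/8)*m*n^2 + (2125/72)*m*n^3 + (-25/6)*m*n^4 + (5/24)*m*n^5 + (1025/48)*m^2*n^2 + (-20/3)*m^2*n^3 + (5/6)*m^2*n^4 + (-1/24)*m^2*n^5 + (-65/36)*m^3*n^2 + (4/9)*m^3*n^3 + (-1/18)*m^3*n^4 +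 (1/360)*m^3*n^5, (5125/48)*n^2 + (-5825/144)*n^3 + (905/144)*n^4 + (-53/120)*n^5 + (1/80)*n^6 + (-1/5040)*n^7 + (25/16)*m*n^2 + (5/36)*m*n^3 + (-5/16)*m*n^4 + (1/24)*m*n^5 + (-55/12)*m^2*n^2 + (1)*m^2*n^3 + (-1/48)*m^2*n^4 + (-1/240)*m^2*n^5 + (2/3)*m^3*n^2 + (-1/9)*m^3*n^3 + (1/144)*m^3*n^4, (-3575/144)*n^2 + (385/54)*n^3 + (-91/144)*n^4 + (1/90)*n^5 + (-1/2160)*n^6 + (25/4)*m*n^2 + (-55/36)*m*n^3 + (1/12)*m*n^4 + (1/360)*m*n^5 + (-1/3)*m^2*n^2 + (1/12)*m^2*n^3 + (-1/72)*m^2*n^4 + (-1/9)*m^3*n^2 + (1/108)*m^3*n^3, (5/36)*n^2 + (1/12)*n^3 + (-1/144)*n^4 + (-1/720)*n^5 + (-13/16)*m*n^2 + (7/72)*m*n^3 + (1/96)*m*n^4 + (11/48)*m^2*n^2 + (-1/48)*m^2*n^3 + (1/144)*m^3*n^2, (23/48)*n^2 + (-5/72)*n^3 + (-1/288)*n^4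 + (-1/8)*m*n^2 + (1/72)*m*n^3 + (-1/48)*m^2*n^2, (1/144)*n^2 + (-1/432)*n^3 + (1/48)*m*n^2, (-1/144)*n^2]
    (by intro x; simp only [evalL]; ring1) (by simp only [antiL, Nat.cast_add, Nat.cast_zero, Nat.cast_one]; ring1)


/-- `mm t = max 0 (-t)`. -/
def mm (t : ℝ) : ℝ := max 0 (-t)

lemma mm_nonpos {t : ℝ} (h : t ≤ 0) : mm t = -t := by
  unfold mm; exact max_eq_right (by linarith)

lemma mm_nonneg {t : ℝ} (h : 0 ≤ t) : mm t = 0 := by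
  unfold mm; exact max_eq_left (by linarith)

/-- Integral over `[-1,1]` of a function which is polynomial on each side of zero. -/
lemma pint2 {f : ℝ → ℝ} (L1 L2 : List ℝ) {r : ℝ} (h1 : ∀ x ≤ 0, f x = evalL L1 x)
    (h2 : ∀ x, 0 ≤ x → f x = evalL L2 x)
    (hr : (antiL 0 L1 0 - antiL 0 L1 (-1)) + (antiL 0 L2 1 - antiL 0 L2 0) = r) :
    ∫ x in (-1 : ℝ)..1, f x = r := by
  have c1 : Set.EqOn f (evalL L1) (Set.uIcc (-1) 0) := by
    intro x hx
    rw [Set.uIcc_of_le (by norm_num)] at hx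
    exact h1 x hx.2
  have c2 : Set.EqOn f (evalL L2) (Set.uIcc 0 1) := by
    intro x hx
    rw [Set.uIcc_of_le (by norm_num)] at hx
    exact h2 x hx.1
  have i1 : IntervalIntegrable f volume (-1) 0 :=
    ((evalL_continuous L1).continuousOn.congr c1).intervalIntegrable
  have i2 : IntervalIntegrable f volume 0 1 :=
    ((evalL_continuous L2).continuousOn.congr c2).intervalIntegrable
  rw [← intervalIntegral.integral_add_adjacent_intervals i1 i2,
    intervalIntegral.integral_congr c1, intervalIntegral.integral_congr c2, ← hr,
    pint L1 (fun _ => rfl) rfl, pint L2 (fun _ => rfl) rfl]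

/-- Closed interval constructor. -/
abbrev tcl {n : ℕ} (lo hi : ℝ) (rest : ℝ → Tele n) : Tele (n + 1) :=
  .cons (Set.Icc lo hi) lo hi rest

/-- Half-open interval constructor. -/
abbrev tho {n : ℕ} (lo hi : ℝ) (rest : ℝ → Tele n) : Tele (n + 1) :=
  .cons (Set.Ico lo hi) lo hi rest

/-- The inner four variables. -/
def Tyz (r R : ℝ) : Tele 4 :=
  tcl 0 r fun y => tcl 0 (r - y) fun _ => tcl 0 R fun p => tcl 0 (R - p) fun _ => .nil

def TQ : Tele 10 :=
  tcl (-1) 1 fun _ => tcl (-1) 1 fun _ => tcl 0 5 fun a => tcl 0 5 fun b =>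
  tcl 0 (5 - a) fun c => tcl 0 (5 - b) fun d => Tyz (5 - a - c) (5 - b - d)

def TO : Tele 10 :=
  tcl (-1) 1 fun t => tcl (-1) 1 fun _ => tcl 0 (1 + mm t) fun a => tho 0 (1 + mm t - a) fun b =>
  tcl 0 (5 - a) fun c => tcl 0 (5 - b) fun d => Tyz (5 - a - c) (5 - b - d)

def TH : Tele 10 :=
  tcl (-1) 1 fun t => tcl (-1) 1 fun s => tcl 0 (1 + mm t) fun a => tho 0 (1 + mm t - a) fun b =>
  tcl 0 (1 + mm s) fun c => tho 0 (1 + mm s - c) fun d => Tyz (5 - a - c) (5 - b - d)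

/-- The simplices times the square, in shifted and permuted coordinates. -/
def SQ : Set (Fin 10 → ℝ) := {x | (-1 ≤ x 0 ∧ x 0 ≤ 1 ∧ -1 ≤ x 1 ∧ x 1 ≤ 1) ∧
  (0 ≤ x 2 ∧ 0 ≤ x 3 ∧ 0 ≤ x 4 ∧ 0 ≤ x 5 ∧ 0 ≤ x 6 ∧ 0 ≤ x 7 ∧ 0 ≤ x 8 ∧ 0 ≤ x 9) ∧
  x 2 + x 4 + x 6 + x 7 ≤ 5 ∧ x 3 + x 5 + x 8 + x 9 ≤ 5}

def S1 : Set (Fin 10 → ℝ) := {x | x 2 + x 3 < 1 + mm (x 0)}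
def S2 : Set (Fin 10 → ℝ) := {x | x 4 + x 5 < 1 + mm (x 1)}

lemma mm_bounds {t : ℝ} (h : -1 ≤ t) : 0 ≤ mm t ∧ mm t ≤ 1 := by
  unfold mm
  exact ⟨le_max_left _ _, max_le (by norm_num) (by linarith)⟩

lemma TQ_set : TQ.set = SQ := by
  ext x
  change (_ ∧ _ ∧ _ ∧ _ ∧ _ ∧ _ ∧ _ ∧ _ ∧ _ ∧ _ ∧ True) ↔ _
  change ((-1 ≤ x 0 ∧ x 0 ≤ 1) ∧ (-1 ≤ x 1 ∧ x 1 ≤ 1) ∧ (0 ≤ x 2 ∧ x 2 ≤ 5) ∧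
    (0 ≤ x 3 ∧ x 3 ≤ 5) ∧ (0 ≤ x 4 ∧ x 4 ≤ 5 - x 2) ∧ (0 ≤ x 5 ∧ x 5 ≤ 5 - x 3) ∧
    (0 ≤ x 6 ∧ x 6 ≤ 5 - x 2 - x 4) ∧ (0 ≤ x 7 ∧ x 7 ≤ 5 - x 2 - x 4 - x 6) ∧
    (0 ≤ x 8 ∧ x 8 ≤ 5 - x 3 - x 5) ∧ (0 ≤ x 9 ∧ x 9 ≤ 5 - x 3 - x 5 - x 8) ∧ True) ↔ _
  simp only [SQ, Set.mem_ofPred_eq]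
  constructor
  · rintro ⟨⟨_, _⟩, ⟨_, _⟩, ⟨_, _⟩, ⟨_, _⟩, ⟨_, _⟩, ⟨_, _⟩, ⟨_, _⟩, ⟨_, _⟩, ⟨_, _⟩, ⟨_, _⟩, _⟩
    refine ⟨⟨?_, ?_, ?_, ?_⟩, ⟨?_, ?_, ?_, ?_, ?_, ?_, ?_, ?_⟩, ?_, ?_⟩ <;> linarith
  · rintro ⟨⟨_, _, _, _⟩, ⟨_, _, _, _, _, _, _, _⟩, _, _⟩
    refine ⟨⟨?_, ?_⟩, ⟨?_, ?_⟩, ⟨?_, ?_⟩, ⟨?_, ?_⟩, ⟨?_, ?_⟩, ⟨?_, ?_⟩, ⟨?_, ?_⟩, ⟨?_, ?_⟩,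
      ⟨?_, ?_⟩, ⟨?_, ?_⟩, trivial⟩ <;> linarith

lemma TO_set : TO.set = SQ ∩ S1 := by
  ext x
  change ((-1 ≤ x 0 ∧ x 0 ≤ 1) ∧ (-1 ≤ x 1 ∧ x 1 ≤ 1) ∧ (0 ≤ x 2 ∧ x 2 ≤ 1 + mm (x 0)) ∧
    (0 ≤ x 3 ∧ x 3 < 1 + mm (x 0) - x 2) ∧ (0 ≤ x 4 ∧ x 4 ≤ 5 - x 2) ∧ (0 ≤ x 5 ∧ x 5 ≤ 5 - x 3) ∧
    (0 ≤ x 6 ∧ x 6 ≤ 5 - x 2 - x 4) ∧ (0 ≤ x 7 ∧ x 7 ≤ 5 - x 2 - x 4 - x 6) ∧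
    (0 ≤ x 8 ∧ x 8 ≤ 5 - x 3 - x 5) ∧ (0 ≤ x 9 ∧ x 9 ≤ 5 - x 3 - x 5 - x 8) ∧ True) ↔ _
  simp only [SQ, S1, Set.mem_ofPred_eq, Set.mem_inter_iff]
  constructor
  · rintro ⟨⟨_, _⟩, ⟨_, _⟩, ⟨_, _⟩, ⟨_, _⟩, ⟨_, _⟩, ⟨_, _⟩, ⟨_, _⟩, ⟨_, _⟩, ⟨_, _⟩, ⟨_, _⟩, _⟩
    refine ⟨⟨⟨?_, ?_, ?_, ?_⟩, ⟨?_, ?_, ?_, ?_, ?_, ?_, ?_, ?_⟩, ?_, ?_⟩, ?_⟩ <;> linarith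
  · rintro ⟨⟨⟨_, _, _, _⟩, ⟨_, _, _, _, _, _, _, _⟩, _, _⟩, _⟩
    refine ⟨⟨?_, ?_⟩, ⟨?_, ?_⟩, ⟨?_, ?_⟩, ⟨?_, ?_⟩, ⟨?_, ?_⟩, ⟨?_, ?_⟩, ⟨?_, ?_⟩, ⟨?_, ?_⟩,
      ⟨?_, ?_⟩, ⟨?_, ?_⟩, trivial⟩ <;> linarith

lemma TH_set : TH.set = SQ ∩ S1 ∩ S2 := by
  ext x
  change ((-1 ≤ x 0 ∧ x 0 ≤ 1) ∧ (-1 ≤ x 1 ∧ x 1 ≤ 1) ∧ (0 ≤ x 2 ∧ x 2 ≤ 1 + mm (x 0)) ∧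
    (0 ≤ x 3 ∧ x 3 < 1 + mm (x 0) - x 2) ∧ (0 ≤ x 4 ∧ x 4 ≤ 1 + mm (x 1)) ∧
    (0 ≤ x 5 ∧ x 5 < 1 + mm (x 1) - x 4) ∧
    (0 ≤ x 6 ∧ x 6 ≤ 5 - x 2 - x 4) ∧ (0 ≤ x 7 ∧ x 7 ≤ 5 - x 2 - x 4 - x 6) ∧
    (0 ≤ x 8 ∧ x 8 ≤ 5 - x 3 - x 5) ∧ (0 ≤ x 9 ∧ x 9 ≤ 5 - x 3 - x 5 - x 8) ∧ True) ↔ _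
  simp only [SQ, S1, S2, Set.mem_ofPred_eq, Set.mem_inter_iff]
  constructor
  · rintro ⟨⟨_, _⟩, ⟨_, _⟩, ⟨_, _⟩, ⟨_, _⟩, ⟨_, _⟩, ⟨_, _⟩, ⟨_, _⟩, ⟨_, _⟩, ⟨_, _⟩, ⟨_, _⟩, _⟩
    refine ⟨⟨⟨⟨?_, ?_, ?_, ?_⟩, ⟨?_, ?_, ?_, ?_, ?_, ?_, ?_, ?_⟩, ?_, ?_⟩, ?_⟩, ?_⟩ <;> linarith
  · rintro ⟨⟨⟨⟨_, _, _, _⟩, ⟨_, _, _, _, _, _, _, _⟩, _, _⟩, _⟩, _⟩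
    refine ⟨⟨?_, ?_⟩, ⟨?_, ?_⟩, ⟨?_, ?_⟩, ⟨?_, ?_⟩, ⟨?_, ?_⟩, ⟨?_, ?_⟩, ⟨?_, ?_⟩, ⟨?_, ?_⟩,
      ⟨?_, ?_⟩, ⟨?_, ?_⟩, trivial⟩ <;> linarith

lemma Tyz_WF {r R : ℝ} (h : 0 ≤ r) (h' : 0 ≤ R) : (Tyz r R).WF := by
  refine ⟨h, Or.inl rfl, fun y hy => ⟨?_, Or.inl rfl, fun z _ => ⟨h', Or.inl rfl, fun p hp =>
    ⟨?_, Or.inl rfl, fun _ _ => trivial⟩⟩⟩⟩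
  · linarith [hy.2]
  · linarith [hp.2]

lemma TQ_WF : TQ.WF := by
  refine ⟨by norm_num, Or.inl rfl, fun t ht => ⟨by norm_num, Or.inl rfl, fun s hs =>
    ⟨by norm_num, Or.inl rfl, fun a ha => ⟨by norm_num, Or.inl rfl, fun b hb =>
    ⟨by linarith [ha.2], Or.inl rfl, fun c hc => ⟨by linarith [hb.2], Or.inl rfl, fun d hd =>
    Tyz_WF (by linarith [hc.2]) (by linarith [hd.2])⟩⟩⟩⟩⟩⟩

lemma TO_WF : TO.WF := by
  refine ⟨by norm_num, Or.inl rfl, fun t ht => ⟨by norm_num, Or.inl rfl, fun s hs => ?_⟩⟩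
  have h1 := mm_bounds ht.1
  exact ⟨by linarith, Or.inl rfl, fun a ha => ⟨by linarith [ha.2], Or.inr rfl, fun b hb =>
    ⟨by linarith [ha.2], Or.inl rfl, fun c hc => ⟨by linarith [hb.2, ha.1], Or.inl rfl, fun d hd =>
    Tyz_WF (by linarith [hc.2]) (by linarith [hd.2])⟩⟩⟩⟩

lemma TH_WF : TH.WF := by
  refine ⟨by norm_num, Or.inl rfl, fun t ht => ⟨by norm_num, Or.inl rfl, fun s hs => ?_⟩⟩
  have h1 := mm_bounds ht.1
  have h2 := mm_bounds hs.1
  exact ⟨by linarith, Or.inl rfl, fun a ha => ⟨by linarith [ha.2], Or.inr rfl, fun b hb =>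
    ⟨by linarith, Or.inl rfl, fun c hc => ⟨by linarith [hc.2], Or.inr rfl, fun d hd =>
    Tyz_WF (by linarith [hc.2, ha.2]) (by linarith [hd.2, hb.2, ha.1, hc.1])⟩⟩⟩⟩

lemma mm_cont : Continuous mm := by
  unfold mm; fun_prop

lemma S1_meas : MeasurableSet S1 := by
  apply measurableSet_lt
  · fun_prop
  · exact (continuous_const.add (mm_cont.comp (continuous_apply 0))).measurable

lemma S2_meas : MeasurableSet S2 := by
  apply measurableSet_lt
  · fun_prop
  · exact (continuous_const.add (mm_cont.comp (continuous_apply 1))).measurable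

lemma SQ_meas : MeasurableSet SQ := by
  unfold SQ
  simp only [measurableSet_setOfPred]
  measurability

lemma SQ_bdd : ∀ x ∈ SQ, ∀ i, |x i| ≤ 5 := by
  rintro x ⟨⟨_, _, _, _⟩, ⟨_, _, _, _, _, _, _, _⟩, _, _⟩ i
  rw [abs_le]
  fin_cases i <;> constructor <;> simp <;> linarith

set_option maxHeartbeats 2000000 in
set_option maxRecDepth 10000 in
lemma TQ_int0 : TQ.int (fun x => (x 0 - 0) ^ 2) = (390625/432) := by
  change (∫ t in (-1 : ℝ)..1, ∫ s in (-1 : ℝ)..1, ∫ a in (0 : ℝ)..(5), ∫ b in (0 : ℝ)..(5), ∫ c in (0 : ℝ)..(5 - a), ∫ d in (0 : ℝ)..(5 - b), ∫ y in (0 : ℝ)..(5 - a - c), ∫ z in (0 : ℝ)..(5 - a - c - y), ∫ p in (0 : ℝ)..(5 - b - d), ∫ q in (0 : ℝ)..(5 - b - d - p), ((t - 0) ^ 2 : ℝ)) = _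
  simp only [Q_k]
  have h0 : ∀ t : ℝ, (∫ s in (-1 : ℝ)..1, ((390625/576)*(t - 0) ^ 2 : ℝ)) =
      (390625/288)*(t - 0) ^ 2 := by
    intro t
    exact pint [(390625/576)*(t - 0) ^ 2]
      (by intro x; simp only [evalL]; ring1) (by simp only [antiL, Nat.cast_add, Nat.cast_zero, Nat.cast_one]; ring1)
  simp only [h0]
  exact pint2 [0, 0, (390625/288)] [0, 0, (390625/288)]
    (by intro x hx; simp only [evalL, mm_nonpos hx]; ring1)
    (by intro x hx; simp only [evalL, mm_nonneg hx]; ring1)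
    (by simp only [antiL, Nat.cast_add, Nat.cast_zero, Nat.cast_one]; ring1)

set_option maxHeartbeats 2000000 in
set_option maxRecDepth 10000 in
lemma TQ_int2 : TQ.int (fun x => (x 2 - 1) ^ 2) = (390625/216) := by
  change (∫ t in (-1 : ℝ)..1, ∫ s in (-1 : ℝ)..1, ∫ a in (0 : ℝ)..(5), ∫ b in (0 : ℝ)..(5), ∫ c in (0 : ℝ)..(5 - a), ∫ d in (0 : ℝ)..(5 - b), ∫ y in (0 : ℝ)..(5 - a - c), ∫ z in (0 : ℝ)..(5 - a - c - y), ∫ p in (0 : ℝ)..(5 - b - d), ∫ q in (0 : ℝ)..(5 - b - d - p), ((a - 1) ^ 2 : ℝ)) = _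
  simp only [Q_a]
  have h0 : (∫ s in (-1 : ℝ)..1, ((390625/864) : ℝ)) =
      (390625/432) := by
    exact pint [(390625/864)]
      (by intro x; simp only [evalL]; ring1) (by simp only [antiL, Nat.cast_add, Nat.cast_zero, Nat.cast_one]; ring1)
  simp only [h0]
  exact pint2 [(390625/432)] [(390625/432)]
    (by intro x hx; simp only [evalL, mm_nonpos hx]; ring1)
    (by intro x hx; simp only [evalL, mm_nonneg hx]; ring1)
    (by simp only [antiL, Nat.cast_add, Nat.cast_zero, Nat.cast_one]; ring1)

set_option maxHeartbeats 2000000 in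
set_option maxRecDepth 10000 in
lemma TQ_int6 : TQ.int (fun x => (x 6 - 1) ^ 2) = (390625/216) := by
  change (∫ t in (-1 : ℝ)..1, ∫ s in (-1 : ℝ)..1, ∫ a in (0 : ℝ)..(5), ∫ b in (0 : ℝ)..(5), ∫ c in (0 : ℝ)..(5 - a), ∫ d in (0 : ℝ)..(5 - b), ∫ y in (0 : ℝ)..(5 - a - c), ∫ z in (0 : ℝ)..(5 - a - c - y), ∫ p in (0 : ℝ)..(5 - b - d), ∫ q in (0 : ℝ)..(5 - b - d - p), ((y - 1) ^ 2 : ℝ)) = _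
  simp only [Q_y]
  have h0 : (∫ s in (-1 : ℝ)..1, ((390625/864) : ℝ)) =
      (390625/432) := by
    exact pint [(390625/864)]
      (by intro x; simp only [evalL]; ring1) (by simp only [antiL, Nat.cast_add, Nat.cast_zero, Nat.cast_one]; ring1)
  simp only [h0]
  exact pint2 [(390625/432)] [(390625/432)]
    (by intro x hx; simp only [evalL, mm_nonpos hx]; ring1)
    (by intro x hx; simp only [evalL, mm_nonneg hx]; ring1)
    (by simp only [antiL, Nat.cast_add, Nat.cast_zero, Nat.cast_one]; ring1)

set_option maxHeartbeats 2000000 in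
set_option maxRecDepth 10000 in
lemma TO_int0 : TO.int (fun x => (x 0 - 0) ^ 2) = (514737313/1663200) := by
  change (∫ t in (-1 : ℝ)..1, ∫ s in (-1 : ℝ)..1, ∫ a in (0 : ℝ)..(1 + mm t), ∫ b in (0 : ℝ)..(1 + mm t - a), ∫ c in (0 : ℝ)..(5 - a), ∫ d in (0 : ℝ)..(5 - b), ∫ y in (0 : ℝ)..(5 - a - c), ∫ z in (0 : ℝ)..(5 - a - c - y), ∫ p in (0 : ℝ)..(5 - b - d), ∫ q in (0 : ℝ)..(5 - b - d - p), ((t - 0) ^ 2 : ℝ)) = _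
  simp only [O_k]
  have h0 : ∀ t : ℝ, (∫ s in (-1 : ℝ)..1, ((15625/72)*(1 + mm t)^2*(t - 0) ^ 2 + (-3125/36)*(1 + mm t)^3*(t - 0) ^ 2 + (4375/288)*(1 + mm t)^4*(t - 0) ^ 2 + (-25/18)*(1 + mm t)^5*(t - 0) ^ 2 + (5/72)*(1 + mm t)^6*(t - 0) ^ 2 + (-1/504)*(1 + mm t)^7*(t - 0) ^ 2 + (1/40320)*(1 + mm t)^8*(t - 0) ^ 2 : ℝ)) =
      (15625/36)*(1 + mm t)^2*(t - 0) ^ 2 + (-3125/18)*(1 + mm t)^3*(t - 0) ^ 2 + (4375/144)*(1 + mm t)^4*(t - 0) ^ 2 + (-25/9)*(1 + mm t)^5*(t - 0) ^ 2 + (5/36)*(1 + mm t)^6*(t - 0) ^ 2 + (-1/252)*(1 + mm t)^7*(t - 0) ^ 2 + (1/20160)*(1 + mm t)^8*(t - 0) ^ 2 := by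
    intro t
    exact pint [(15625/72)*(1 + mm t)^2*(t - 0) ^ 2 + (-3125/36)*(1 + mm t)^3*(t - 0) ^ 2 + (4375/288)*(1 + mm t)^4*(t - 0) ^ 2 + (-25/18)*(1 + mm t)^5*(t - 0) ^ 2 + (5/72)*(1 + mm t)^6*(t - 0) ^ 2 + (-1/504)*(1 + mm t)^7*(t - 0) ^ 2 + (1/40320)*(1 + mm t)^8*(t - 0) ^ 2]
      (by intro x; simp only [evalL]; ring1) (by simp only [antiL, Nat.cast_add, Nat.cast_zero, Nat.cast_one]; ring1)
  simp only [h0]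
  exact pint2 [0, 0, (645469/2240), (-1148281/2520), (50191/720), (27799/360), (5311/288), (81/40), (9/80), (1/280), (1/20160)] [0, 0, (645469/2240)]
    (by intro x hx; simp only [evalL, mm_nonpos hx]; ring1)
    (by intro x hx; simp only [evalL, mm_nonneg hx]; ring1)
    (by simp only [antiL, Nat.cast_add, Nat.cast_zero, Nat.cast_one]; ring1)

set_option maxHeartbeats 2000000 in
set_option maxRecDepth 10000 in
lemma TO_int1 : TO.int (fun x => (x 1 - 0) ^ 2) = (14722825/54432) := by
  change (∫ t in (-1 : ℝ)..1, ∫ s in (-1 : ℝ)..1, ∫ a in (0 : ℝ)..(1 + mm t), ∫ b in (0 : ℝ)..(1 + mm t - a), ∫ c in (0 : ℝ)..(5 - a), ∫ d in (0 : ℝ)..(5 - b), ∫ y in (0 : ℝ)..(5 - a - c), ∫ z in (0 : ℝ)..(5 - a - c - y), ∫ p in (0 : ℝ)..(5 - b - d), ∫ q in (0 : ℝ)..(5 - b - d - p), ((s - 0) ^ 2 : ℝ)) = _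
  simp only [O_k]
  have h0 : ∀ t : ℝ, (∫ s in (-1 : ℝ)..1, ((15625/72)*(1 + mm t)^2*(s - 0) ^ 2 + (-3125/36)*(1 + mm t)^3*(s - 0) ^ 2 + (4375/288)*(1 + mm t)^4*(s - 0) ^ 2 + (-25/18)*(1 + mm t)^5*(s - 0) ^ 2 + (5/72)*(1 + mm t)^6*(s - 0) ^ 2 + (-1/504)*(1 + mm t)^7*(s - 0) ^ 2 + (1/40320)*(1 + mm t)^8*(s - 0) ^ 2 : ℝ)) =
      (15625/108)*(1 + mm t)^2 + (-3125/54)*(1 + mm t)^3 + (4375/432)*(1 + mm t)^4 + (-25/27)*(1 + mm t)^5 + (5/108)*(1 + mm t)^6 + (-1/756)*(1 + mm t)^7 + (1/60480)*(1 + mm t)^8 := by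
    intro t
    exact pint [0, 0, (15625/72)*(1 + mm t)^2 + (-3125/36)*(1 + mm t)^3 + (4375/288)*(1 + mm t)^4 + (-25/18)*(1 + mm t)^5 + (5/72)*(1 + mm t)^6 + (-1/504)*(1 + mm t)^7 + (1/40320)*(1 + mm t)^8]
      (by intro x; simp only [evalL]; ring1) (by simp only [antiL, Nat.cast_add, Nat.cast_zero, Nat.cast_one]; ring1)
  simp only [h0]
  exact pint2 [(645469/6720), (-1148281/7560), (50191/2160), (27799/1080), (5311/864), (27/40), (3/80), (1/840), (1/60480)] [(645469/6720)]
    (by intro x hx; simp only [evalL, mm_nonpos hx]; ring1)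
    (by intro x hx; simp only [evalL, mm_nonneg hx]; ring1)
    (by simp only [antiL, Nat.cast_add, Nat.cast_zero, Nat.cast_one]; ring1)

set_option maxHeartbeats 2000000 in
set_option maxRecDepth 10000 in
lemma TO_int2 : TO.int (fun x => (x 2 - 1) ^ 2) = (152005837/415800) := by
  change (∫ t in (-1 : ℝ)..1, ∫ s in (-1 : ℝ)..1, ∫ a in (0 : ℝ)..(1 + mm t), ∫ b in (0 : ℝ)..(1 + mm t - a), ∫ c in (0 : ℝ)..(5 - a), ∫ d in (0 : ℝ)..(5 - b), ∫ y in (0 : ℝ)..(5 - a - c), ∫ z in (0 : ℝ)..(5 - a - c - y), ∫ p in (0 : ℝ)..(5 - b - d), ∫ q in (0 : ℝ)..(5 - b - d - p), ((a - 1) ^ 2 : ℝ)) = _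
  simp only [O_a]
  have h0 : ∀ t : ℝ, (∫ s in (-1 : ℝ)..1, ((15625/72)*(1 + mm t)^2 + (-6250/27)*(1 + mm t)^3 + (100625/864)*(1 + mm t)^4 + (-2225/72)*(1 + mm t)^5 + (3935/864)*(1 + mm t)^6 + (-71/189)*(1 + mm t)^7 + (29/1680)*(1 + mm t)^8 + (-1/2160)*(1 + mm t)^9 + (1/181440)*(1 + mm t)^10 : ℝ)) =
      (15625/36)*(1 + mm t)^2 + (-12500/27)*(1 + mm t)^3 + (100625/432)*(1 + mm t)^4 + (-2225/36)*(1 + mm t)^5 + (3935/432)*(1 + mm t)^6 + (-142/189)*(1 + mm t)^7 + (29/840)*(1 + mm t)^8 + (-1/1080)*(1 + mm t)^9 + (1/90720)*(1 + mm t)^10 := by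
    intro t
    exact pint [(15625/72)*(1 + mm t)^2 + (-6250/27)*(1 + mm t)^3 + (100625/864)*(1 + mm t)^4 + (-2225/72)*(1 + mm t)^5 + (3935/864)*(1 + mm t)^6 + (-71/189)*(1 + mm t)^7 + (29/1680)*(1 + mm t)^8 + (-1/2160)*(1 + mm t)^9 + (1/181440)*(1 + mm t)^10]
      (by intro x; simp only [evalL]; ring1) (by simp only [antiL, Nat.cast_add, Nat.cast_zero, Nat.cast_one]; ring1)
  simp only [h0]
  exact pint2 [(13660489/90720), (-1374529/9072), (-179959/3360), (-3541/420), (78923/2160), (190/9), (128/27), (71/140), (269/10080), (37/45360), (1/90720)] [(13660489/90720)]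
    (by intro x hx; simp only [evalL, mm_nonpos hx]; ring1)
    (by intro x hx; simp only [evalL, mm_nonneg hx]; ring1)
    (by simp only [antiL, Nat.cast_add, Nat.cast_zero, Nat.cast_one]; ring1)

set_option maxHeartbeats 2000000 in
set_option maxRecDepth 10000 in
lemma TO_int4 : TO.int (fun x => (x 4 - 1) ^ 2) = (81987161/123200) := by
  change (∫ t in (-1 : ℝ)..1, ∫ s in (-1 : ℝ)..1, ∫ a in (0 : ℝ)..(1 + mm t), ∫ b in (0 : ℝ)..(1 + mm t - a), ∫ c in (0 : ℝ)..(5 - a), ∫ d in (0 : ℝ)..(5 - b), ∫ y in (0 : ℝ)..(5 - a - c), ∫ z in (0 : ℝ)..(5 - a - c - y), ∫ p in (0 : ℝ)..(5 - b - d), ∫ q in (0 : ℝ)..(5 - b - d - p), ((c - 1) ^ 2 : ℝ)) = _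
  simp only [O_c]
  have h0 : ∀ t : ℝ, (∫ s in (-1 : ℝ)..1, ((15625/72)*(1 + mm t)^2 + (-53125/432)*(1 + mm t)^3 + (60625/1728)*(1 + mm t)^4 + (-1775/288)*(1 + mm t)^5 + (1195/1728)*(1 + mm t)^6 + (-73/1512)*(1 + mm t)^7 + (9/4480)*(1 + mm t)^8 + (-1/20160)*(1 + mm t)^9 + (1/1814400)*(1 + mm t)^10 : ℝ)) =
      (15625/36)*(1 + mm t)^2 + (-53125/216)*(1 + mm t)^3 + (60625/864)*(1 + mm t)^4 + (-1775/144)*(1 + mm t)^5 + (1195/864)*(1 + mm t)^6 + (-73/756)*(1 + mm t)^7 + (9/2240)*(1 + mm t)^8 + (-1/10080)*(1 + mm t)^9 + (1/907200)*(1 + mm t)^10 := by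
    intro t
    exact pint [(15625/72)*(1 + mm t)^2 + (-53125/432)*(1 + mm t)^3 + (60625/1728)*(1 + mm t)^4 + (-1775/288)*(1 + mm t)^5 + (1195/1728)*(1 + mm t)^6 + (-73/1512)*(1 + mm t)^7 + (9/4480)*(1 + mm t)^8 + (-1/20160)*(1 + mm t)^9 + (1/1814400)*(1 + mm t)^10]
      (by intro x; simp only [evalL]; ring1) (by simp only [antiL, Nat.cast_add, Nat.cast_zero, Nat.cast_one]; ring1)
  simp only [h0]
  exact pint2 [(14016841/56700), (-8094529/22680), (28563/2240), (161387/2520), (56531/2160), (10517/1800), (1753/2160), (19/280), (1/315), (1/11340), (1/907200)] [(14016841/56700)]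
    (by intro x hx; simp only [evalL, mm_nonpos hx]; ring1)
    (by intro x hx; simp only [evalL, mm_nonneg hx]; ring1)
    (by simp only [antiL, Nat.cast_add, Nat.cast_zero, Nat.cast_one]; ring1)

set_option maxHeartbeats 2000000 in
set_option maxRecDepth 10000 in
lemma TO_int6 : TO.int (fun x => (x 6 - 1) ^ 2) = (81987161/123200) := by
  change (∫ t in (-1 : ℝ)..1, ∫ s in (-1 : ℝ)..1, ∫ a in (0 : ℝ)..(1 + mm t), ∫ b in (0 : ℝ)..(1 + mm t - a), ∫ c in (0 : ℝ)..(5 - a), ∫ d in (0 : ℝ)..(5 - b), ∫ y in (0 : ℝ)..(5 - a - c), ∫ z in (0 : ℝ)..(5 - a - c - y), ∫ p in (0 : ℝ)..(5 - b - d), ∫ q in (0 : ℝ)..(5 - b - d - p), ((y - 1) ^ 2 : ℝ)) = _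
  simp only [O_y]
  have h0 : ∀ t : ℝ, (∫ s in (-1 : ℝ)..1, ((15625/72)*(1 + mm t)^2 + (-53125/432)*(1 + mm t)^3 + (60625/1728)*(1 + mm t)^4 + (-1775/288)*(1 + mm t)^5 + (1195/1728)*(1 + mm t)^6 + (-73/1512)*(1 + mm t)^7 + (9/4480)*(1 + mm t)^8 + (-1/20160)*(1 + mm t)^9 + (1/1814400)*(1 + mm t)^10 : ℝ)) =
      (15625/36)*(1 + mm t)^2 + (-53125/216)*(1 + mm t)^3 + (60625/864)*(1 + mm t)^4 + (-1775/144)*(1 + mm t)^5 + (1195/864)*(1 + mm t)^6 + (-73/756)*(1 + mm t)^7 + (9/2240)*(1 + mm t)^8 + (-1/10080)*(1 + mm t)^9 + (1/907200)*(1 + mm t)^10 := by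
    intro t
    exact pint [(15625/72)*(1 + mm t)^2 + (-53125/432)*(1 + mm t)^3 + (60625/1728)*(1 + mm t)^4 + (-1775/288)*(1 + mm t)^5 + (1195/1728)*(1 + mm t)^6 + (-73/1512)*(1 + mm t)^7 + (9/4480)*(1 + mm t)^8 + (-1/20160)*(1 + mm t)^9 + (1/1814400)*(1 + mm t)^10]
      (by intro x; simp only [evalL]; ring1) (by simp only [antiL, Nat.cast_add, Nat.cast_zero, Nat.cast_one]; ring1)
  simp only [h0]
  exact pint2 [(14016841/56700), (-8094529/22680), (28563/2240), (161387/2520), (56531/2160), (10517/1800), (1753/2160), (19/280), (1/315), (1/11340), (1/907200)] [(14016841/56700)]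
    (by intro x hx; simp only [evalL, mm_nonpos hx]; ring1)
    (by intro x hx; simp only [evalL, mm_nonneg hx]; ring1)
    (by simp only [antiL, Nat.cast_add, Nat.cast_zero, Nat.cast_one]; ring1)

set_option maxHeartbeats 2000000 in
set_option maxRecDepth 10000 in
lemma TH_int0 : TH.int (fun x => (x 0 - 0) ^ 2) = (798210253/10886400) := by
  change (∫ t in (-1 : ℝ)..1, ∫ s in (-1 : ℝ)..1, ∫ a in (0 : ℝ)..(1 + mm t), ∫ b in (0 : ℝ)..(1 + mm t - a), ∫ c in (0 : ℝ)..(1 + mm s), ∫ d in (0 : ℝ)..(1 + mm s - c), ∫ y in (0 : ℝ)..(5 - a - c), ∫ z in (0 : ℝ)..(5 - a - c - y), ∫ p in (0 : ℝ)..(5 - b - d), ∫ q in (0 : ℝ)..(5 - b - d - p), ((t - 0) ^ 2 : ℝ)) = _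
  simp only [H_k]
  have h0 : ∀ t : ℝ, (∫ s in (-1 : ℝ)..1, ((625/16)*(1 + mm t)^2*(1 + mm s)^2*(t - 0) ^ 2 + (-125/12)*(1 + mm t)^2*(1 + mm s)^3*(t - 0) ^ 2 + (25/24)*(1 + mm t)^2*(1 + mm s)^4*(t - 0) ^ 2 + (-1/24)*(1 + mm t)^2*(1 + mm s)^5*(t - 0) ^ 2 + (1/1440)*(1 + mm t)^2*(1 + mm s)^6*(t - 0) ^ 2 + (-125/12)*(1 + mm t)^3*(1 + mm s)^2*(t - 0) ^ 2 + (25/12)*(1 + mm t)^3*(1 + mm s)^3*(t - 0) ^ 2 + (-5/36)*(1 + mm t)^3*(1 + mm s)^4*(t - 0) ^ 2 + (1/360)*(1 + mm t)^3*(1 + mm s)^5*(t - 0) ^ 2 + (25/24)*(1 + mm t)^4*(1 + mm s)^2*(t - 0) ^ 2 + (-5/36)*(1 + mm t)^4*(1 + mm s)^3*(t - 0) ^ 2 + (1/192)*(1 + mm t)^4*(1 + mm s)^4*(t - 0) ^ 2 + (-1/24)*(1 + mm t)^5*(1 + mm s)^2*(t - 0) ^ 2 + (1/360)*(1 + mm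 t)^5*(1 + mm s)^3*(t - 0) ^ 2 + (1/1440)*(1 + mm t)^6*(1 + mm s)^2*(t - 0) ^ 2 : ℝ)) =
      (442327/5040)*(1 + mm t)^2*(t - 0) ^ 2 + (-4643/180)*(1 + mm t)^3*(t - 0) ^ 2 + (57/20)*(1 + mm t)^4*(t - 0) ^ 2 + (-181/1440)*(1 + mm t)^5*(t - 0) ^ 2 + (1/432)*(1 + mm t)^6*(t - 0) ^ 2 := by
    intro t
    exact pint2 [(42691/1440)*(1 + mm t)^2*(t - 0) ^ 2 + (-3049/360)*(1 + mm t)^3*(t - 0) ^ 2 + (523/576)*(1 + mm t)^4*(t - 0) ^ 2 + (-7/180)*(1 + mm t)^5*(t - 0) ^ 2 + (1/1440)*(1 + mm t)^6*(t - 0) ^ 2, (-4067/80)*(1 + mm t)^2*(t - 0) ^ 2 + (121/8)*(1 + mm t)^3*(t - 0) ^ 2 + (-27/16)*(1 + mm t)^4*(t - 0) ^ 2 + (3/40)*(1 + mm t)^5*(t - 0) ^ 2 + (-1/720)*(1 + mm t)^6*(t - 0) ^ 2, (437/32)*(1 + mm t)^2*(t - 0) ^ 2 + (-179/36)*(1 +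 mm t)^3*(t - 0) ^ 2 + (21/32)*(1 + mm t)^4*(t - 0) ^ 2 + (-1/30)*(1 + mm t)^5*(t - 0) ^ 2 + (1/1440)*(1 + mm t)^6*(t - 0) ^ 2, (479/72)*(1 + mm t)^2*(t - 0) ^ 2 + (-14/9)*(1 + mm t)^3*(t - 0) ^ 2 + (17/144)*(1 + mm t)^4*(t - 0) ^ 2 + (-1/360)*(1 + mm t)^5*(t - 0) ^ 2, (27/32)*(1 + mm t)^2*(t - 0) ^ 2 + (-1/8)*(1 + mm t)^3*(t - 0) ^ 2 + (1/192)*(1 + mm t)^4*(t - 0) ^ 2, (3/80)*(1 + mm t)^2*(t - 0) ^ 2 + (-1/360)*(1 + mm t)^3*(t - 0) ^ 2, (1/1440)*(1 + mm t)^2*(t - 0) ^ 2] [(42691/1440)*(1 + mm t)^2*(t - 0) ^ 2 + (-3049/360)*(1 + mm t)^3*(t - 0) ^ 2 + (523/576)*(1 + mm t)^4*(t - 0) ^ 2 + (-7/180)*(1 + mm t)^5*(t - 0) ^ 2 + (1/1440)*(1 + mm t)^6*(t - 0) ^ 2]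
      (by intro x hx; simp only [evalL, mm_nonpos hx]; ring1)
      (by intro x hx; simp only [evalL, mm_nonneg hx]; ring1)
      (by simp only [antiL, Nat.cast_add, Nat.cast_zero, Nat.cast_one]; ring1)
  simp only [h0]
  exact pint2 [0, 0, (1956391/30240), (-1098001/10080), (44113/1680), (33707/2160), (361/160), (161/1440), (1/432)] [0, 0, (1956391/30240)]
    (by intro x hx; simp only [evalL, mm_nonpos hx]; ring1)
    (by intro x hx; simp only [evalL, mm_nonneg hx]; ring1)
    (by simp only [antiL, Nat.cast_add, Nat.cast_zero, Nat.cast_one]; ring1)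

set_option maxHeartbeats 2000000 in
set_option maxRecDepth 10000 in
lemma TH_int2 : TH.int (fun x => (x 2 - 1) ^ 2) = (86250301/1036800) := by
  change (∫ t in (-1 : ℝ)..1, ∫ s in (-1 : ℝ)..1, ∫ a in (0 : ℝ)..(1 + mm t), ∫ b in (0 : ℝ)..(1 + mm t - a), ∫ c in (0 : ℝ)..(1 + mm s), ∫ d in (0 : ℝ)..(1 + mm s - c), ∫ y in (0 : ℝ)..(5 - a - c), ∫ z in (0 : ℝ)..(5 - a - c - y), ∫ p in (0 : ℝ)..(5 - b - d), ∫ q in (0 : ℝ)..(5 - b - d - p), ((a - 1) ^ 2 : ℝ)) = _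
  simp only [H_a]
  have h0 : ∀ t : ℝ, (∫ s in (-1 : ℝ)..1, ((625/16)*(1 + mm t)^2*(1 + mm s)^2 + (-125/12)*(1 + mm t)^2*(1 + mm s)^3 + (25/24)*(1 + mm t)^2*(1 + mm s)^4 + (-1/24)*(1 + mm t)^2*(1 + mm s)^5 + (1/1440)*(1 + mm t)^2*(1 + mm s)^6 + (-875/24)*(1 + mm t)^3*(1 + mm s)^2 + (325/36)*(1 + mm t)^3*(1 + mm s)^3 + (-5/6)*(1 + mm t)^3*(1 + mm s)^4 + (11/360)*(1 + mm t)^3*(1 + mm s)^5 + (-1/2160)*(1 + mm t)^3*(1 + mm s)^6 + (1475/96)*(1 + mm t)^4*(1 + mm s)^2 + (-55/16)*(1 + mm t)^4*(1 + mm s)^3 + (163/576)*(1 + mm t)^4*(1 + mm s)^4 + (-13/1440)*(1 + mm t)^4*(1 + mm s)^5 + (1/8640)*(1 + mm t)^4*(1 + mm s)^6 + (-71/24)*(1 + mm t)^5*(1 + mm s)^2 + (191/360)*(1 + mm t)^5*(1 + mm s)^3 + (-23/720)*(1 + mm t)^5*(1 + mm s)^4 + (1/1800)*(1 + mm t)^5*(1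 + mm s)^5 + (47/180)*(1 + mm t)^6*(1 + mm s)^2 + (-7/216)*(1 + mm t)^6*(1 + mm s)^3 + (1/864)*(1 + mm t)^6*(1 + mm s)^4 + (-1/105)*(1 + mm t)^7*(1 + mm s)^2 + (1/1680)*(1 + mm t)^7*(1 + mm s)^3 + (1/6720)*(1 + mm t)^8*(1 + mm s)^2 : ℝ)) =
      (442327/5040)*(1 + mm t)^2 + (-637333/7560)*(1 + mm t)^3 + (1113529/30240)*(1 + mm t)^4 + (-3631/480)*(1 + mm t)^5 + (3131/4320)*(1 + mm t)^6 + (-583/20160)*(1 + mm t)^7 + (1/2016)*(1 + mm t)^8 := by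
    intro t
    exact pint2 [(42691/1440)*(1 + mm t)^2 + (-12197/432)*(1 + mm t)^3 + (52709/4320)*(1 + mm t)^4 + (-2951/1200)*(1 + mm t)^5 + (331/1440)*(1 + mm t)^6 + (-1/112)*(1 + mm t)^7 + (1/6720)*(1 + mm t)^8, (-4067/80)*(1 + mm t)^2 + (2941/60)*(1 + mm t)^3 + (-5161/240)*(1 + mm t)^4 + (89/20)*(1 + mm t)^5 + (-58/135)*(1 + mm t)^6 + (29/1680)*(1 + mm t)^7 + (-1/3360)*(1 + mm t)^8, (437/32)*(1 + mm t)^2 + (-2027/144)*(1 + mm t)^3 + (1279/192)*(1 + mm t)^4 + (-559/360)*(1 + mm t)^5 + (41/240)*(1 + mm t)^6 + (-13/1680)*(1 + mm t)^7 + (1/6720)*(1 + mm t)^8, (479/72)*(1 + mm t)^2 + (-647/108)*(1 + mm t)^3 + (517/216)*(1 + mm t)^4 + (-49/120)*(1 + mm t)^5 + (1/36)*(1 + mm t)^6 + (-1/1680)*(1 + mm t)^7, (27/32)*(1 + mm t)^2 + (-11/16)*(1 + mm t)^3 + (23/96)*(1 + mm t)^4 + (-7/240)*(1 + mm t)^5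 + (1/864)*(1 + mm t)^6, (3/80)*(1 + mm t)^2 + (-1/36)*(1 + mm t)^3 + (1/120)*(1 + mm t)^4 + (-1/1800)*(1 + mm t)^5, (1/1440)*(1 + mm t)^2 + (-1/2160)*(1 + mm t)^3 + (1/8640)*(1 + mm t)^4] [(42691/1440)*(1 + mm t)^2 + (-12197/432)*(1 + mm t)^3 + (52709/4320)*(1 + mm t)^4 + (-2951/1200)*(1 + mm t)^5 + (331/1440)*(1 + mm t)^6 + (-1/112)*(1 + mm t)^7 + (1/6720)*(1 + mm t)^8]
      (by intro x hx; simp only [evalL, mm_nonpos hx]; ring1)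
      (by intro x hx; simp only [evalL, mm_nonneg hx]; ring1)
      (by simp only [antiL, Nat.cast_add, Nat.cast_zero, Nat.cast_one]; ring1)
  simp only [h0]
  exact pint2 [(2020927/60480), (-2191559/60480), (-9193/960), (-7379/8640), (537923/60480), (10931/2880), (4633/8640), (503/20160), (1/2016)] [(2020927/60480)]
    (by intro x hx; simp only [evalL, mm_nonpos hx]; ring1)
    (by intro x hx; simp only [evalL, mm_nonneg hx]; ring1)
    (by simp only [antiL, Nat.cast_add, Nat.cast_zero, Nat.cast_one]; ring1)

set_option maxHeartbeats 2000000 in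
set_option maxRecDepth 10000 in
lemma TH_int6 : TH.int (fun x => (x 6 - 1) ^ 2) = (2333992001/10886400) := by
  change (∫ t in (-1 : ℝ)..1, ∫ s in (-1 : ℝ)..1, ∫ a in (0 : ℝ)..(1 + mm t), ∫ b in (0 : ℝ)..(1 + mm t - a), ∫ c in (0 : ℝ)..(1 + mm s), ∫ d in (0 : ℝ)..(1 + mm s - c), ∫ y in (0 : ℝ)..(5 - a - c), ∫ z in (0 : ℝ)..(5 - a - c - y), ∫ p in (0 : ℝ)..(5 - b - d), ∫ q in (0 : ℝ)..(5 - b - d - p), ((y - 1) ^ 2 : ℝ)) = _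
  simp only [H_y]
  have h0 : ∀ t : ℝ, (∫ s in (-1 : ℝ)..1, ((6875/96)*(1 + mm t)^2*(1 + mm s)^2 + (-4625/144)*(1 + mm t)^2*(1 + mm s)^3 + (1325/192)*(1 + mm t)^2*(1 + mm s)^4 + (-121/144)*(1 + mm t)^2*(1 + mm s)^5 + (9/160)*(1 + mm t)^2*(1 + mm s)^6 + (-1/560)*(1 + mm t)^2*(1 + mm s)^7 + (1/40320)*(1 + mm t)^2*(1 + mm s)^8 + (-4625/144)*(1 + mm t)^3*(1 + mm s)^2 + (5275/432)*(1 + mm t)^3*(1 + mm s)^3 + (-455/216)*(1 + mm t)^3*(1 + mm s)^4 + (137/720)*(1 + mm t)^3*(1 + mm s)^5 + (-1/120)*(1 + mm t)^3*(1 + mm s)^6 + (1/7560)*(1 + mm t)^3*(1 + mm s)^7 + (1325/192)*(1 + mm t)^4*(1 + mm s)^2 + (-455/216)*(1 + mm t)^4*(1 + mm s)^3 + (17/64)*(1 + mm t)^4*(1 + mm s)^4 + (-11/720)*(1 + mm t)^4*(1 + mm s)^5 + (1/2880)*(1 + mm t)^4*(1 + mm s)^6 + (-121/144)*(1 + mm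 t)^5*(1 + mm s)^2 + (137/720)*(1 + mm t)^5*(1 + mm s)^3 + (-11/720)*(1 + mm t)^5*(1 + mm s)^4 + (1/2400)*(1 + mm t)^5*(1 + mm s)^5 + (9/160)*(1 + mm t)^6*(1 + mm s)^2 + (-1/120)*(1 + mm t)^6*(1 + mm s)^3 + (1/2880)*(1 + mm t)^6*(1 + mm s)^4 + (-1/560)*(1 + mm t)^7*(1 + mm s)^2 + (1/7560)*(1 + mm t)^7*(1 + mm s)^3 + (1/40320)*(1 + mm t)^8*(1 + mm s)^2 : ℝ)) =
      (46157731/362880)*(1 + mm t)^2 + (-156727/2520)*(1 + mm t)^3 + (111443/7560)*(1 + mm t)^4 + (-865/432)*(1 + mm t)^5 + (361/2400)*(1 + mm t)^6 + (-23/4320)*(1 + mm t)^7 + (1/12096)*(1 + mm t)^8 := by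
    intro t
    exact pint2 [(1839067/40320)*(1 + mm t)^2 + (-330097/15120)*(1 + mm t)^3 + (43591/8640)*(1 + mm t)^4 + (-4787/7200)*(1 + mm t)^5 + (139/2880)*(1 + mm t)^6 + (-5/3024)*(1 + mm t)^7 + (1/40320)*(1 + mm t)^8, (-118613/1680)*(1 + mm t)^2 + (6323/180)*(1 + mm t)^3 + (-2033/240)*(1 + mm t)^4 + (187/160)*(1 + mm t)^5 + (-4/45)*(1 + mm t)^6 + (1/315)*(1 + mm t)^7 + (-1/20160)*(1 + mm t)^8, (2177/240)*(1 + mm t)^2 + (-571/90)*(1 + mm t)^3 + (73/36)*(1 + mm t)^4 + (-257/720)*(1 + mm t)^5 + (1/30)*(1 + mm t)^6 + (-1/720)*(1 + mm t)^7 + (1/40320)*(1 + mm t)^8, (4267/360)*(1 + mm t)^2 + (-2387/432)*(1 + mm t)^3 + (257/216)*(1 + mm t)^4 + (-2/15)*(1 + mm t)^5 + (1/144)*(1 + mm t)^6 + (-1/7560)*(1 + mm t)^7, (1003/288)*(1 + mm t)^2 + (-551/432)*(1 + mm t)^3 + (7/36)*(1 + mm t)^4 + (-19/1440)*(1 + mm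 t)^5 + (1/2880)*(1 + mm t)^6, (97/180)*(1 + mm t)^2 + (-103/720)*(1 + mm t)^3 + (19/1440)*(1 + mm t)^4 + (-1/2400)*(1 + mm t)^5, (2/45)*(1 + mm t)^2 + (-1/135)*(1 + mm t)^3 + (1/2880)*(1 + mm t)^4, (1/630)*(1 + mm t)^2 + (-1/7560)*(1 + mm t)^3, (1/40320)*(1 + mm t)^2] [(1839067/40320)*(1 + mm t)^2 + (-330097/15120)*(1 + mm t)^3 + (43591/8640)*(1 + mm t)^4 + (-4787/7200)*(1 + mm t)^5 + (139/2880)*(1 + mm t)^6 + (-5/3024)*(1 + mm t)^7 + (1/40320)*(1 + mm t)^8]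
      (by intro x hx; simp only [evalL, mm_nonpos hx]; ring1)
      (by intro x hx; simp only [evalL, mm_nonneg hx]; ring1)
      (by simp only [antiL, Nat.cast_add, Nat.cast_zero, Nat.cast_one]; ring1)
  simp only [h0]
  exact pint2 [(141321941/1814400), (-106719173/907200), (4060267/362880), (88237/4320), (68597/10080), (26071/21600), (1247/10800), (47/10080), (1/12096)] [(141321941/1814400)]
    (by intro x hx; simp only [evalL, mm_nonpos hx]; ring1)
    (by intro x hx; simp only [evalL, mm_nonneg hx]; ring1)
    (by simp only [antiL, Nat.cast_add, Nat.cast_zero, Nat.cast_one]; ring1)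


/-- The shift vector: the first two coordinates are not shifted. -/
def sh : Fin 10 → ℝ := ![0, 0, 1, 1, 1, 1, 1, 1, 1, 1]

/-- Second moments over a set. -/
def J (S : Set (Fin 10 → ℝ)) (i : Fin 10) : ℝ := ∫ x in S, (x i - sh i) ^ 2

/-- The moment polytope in the shifted and permuted coordinates. -/
def PP : Set (Fin 10 → ℝ) := (SQ \ S1) \ S2

lemma w_cont (i : Fin 10) : Continuous (fun x : Fin 10 → ℝ => (x i - sh i) ^ 2) := by
  fun_prop

lemma J_TQ (i : Fin 10) : J SQ i = TQ.int (fun x => (x i - sh i) ^ 2) := by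
  unfold J
  rw [← TQ_set]
  exact Tele.integral_eq TQ _ TQ_WF (TQ_set ▸ SQ_meas)
    ⟨5, fun x hx => SQ_bdd x (TQ_set ▸ hx)⟩ (w_cont i)

lemma J_TO (i : Fin 10) : J (SQ ∩ S1) i = TO.int (fun x => (x i - sh i) ^ 2) := by
  unfold J
  rw [← TO_set]
  refine Tele.integral_eq TO _ TO_WF (TO_set ▸ SQ_meas.inter S1_meas)
    ⟨5, fun x hx => SQ_bdd x ?_⟩ (w_cont i)
  rw [TO_set] at hx
  exact hx.1

lemma J_TH (i : Fin 10) : J (SQ ∩ S1 ∩ S2) i = TH.int (fun x => (x i - sh i) ^ 2) := by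
  unfold J
  rw [← TH_set]
  refine Tele.integral_eq TH _ TH_WF (TH_set ▸ (SQ_meas.inter S1_meas).inter S2_meas)
    ⟨5, fun x hx => SQ_bdd x ?_⟩ (w_cont i)
  rw [TH_set] at hx
  exact hx.1.1

lemma J_PP (i : Fin 10) :
    J PP i = J SQ i - J (SQ ∩ S1) i - J (SQ ∩ S2) i + J (SQ ∩ S1 ∩ S2) i := by
  have hi : IntegrableOn (fun x : Fin 10 → ℝ => (x i - sh i) ^ 2) SQ :=
    bdd_integrableOn 5 SQ_bdd (w_cont i)
  have e1 := integral_inter_add_sdiff S1_meas hi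
  have e2 := integral_inter_add_sdiff S2_meas (hi.mono_set (Set.sdiff_subset (t := S1)))
  have e3 := integral_inter_add_sdiff S1_meas (hi.mono_set (Set.inter_subset_left (t := S2)))
  have s1 : SQ ∩ S2 ∩ S1 = SQ ∩ S1 ∩ S2 := Set.inter_right_comm _ _ _
  have s2 : (SQ ∩ S2) \ S1 = (SQ \ S1) ∩ S2 := by
    ext x
    simp only [Set.mem_inter_iff, Set.mem_sdiff]
    tauto
  rw [s1, s2] at e3
  unfold J PP
  linarith

/-- The coordinate permutation as a measurable equivalence. -/
def pe (σ : Equiv.Perm (Fin 10)) : (Fin 10 → ℝ) ≃ᵐ (Fin 10 → ℝ) :=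
  MeasurableEquiv.piCongrLeft (fun _ => ℝ) σ.symm

lemma pe_apply (σ : Equiv.Perm (Fin 10)) (x : Fin 10 → ℝ) (j : Fin 10) :
    pe σ x j = x (σ j) := by
  have h := MeasurableEquiv.piCongrLeft_apply_apply σ.symm (β := fun _ => ℝ) x (σ j)
  simpa [pe] using h

lemma pe_mp (σ : Equiv.Perm (Fin 10)) : MeasurePreserving (pe σ) volume volume :=
  volume_measurePreserving_piCongrLeft (fun _ => ℝ) σ.symm

lemma perm_J (σ : Equiv.Perm (Fin 10)) (S S' : Set (Fin 10 → ℝ)) (i j : Fin 10)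
    (hj : σ i = j) (hs : sh i = sh j)
    (h : ∀ x, (fun k => x (σ k)) ∈ S' ↔ x ∈ S) : J S j = J S' i := by
  unfold J
  rw [← (pe_mp σ).setIntegral_preimage_emb (pe σ).measurableEmbedding
    (fun x => (x i - sh i) ^ 2) S']
  have hset : (pe σ) ⁻¹' S' = S := by
    ext x
    rw [← h x, Set.mem_preimage]
    have : pe σ x = fun k => x (σ k) := funext (pe_apply σ x)
    rw [this]
  rw [hset]
  simp only [pe_apply, hj, hs]

/-- Swap the two simplices. -/
def pτ : Equiv.Perm (Fin 10) where
  toFun := ![0, 1, 3, 2, 5, 4, 8, 9, 6, 7]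
  invFun := ![0, 1, 3, 2, 5, 4, 8, 9, 6, 7]
  left_inv := by decide
  right_inv := by decide

/-- Swap the two linking constraints. -/
def pρ : Equiv.Perm (Fin 10) where
  toFun := ![1, 0, 4, 5, 2, 3, 6, 7, 8, 9]
  invFun := ![1, 0, 4, 5, 2, 3, 6, 7, 8, 9]
  left_inv := by decide
  right_inv := by decide

/-- Swap two free coordinates of the first simplex. -/
def pκ : Equiv.Perm (Fin 10) where
  toFun := ![0, 1, 2, 3, 4, 5, 7, 6, 8, 9]
  invFun := ![0, 1, 2, 3, 4, 5, 7, 6, 8, 9]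
  left_inv := by decide
  right_inv := by decide

lemma SQ_iff (x : Fin 10 → ℝ) : x ∈ SQ ↔ (-1 ≤ x 0 ∧ x 0 ≤ 1 ∧ -1 ≤ x 1 ∧ x 1 ≤ 1) ∧
  (0 ≤ x 2 ∧ 0 ≤ x 3 ∧ 0 ≤ x 4 ∧ 0 ≤ x 5 ∧ 0 ≤ x 6 ∧ 0 ≤ x 7 ∧ 0 ≤ x 8 ∧ 0 ≤ x 9) ∧
  x 2 + x 4 + x 6 + x 7 ≤ 5 ∧ x 3 + x 5 + x 8 + x 9 ≤ 5 := Iff.rfl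

lemma SQ_τ (x : Fin 10 → ℝ) : (fun k => x (pτ k)) ∈ SQ ↔ x ∈ SQ := by
  rw [SQ_iff x]
  change ((-1 ≤ x 0 ∧ x 0 ≤ 1 ∧ -1 ≤ x 1 ∧ x 1 ≤ 1) ∧
    (0 ≤ x 3 ∧ 0 ≤ x 2 ∧ 0 ≤ x 5 ∧ 0 ≤ x 4 ∧ 0 ≤ x 8 ∧ 0 ≤ x 9 ∧ 0 ≤ x 6 ∧ 0 ≤ x 7) ∧
    x 3 + x 5 + x 8 + x 9 ≤ 5 ∧ x 2 + x 4 + x 6 + x 7 ≤ 5) ↔ _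
  tauto

lemma SQ_ρ (x : Fin 10 → ℝ) : (fun k => x (pρ k)) ∈ SQ ↔ x ∈ SQ := by
  rw [SQ_iff x]
  change ((-1 ≤ x 1 ∧ x 1 ≤ 1 ∧ -1 ≤ x 0 ∧ x 0 ≤ 1) ∧
    (0 ≤ x 4 ∧ 0 ≤ x 5 ∧ 0 ≤ x 2 ∧ 0 ≤ x 3 ∧ 0 ≤ x 6 ∧ 0 ≤ x 7 ∧ 0 ≤ x 8 ∧ 0 ≤ x 9) ∧
    x 4 + x 2 + x 6 + x 7 ≤ 5 ∧ x 5 + x 3 + x 8 + x 9 ≤ 5) ↔ _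
  rw [add_comm (x 4), add_comm (x 5)]
  tauto

lemma SQ_κ (x : Fin 10 → ℝ) : (fun k => x (pκ k)) ∈ SQ ↔ x ∈ SQ := by
  rw [SQ_iff x]
  change ((-1 ≤ x 0 ∧ x 0 ≤ 1 ∧ -1 ≤ x 1 ∧ x 1 ≤ 1) ∧
    (0 ≤ x 2 ∧ 0 ≤ x 3 ∧ 0 ≤ x 4 ∧ 0 ≤ x 5 ∧ 0 ≤ x 7 ∧ 0 ≤ x 6 ∧ 0 ≤ x 8 ∧ 0 ≤ x 9) ∧
    x 2 + x 4 + x 7 + x 6 ≤ 5 ∧ x 3 + x 5 + x 8 + x 9 ≤ 5) ↔ _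
  rw [add_right_comm (x 2 + x 4)]
  tauto

lemma S1_ρ (x : Fin 10 → ℝ) : (fun k => x (pρ k)) ∈ S1 ↔ x ∈ S2 := Iff.rfl

lemma S2_ρ (x : Fin 10 → ℝ) : (fun k => x (pρ k)) ∈ S2 ↔ x ∈ S1 := Iff.rfl

lemma S1_τ (x : Fin 10 → ℝ) : (fun k => x (pτ k)) ∈ S1 ↔ x ∈ S1 := by
  change x 3 + x 2 < 1 + mm (x 0) ↔ x 2 + x 3 < 1 + mm (x 0)
  rw [add_comm]

lemma S2_τ (x : Fin 10 → ℝ) : (fun k => x (pτ k)) ∈ S2 ↔ x ∈ S2 := by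
  change x 5 + x 4 < 1 + mm (x 1) ↔ x 4 + x 5 < 1 + mm (x 1)
  rw [add_comm]

lemma PP_τ (x : Fin 10 → ℝ) : (fun k => x (pτ k)) ∈ PP ↔ x ∈ PP := by
  simp only [PP, Set.mem_sdiff, SQ_τ, S1_τ, S2_τ]

lemma PP_ρ (x : Fin 10 → ℝ) : (fun k => x (pρ k)) ∈ PP ↔ x ∈ PP := by
  simp only [PP, Set.mem_sdiff, SQ_ρ, S1_ρ, S2_ρ]
  tauto

lemma PP_κ (x : Fin 10 → ℝ) : (fun k => x (pκ k)) ∈ PP ↔ x ∈ PP := by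
  simp only [PP, Set.mem_sdiff, SQ_κ]
  exact Iff.rfl

lemma J_S2 (i j : Fin 10) (hj : pρ i = j) (hs : sh i = sh j) :
    J (SQ ∩ S2) j = J (SQ ∩ S1) i :=
  perm_J pρ _ _ i j hj hs (fun x => by simp only [Set.mem_inter_iff, SQ_ρ, S1_ρ])

lemma JPP0 : J PP 0 = 47610261247 / 119750400 := by
  have h1 : J SQ 0 = _ := (J_TQ 0).trans TQ_int0
  have h2 : J (SQ ∩ S1) 0 = _ := (J_TO 0).trans TO_int0
  have h3 : J (SQ ∩ S1) 1 = _ := (J_TO 1).trans TO_int1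
  have h4 : J (SQ ∩ S1 ∩ S2) 0 = _ := (J_TH 0).trans TH_int0
  rw [J_PP, J_S2 1 0 rfl rfl, h1, h2, h3, h4]
  norm_num

lemma JPP2 : J PP 2 = 178450577 / 207360 := by
  have h1 : J SQ 2 = _ := (J_TQ 2).trans TQ_int2
  have h2 : J (SQ ∩ S1) 2 = _ := (J_TO 2).trans TO_int2
  have h3 : J (SQ ∩ S1) 4 = _ := (J_TO 4).trans TO_int4
  have h4 : J (SQ ∩ S1 ∩ S2) 2 = _ := (J_TH 2).trans TH_int2
  rw [J_PP, J_S2 4 2 rfl rfl, h1, h2, h3, h4]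
  norm_num

lemma JPP6 : J PP 6 = 11836195861 / 17107200 := by
  have h1 : J SQ 6 = _ := (J_TQ 6).trans TQ_int6
  have h2 : J (SQ ∩ S1) 6 = _ := (J_TO 6).trans TO_int6
  have h4 : J (SQ ∩ S1 ∩ S2) 6 = _ := (J_TH 6).trans TH_int6
  rw [J_PP, J_S2 6 6 rfl rfl, h1, h2, h4]
  norm_num

/-- The reordering of coordinates. -/
def pπ : Equiv.Perm (Fin 10) where
  toFun := ![8, 9, 0, 4, 1, 5, 2, 3, 6, 7]
  invFun := ![2, 4, 6, 7, 3, 5, 8, 9, 0, 1]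
  left_inv := by decide
  right_inv := by decide

/-- The change of coordinates: reorder and shift. -/
def chg : EuclideanSpace ℝ (Fin 10) ≃ᵐ (Fin 10 → ℝ) :=
  ((MeasurableEquiv.toLp 2 (Fin 10 → ℝ)).symm.trans (pe pπ)).trans (MeasurableEquiv.addRight sh)

lemma chg_mp : MeasurePreserving chg volume volume :=
  (measurePreserving_add_right volume sh).comp
    ((pe_mp pπ).comp (EuclideanSpace.volume_preserving_symm_measurableEquiv_toLp (Fin 10)))

lemma chg_apply (x : EuclideanSpace ℝ (Fin 10)) (j : Fin 10) :
    chg x j = x (pπ j) + sh j := by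
  change pe pπ x.ofLp j + sh j = _
  rw [pe_apply]

lemma chg_P : chg ⁻¹' PP = P := by
  ext x
  have hc : chg x = fun j => x (pπ j) + sh j := funext (chg_apply x)
  rw [Set.mem_preimage, hc]
  have hL : (fun j => x (pπ j) + sh j) ∈ PP ↔
      (((-1 ≤ x 8 + 0 ∧ x 8 + 0 ≤ 1 ∧ -1 ≤ x 9 + 0 ∧ x 9 + 0 ≤ 1) ∧
      (0 ≤ x 0 + 1 ∧ 0 ≤ x 4 + 1 ∧ 0 ≤ x 1 + 1 ∧ 0 ≤ x 5 + 1 ∧ 0 ≤ x 2 + 1 ∧ 0 ≤ x 3 + 1 ∧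
        0 ≤ x 6 + 1 ∧ 0 ≤ x 7 + 1) ∧
      (x 0 + 1) + (x 1 + 1) + (x 2 + 1) + (x 3 + 1) ≤ 5 ∧
      (x 4 + 1) + (x 5 + 1) + (x 6 + 1) + (x 7 + 1) ≤ 5) ∧
      ¬ ((x 0 + 1) + (x 4 + 1) < 1 + max 0 (-(x 8 + 0)))) ∧
      ¬ ((x 1 + 1) + (x 5 + 1) < 1 + max 0 (-(x 9 + 0))) := Iff.rfl
  rw [hL, P]
  simp only [V18, Set.mem_ofPred_eq, Set.mem_insert_iff, Set.mem_singleton_iff, forall_eq_or_imp,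
    forall_eq, ee, inner_add_right, inner_neg_right, EuclideanSpace.inner_single_right, one_mul,
    conj_trivial, not_lt, ge_iff_le]
  rw [← max_add_add_left, ← max_add_add_left, max_le_iff, max_le_iff]
  constructor
  · rintro ⟨⟨⟨⟨_, _, _, _⟩, ⟨_, _, _, _, _, _, _, _⟩, _, _⟩, _, _⟩, _, _⟩
    refine ⟨?_, ?_, ?_, ?_, ?_, ?_, ?_, ?_, ?_, ?_, ?_, ?_, ?_, ?_, ?_, ?_, ?_, ?_⟩ <;> linarith
  · rintro ⟨_, _, _, _, _, _, _, _, _, _, _, _, _, _, _, _, _, _⟩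
    refine ⟨⟨⟨⟨?_, ?_, ?_, ?_⟩, ⟨?_, ?_, ?_, ?_, ?_, ?_, ?_, ?_⟩, ?_, ?_⟩, ?_, ?_⟩, ?_, ?_⟩ <;>
      linarith

lemma int_P (i j : Fin 10) (h : pπ j = i) : (∫ x in P, (x i) ^ 2) = J PP j := by
  unfold J
  rw [← chg_mp.setIntegral_preimage_emb chg.measurableEmbedding, chg_P]
  simp only [chg_apply, h, add_sub_cancel_right]


theorem stmt11 :
    (∀ i : Fin 10, (i = 0 ∨ i = 1 ∨ i = 4 ∨ i = 5) →
      (∫ x in P, (x i) ^ 2) = 178450577 / 207360) ∧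
    (∀ i : Fin 10, (i = 2 ∨ i = 3 ∨ i = 6 ∨ i = 7) →
      (∫ x in P, (x i) ^ 2) = 11836195861 / 17107200) ∧
    (∀ i : Fin 10, (i = 8 ∨ i = 9) →
      (∫ x in P, (x i) ^ 2) = 47610261247 / 119750400) := by
  have h4 : J PP 4 = J PP 2 := perm_J pρ _ _ 2 4 rfl rfl PP_ρ
  have h3 : J PP 3 = J PP 2 := perm_J pτ _ _ 2 3 rfl rfl PP_τ
  have h5 : J PP 5 = J PP 4 := perm_J pτ _ _ 4 5 rfl rfl PP_τ
  have h7 : J PP 7 = J PP 6 := perm_J pκ _ _ 6 7 rfl rfl PP_κ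
  have h8 : J PP 8 = J PP 6 := perm_J pτ _ _ 6 8 rfl rfl PP_τ
  have h9 : J PP 9 = J PP 7 := perm_J pτ _ _ 7 9 rfl rfl PP_τ
  have h1 : J PP 1 = J PP 0 := perm_J pρ _ _ 0 1 rfl rfl PP_ρ
  refine ⟨?_, ?_, ?_⟩
  · rintro i (rfl | rfl | rfl | rfl)
    · rw [int_P 0 2 rfl, JPP2]
    · rw [int_P 1 4 rfl, h4, JPP2]
    · rw [int_P 4 3 rfl, h3, JPP2]
    · rw [int_P 5 5 rfl, h5, h4, JPP2]
  · rintro i (rfl | rfl | rfl | rfl)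
    · rw [int_P 2 6 rfl, JPP6]
    · rw [int_P 3 7 rfl, h7, JPP6]
    · rw [int_P 6 8 rfl, h8, JPP6]
    · rw [int_P 7 9 rfl, h9, h7, JPP6]
  · rintro i (rfl | rfl)
    · rw [int_P 8 0 rfl, JPP0]
    · rw [int_P 9 1 rfl, h1, JPP0]
end
end
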